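/- Let γ : ℝ → ℝ^d be a smooth well-curved curve, let α > 0 and β > 0, let 1 < p ≤ 2 with conjugate exponent p' = p/(p−1), and assume p' ≤ 2β/((d+1)α). Then T_γ maps L^p(log L)^{2(1/p−1/2)}(ℝ^d) into the Lorentz space L^{p,p'}(ℝ^d): there is a constant C such that for every Schwartz function f with ∫_{ℝ^d} |f(x)|^p (log(e + |f(x)|))^{2(1/p−1/2)} dx ≤ 1, one has ( p ∫_0^∞ λ^{p'−1} |{x ∈ ℝ^d : |T_γ f(x)| > λ}|^{p'/p} dλ )^{1/p'} ≤ C. -/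

import Mathlib

open MeasureTheory Real Filter
open scoped Topology ENNReal

/-- A smooth curve `γ : ℝ → ℝ^d` is *well-curved* if `γ(0) = 0` and the derivatives
`γ^{(k)}(0)`, `k ≥ 1`, span `ℝ^d`. -/
def IsWellCurved (d : ℕ) (γ : ℝ → EuclideanSpace ℝ (Fin d)) : Prop :=
  ContDiff ℝ (⊤ : ℕ∞) γ ∧ γ 0 = 0 ∧
    Submodule.span ℝ (Set.range fun k : ℕ => iteratedDeriv (k + 1) γ 0) = ⊤

/-- `T : f ↦ Tf` is the strongly singular integral along `γ` with kernel
`H_{α,β}(t) = t⁻¹|t|^{-α} e^{i|t|^{-β}}` if, for every Schwartz `f` and every `x`,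
`Tf(x)` is the limit as `ε → 0⁺` of `∫_{ε ≤ |t| ≤ 1} H_{α,β}(t) f(x - γ(t)) dt`. -/
def IsStronglySingularIntegralAlong (d : ℕ) (γ : ℝ → EuclideanSpace ℝ (Fin d))
    (α β : ℝ)
    (T : SchwartzMap (EuclideanSpace ℝ (Fin d)) ℂ → EuclideanSpace ℝ (Fin d) → ℂ) :
    Prop :=
  ∀ (f : SchwartzMap (EuclideanSpace ℝ (Fin d)) ℂ) (x : EuclideanSpace ℝ (Fin d)),
    Tendsto
      (fun ε : ℝ => ∫ t in {t : ℝ | ε ≤ |t| ∧ |t| ≤ 1},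
        (t : ℂ)⁻¹ * ((|t| ^ (-α) : ℝ) : ℂ) *
          Complex.exp (Complex.I * ((|t| ^ (-β) : ℝ) : ℂ)) * f (x - γ t))
      (𝓝[>] 0) (𝓝 (T f x))

lemma norm_integral_exp_le_two_div_add (φ φ₁ φ₂ : ℝ → ℝ) (h₁ : ∀ x, HasDerivAt φ (φ₁ x) x)
    (h₂ : ∀ x, HasDerivAt φ₁ (φ₂ x) x) (hc : Continuous φ₂) {a b μ : ℝ} (hab : a ≤ b)
    (hμ : 0 < μ) (hle : ∀ x ∈ Set.Icc a b, μ ≤ |φ₁ x|) :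
    ‖∫ x in a..b, Complex.exp (Complex.I * φ x)‖ ≤ 2 / μ + ∫ x in a..b, |φ₂ x| / φ₁ x ^ 2 := by
  have hφc : Continuous φ := continuous_iff_continuousAt.2 fun x => (h₁ x).continuousAt
  have hφ₁c : Continuous φ₁ := continuous_iff_continuousAt.2 fun x => (h₂ x).continuousAt
  have hne : ∀ x ∈ Set.Icc a b, φ₁ x ≠ 0 := fun x hx h0 => by
    have := hle x hx; rw [h0, abs_zero] at this; linarith
  have hu : Set.uIcc a b = Set.Icc a b := Set.uIcc_of_le hab
  set u : ℝ → ℂ := fun x => -Complex.I * ((φ₁ x)⁻¹ : ℝ)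
  set u' : ℝ → ℂ := fun x => -Complex.I * ((-φ₂ x / φ₁ x ^ 2 : ℝ) : ℂ)
  set v : ℝ → ℂ := fun x => Complex.exp (Complex.I * φ x)
  set v' : ℝ → ℂ := fun x => Complex.exp (Complex.I * φ x) * (Complex.I * φ₁ x)
  have hud : ∀ x ∈ Set.uIcc a b, HasDerivAt u (u' x) x := fun x hx =>
    (((h₂ x).inv (hne x (hu ▸ hx))).ofReal_comp).const_mul _
  have hvd : ∀ x ∈ Set.uIcc a b, HasDerivAt v (v' x) x := fun x _ =>
    (((h₁ x).ofReal_comp).const_mul Complex.I).cexp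
  have hv1 : ∀ x, ‖v x‖ = 1 := fun x => by
    simp only [v]; rw [mul_comm]; exact Complex.norm_exp_ofReal_mul_I _
  have hcq : ContinuousOn (fun x => φ₂ x / φ₁ x ^ 2) (Set.Icc a b) :=
    hc.continuousOn.div (hφ₁c.pow 2).continuousOn fun x hx => pow_ne_zero 2 (hne x hx)
  have hcu' : ContinuousOn u' (Set.Icc a b) := by
    refine continuousOn_const.mul (Complex.continuous_ofReal.comp_continuousOn ?_)
    simp only [neg_div]
    exact hcq.fun_neg
  have hcv' : Continuous v' := by fun_prop
  have key := intervalIntegral.integral_mul_deriv_eq_deriv_mul hud hvd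
    ((hu ▸ hcu').intervalIntegrable) (hcv'.intervalIntegrable _ _)
  have h1 : ∫ x in a..b, Complex.exp (Complex.I * φ x) = ∫ x in a..b, u x * v' x := by
    refine intervalIntegral.integral_congr fun x hx => ?_
    have : (φ₁ x : ℂ) ≠ 0 := by exact_mod_cast hne x (hu ▸ hx)
    simp only [u, v']
    push_cast
    field_simp
    simp
  have hub : ∀ x ∈ Set.Icc a b, ‖u x‖ ≤ 1 / μ := fun x hx => by
    simp only [u, norm_mul, norm_neg, Complex.norm_I, one_mul, Complex.norm_real, norm_inv,
      Real.norm_eq_abs, one_div]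
    exact inv_anti₀ hμ (hle x hx)
  rw [h1, key]
  have h3 : ‖∫ x in a..b, u' x * v x‖ ≤ ∫ x in a..b, |φ₂ x| / φ₁ x ^ 2 := by
    refine intervalIntegral.norm_integral_le_of_norm_le hab (.of_forall fun x _ => ?_) ?_
    · simp [u', hv1]
    · refine ContinuousOn.intervalIntegrable ?_
      rw [hu]
      exact hc.abs.continuousOn.div (hφ₁c.pow 2).continuousOn fun x hx => pow_ne_zero 2 (hne x hx)
  have hb := hub b (Set.right_mem_Icc.2 hab)
  have ha := hub a (Set.left_mem_Icc.2 hab)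
  calc _ ≤ ‖u b * v b‖ + ‖u a * v a‖ + ‖∫ x in a..b, u' x * v x‖ :=
        (norm_sub_le _ _).trans (add_le_add_left (norm_sub_le _ _) _)
    _ ≤ 1 / μ + 1 / μ + ∫ x in a..b, |φ₂ x| / φ₁ x ^ 2 := by
        rw [norm_mul (u b), norm_mul (u a), hv1, hv1, mul_one, mul_one]; gcongr
    _ = _ := by ring

lemma ContDiff.hasDerivAt_iteratedDeriv {φ : ℝ → ℝ} (hφ : ContDiff ℝ (⊤ : ℕ∞) φ) (k : ℕ) (x : ℝ) :
    HasDerivAt (iteratedDeriv k φ) (iteratedDeriv (k + 1) φ x) x := by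
  rw [iteratedDeriv_succ]
  exact (hφ.differentiable_iteratedDeriv k (by exact_mod_cast WithTop.coe_lt_top _) x).hasDerivAt

lemma ContDiff.continuous_iteratedDeriv_top {φ : ℝ → ℝ} (hφ : ContDiff ℝ (⊤ : ℕ∞) φ) (k : ℕ) :
    Continuous (iteratedDeriv k φ) :=
  hφ.continuous_iteratedDeriv k (by exact_mod_cast le_top)

/-- Van der Corput's first derivative test with a bounded second derivative. -/
lemma norm_integral_exp_le_of_second_deriv_le {φ : ℝ → ℝ} (hφ : ContDiff ℝ (⊤ : ℕ∞) φ)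
    {a b μ K : ℝ} (hab : a ≤ b) (hμ : 0 < μ) (hK : 0 ≤ K) (hb : b - a ≤ 1)
    (h1 : ∀ x ∈ Set.Icc a b, μ ≤ |iteratedDeriv 1 φ x|)
    (h2 : ∀ x ∈ Set.Icc a b, |iteratedDeriv 2 φ x| ≤ K * μ) :
    ‖∫ x in a..b, Complex.exp (Complex.I * φ x)‖ ≤ (2 + K) / μ := by
  have hφ0 : ∀ x, HasDerivAt φ (iteratedDeriv 1 φ x) x := fun x => by
    simpa using hφ.hasDerivAt_iteratedDeriv 0 x
  refine (norm_integral_exp_le_two_div_add φ _ _ hφ0 (hφ.hasDerivAt_iteratedDeriv 1)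
    (hφ.continuous_iteratedDeriv_top 2) hab hμ h1).trans ?_
  have : ∫ x in a..b, |iteratedDeriv 2 φ x| / iteratedDeriv 1 φ x ^ 2 ≤ (K / μ) * |b - a| := by
    refine (Real.le_norm_self _).trans ?_
    refine intervalIntegral.norm_integral_le_of_norm_le_const fun x hx => ?_
    rw [Set.uIoc_of_le hab] at hx
    have hx' := Set.Ioc_subset_Icc_self hx
    have hpos : 0 < |iteratedDeriv 1 φ x| := hμ.trans_le (h1 x hx')
    rw [Real.norm_eq_abs, abs_div, abs_abs, abs_pow, div_le_div_iff₀ (by positivity) hμ]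
    calc |iteratedDeriv 2 φ x| * μ ≤ K * μ * μ := by gcongr; exact h2 x hx'
      _ = K * μ ^ 2 := by ring
      _ ≤ K * |iteratedDeriv 1 φ x| ^ 2 := by gcongr; exact h1 x hx'
  have h3 : (K / μ) * |b - a| ≤ K / μ := by
    rw [abs_of_nonneg (by linarith)]
    exact mul_le_of_le_one_right (by positivity) hb
  rw [add_div]; linarith

lemma norm_integral_exp_le_of_monotone_deriv {φ : ℝ → ℝ} (hφ : ContDiff ℝ (⊤ : ℕ∞) φ)
    {a b μ : ℝ} (hab : a ≤ b) (hμ : 0 < μ)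
    (h1 : ∀ x ∈ Set.Icc a b, μ ≤ |iteratedDeriv 1 φ x|)
    (h2 : ∀ x ∈ Set.Icc a b, 0 ≤ iteratedDeriv 2 φ x) :
    ‖∫ x in a..b, Complex.exp (Complex.I * φ x)‖ ≤ 4 / μ := by
  have hφ0 : ∀ x, HasDerivAt φ (iteratedDeriv 1 φ x) x := fun x => by
    simpa using hφ.hasDerivAt_iteratedDeriv 0 x
  refine (norm_integral_exp_le_two_div_add φ _ _ hφ0 (hφ.hasDerivAt_iteratedDeriv 1)
    (hφ.continuous_iteratedDeriv_top 2) hab hμ h1).trans ?_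
  have hne : ∀ x ∈ Set.Icc a b, iteratedDeriv 1 φ x ≠ 0 := fun x hx h0 => by
    have := h1 x hx; rw [h0, abs_zero] at this; linarith
  have hu : Set.uIcc a b = Set.Icc a b := Set.uIcc_of_le hab
  have h4 : ∫ x in a..b, |iteratedDeriv 2 φ x| / iteratedDeriv 1 φ x ^ 2 =
      -(iteratedDeriv 1 φ b)⁻¹ - -(iteratedDeriv 1 φ a)⁻¹ := by
    refine intervalIntegral.integral_eq_sub_of_hasDerivAt
      (f := fun x => -(iteratedDeriv 1 φ x)⁻¹) (fun x hx => ?_) ?_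
    · rw [hu] at hx
      convert ((hφ.hasDerivAt_iteratedDeriv 1 x).fun_inv (hne x hx)).fun_neg using 1
      rw [abs_of_nonneg (h2 x hx)]; ring
    · refine ContinuousOn.intervalIntegrable ?_
      rw [hu]
      exact (hφ.continuous_iteratedDeriv_top 2).abs.continuousOn.div
        ((hφ.continuous_iteratedDeriv_top 1).pow 2).continuousOn
        fun x hx => pow_ne_zero 2 (hne x hx)
  have hinv : ∀ x ∈ Set.Icc a b, |(iteratedDeriv 1 φ x)⁻¹| ≤ 1 / μ := fun x hx => by
    rw [abs_inv, one_div]; exact inv_anti₀ hμ (h1 x hx)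
  have hA := abs_le.1 (hinv a (Set.left_mem_Icc.2 hab))
  have hB := abs_le.1 (hinv b (Set.right_mem_Icc.2 hab))
  have e2 : 2 / μ = 2 * (1 / μ) := by ring
  have e4 : 4 / μ = 4 * (1 / μ) := by ring
  rw [h4, e2, e4]; linarith [hA.1, hA.2, hB.1, hB.2]

lemma iteratedDeriv_neg_fun (k : ℕ) (φ : ℝ → ℝ) (x : ℝ) :
    iteratedDeriv k (fun y => -φ y) x = -iteratedDeriv k φ x :=
  iteratedDeriv_fun_neg k φ x

lemma norm_integral_exp_neg (φ : ℝ → ℝ) (a b : ℝ) :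
    ‖∫ x in a..b, Complex.exp (Complex.I * ((-φ x : ℝ) : ℂ))‖ =
      ‖∫ x in a..b, Complex.exp (Complex.I * φ x)‖ := by
  rw [← RCLike.norm_conj, intervalIntegral.intervalIntegral_eq_integral_uIoc,
    intervalIntegral.intervalIntegral_eq_integral_uIoc]
  simp only [norm_smul, RCLike.norm_conj]
  congr 1
  rw [← RCLike.norm_conj, ← integral_conj]
  congr 2
  ext x
  rw [← Complex.exp_conj]
  simp

lemma norm_integral_exp_le_sub (φ : ℝ → ℝ) {a b : ℝ} (hab : a ≤ b) :
    ‖∫ x in a..b, Complex.exp (Complex.I * φ x)‖ ≤ b - a := by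
  have := intervalIntegral.norm_integral_le_of_norm_le_const (a := a) (b := b) (C := 1)
    (f := fun x => Complex.exp (Complex.I * φ x)) fun x _ => by
      rw [mul_comm]; exact (Complex.norm_exp_ofReal_mul_I _).le
  rwa [one_mul, abs_of_nonneg (by linarith)] at this

/-- If `g' ≥ μ` on `[a, b]`, then `|g|` grows linearly away from some point. -/
lemma exists_mul_abs_sub_le_abs {g g' : ℝ → ℝ} (hg : ∀ x, HasDerivAt g (g' x) x) {a b μ : ℝ}
    (hab : a ≤ b) (h : ∀ x ∈ Set.Icc a b, μ ≤ g' x) :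
    ∃ c ∈ Set.Icc a b, ∀ x ∈ Set.Icc a b, μ * |x - c| ≤ |g x| := by
  have hc : Continuous g := continuous_iff_continuousAt.2 fun x => (hg x).continuousAt
  have mvt : ∀ x ∈ Set.Icc a b, ∀ y ∈ Set.Icc a b, x ≤ y → μ * (y - x) ≤ g y - g x :=
    (convex_Icc a b).mul_sub_le_image_sub_of_le_deriv hc.continuousOn
      (fun x _ => (hg x).differentiableAt.differentiableWithinAt)
      (fun x hx => by rw [(hg x).deriv]; exact h x (interior_subset hx))
  have key : ∀ c ∈ Set.Icc a b, (∀ x ∈ Set.Icc a b, c ≤ x → 0 ≤ g c ∨ x = c) →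
      (∀ x ∈ Set.Icc a b, x ≤ c → g c ≤ 0 ∨ x = c) →
      ∀ x ∈ Set.Icc a b, μ * |x - c| ≤ |g x| := by
    intro c hcm h1 h2 x hx
    rcases le_total c x with hcx | hxc
    · rcases h1 x hx hcx with h0 | rfl
      · rw [abs_of_nonneg (sub_nonneg.2 hcx)]
        have := mvt c hcm x hx hcx
        exact (by linarith : μ * (x - c) ≤ g x).trans (le_abs_self _)
      · simp
    · rcases h2 x hx hxc with h0 | rfl
      · rw [abs_sub_comm, abs_of_nonneg (sub_nonneg.2 hxc)]
        have := mvt x hx c hcm hxc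
        exact (by linarith : μ * (c - x) ≤ -g x).trans (neg_le_abs _)
      · simp
  have ham := Set.left_mem_Icc.2 hab
  have hbm := Set.right_mem_Icc.2 hab
  by_cases hga : 0 ≤ g a
  · exact ⟨a, ham, key a ham (fun _ _ _ => .inl hga) fun x hx h => .inr (le_antisymm h hx.1)⟩
  by_cases hgb : g b ≤ 0
  · exact ⟨b, hbm, key b hbm (fun x hx h => .inr (le_antisymm hx.2 h)) fun _ _ _ => .inl hgb⟩
  push Not at hga hgb
  obtain ⟨c, hcm, hc0⟩ := intermediate_value_Icc hab hc.continuousOn ⟨hga.le, hgb.le⟩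
  exact ⟨c, hcm, key c hcm (fun _ _ _ => .inl hc0.ge) fun _ _ _ => .inl hc0.le⟩

lemma vanDerCorput_succ_of_pos {k : ℕ} {C : ℝ} (hC : 0 < C)
    (H : ∀ φ : ℝ → ℝ, ContDiff ℝ (⊤ : ℕ∞) φ → ∀ a b μ : ℝ, a ≤ b → 0 < μ →
      (∀ x ∈ Set.Icc a b, μ ≤ |iteratedDeriv (k + 1) φ x|) →
      (∀ x ∈ Set.Icc a b, 0 ≤ iteratedDeriv (k + 2) φ x) →
      ‖∫ x in a..b, Complex.exp (Complex.I * φ x)‖ ≤ C * μ ^ (-(1 / (k + 1 : ℝ))))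
    {φ : ℝ → ℝ} (hφ : ContDiff ℝ (⊤ : ℕ∞) φ) {a b μ : ℝ} (hab : a ≤ b) (hμ : 0 < μ)
    (h : ∀ x ∈ Set.Icc a b, μ ≤ iteratedDeriv (k + 2) φ x) :
    ‖∫ x in a..b, Complex.exp (Complex.I * φ x)‖ ≤
      (2 + 2 * C) * μ ^ (-(1 / (k + 2 : ℝ))) := by
  obtain ⟨c, hc, hcb⟩ := exists_mul_abs_sub_le_abs (hφ.hasDerivAt_iteratedDeriv (k + 1)) hab h
  set δ := μ ^ (-(1 / (k + 2 : ℝ))) with hδ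
  have hδ0 : 0 < δ := Real.rpow_pos_of_pos hμ _
  have hpow : (μ * δ) ^ (-(1 / (k + 1 : ℝ))) = δ := by
    rw [hδ]
    nth_rewrite 1 [← Real.rpow_one μ]
    rw [← Real.rpow_add hμ, ← Real.rpow_mul hμ.le]
    congr 1
    have : (k : ℝ) + 2 ≠ 0 := by positivity
    have : (k : ℝ) + 1 ≠ 0 := by positivity
    field_simp
    ring
  set x₁ := max a (c - δ)
  set x₂ := min b (c + δ)
  have h1 : a ≤ x₁ := le_max_left _ _
  have h2 : x₁ ≤ c := max_le hc.1 (by linarith)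
  have h3 : c ≤ x₂ := le_min hc.2 (by linarith)
  have h4 : x₂ ≤ b := min_le_left _ _
  have hci : ∀ s t, IntervalIntegrable (fun x => Complex.exp (Complex.I * φ x)) volume s t :=
    fun s t => by
      have := hφ.continuous
      exact Continuous.intervalIntegrable (by fun_prop) _ _
  have hL : ‖∫ x in a..x₁, Complex.exp (Complex.I * φ x)‖ ≤ C * δ := by
    rcases le_total a (c - δ) with h | h
    · rw [← hpow]
      refine H φ hφ a x₁ (μ * δ) h1 (by positivity) (fun x hx => ?_) fun x hx =>
        hμ.le.trans (‹∀ x ∈ Set.Icc a b, μ ≤ iteratedDeriv (k + 2) φ x› x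
          ⟨hx.1, hx.2.trans (h2.trans hc.2)⟩)
      refine le_trans ?_ (hcb x ⟨hx.1, hx.2.trans (h2.trans hc.2)⟩)
      gcongr
      have : x ≤ c - δ := hx.2.trans (max_eq_right h).le
      rw [abs_sub_comm]
      exact (by linarith : δ ≤ c - x).trans (le_abs_self _)
    · have : x₁ = a := max_eq_left h
      rw [this]; simp; positivity
  have hR : ‖∫ x in x₂..b, Complex.exp (Complex.I * φ x)‖ ≤ C * δ := by
    rcases le_total (c + δ) b with h | h
    · rw [← hpow]
      refine H φ hφ x₂ b (μ * δ) h4 (by positivity) (fun x hx => ?_) fun x hx =>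
        hμ.le.trans (‹∀ x ∈ Set.Icc a b, μ ≤ iteratedDeriv (k + 2) φ x› x
          ⟨(hc.1.trans h3).trans hx.1, hx.2⟩)
      refine le_trans ?_ (hcb x ⟨(hc.1.trans h3).trans hx.1, hx.2⟩)
      gcongr
      have : c + δ ≤ x := (min_eq_right h).ge.trans hx.1
      exact (by linarith : δ ≤ x - c).trans (le_abs_self _)
    · have : x₂ = b := min_eq_left h
      rw [this]; simp; positivity
  have hM : ‖∫ x in x₁..x₂, Complex.exp (Complex.I * φ x)‖ ≤ 2 * δ := by
    refine (norm_integral_exp_le_sub φ (h2.trans h3)).trans ?_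
    have : c - δ ≤ x₁ := le_max_right _ _
    have : x₂ ≤ c + δ := min_le_right _ _
    linarith
  rw [← intervalIntegral.integral_add_adjacent_intervals (hci a x₁) (hci x₁ b),
    ← intervalIntegral.integral_add_adjacent_intervals (hci x₁ x₂) (hci x₂ b)]
  calc _ ≤ C * δ + (2 * δ + C * δ) :=
        (norm_add_le _ _).trans (add_le_add hL ((norm_add_le _ _).trans (add_le_add hM hR)))
    _ = _ := by ring

lemma vanDerCorput_succ {k : ℕ} {C : ℝ} (hC : 0 < C)
    (H : ∀ φ : ℝ → ℝ, ContDiff ℝ (⊤ : ℕ∞) φ → ∀ a b μ : ℝ, a ≤ b → 0 < μ →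
      (∀ x ∈ Set.Icc a b, μ ≤ |iteratedDeriv (k + 1) φ x|) →
      (∀ x ∈ Set.Icc a b, 0 ≤ iteratedDeriv (k + 2) φ x) →
      ‖∫ x in a..b, Complex.exp (Complex.I * φ x)‖ ≤ C * μ ^ (-(1 / (k + 1 : ℝ))))
    {φ : ℝ → ℝ} (hφ : ContDiff ℝ (⊤ : ℕ∞) φ) {a b μ : ℝ} (hab : a ≤ b) (hμ : 0 < μ)
    (h : ∀ x ∈ Set.Icc a b, μ ≤ |iteratedDeriv (k + 2) φ x|) :
    ‖∫ x in a..b, Complex.exp (Complex.I * φ x)‖ ≤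
      (2 + 2 * C) * μ ^ (-(1 / (k + 2 : ℝ))) := by
  have hsign : (∀ x ∈ Set.Icc a b, 0 ≤ iteratedDeriv (k + 2) φ x) ∨
      ∀ x ∈ Set.Icc a b, iteratedDeriv (k + 2) φ x ≤ 0 := by
    by_contra! hcon
    obtain ⟨⟨x, hx, hx0⟩, y, hy, hy0⟩ := hcon
    obtain ⟨z, hz, hz0⟩ := (isPreconnected_Icc (a := a) (b := b)).intermediate_value hx hy
      (hφ.continuous_iteratedDeriv_top (k + 2)).continuousOn ⟨hx0.le, hy0.le⟩
    have := h z hz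
    rw [hz0, abs_zero] at this
    linarith
  rcases hsign with hs | hs
  · exact vanDerCorput_succ_of_pos hC H hφ hab hμ fun x hx => by
      simpa [abs_of_nonneg (hs x hx)] using h x hx
  · rw [← norm_integral_exp_neg]
    refine vanDerCorput_succ_of_pos hC H hφ.neg hab hμ fun x hx => ?_
    have := h x hx
    rw [abs_of_nonpos (hs x hx)] at this
    rwa [iteratedDeriv_neg_fun]

lemma vanDerCorput_monotone (k : ℕ) : ∃ C : ℝ, 0 < C ∧
    ∀ φ : ℝ → ℝ, ContDiff ℝ (⊤ : ℕ∞) φ → ∀ a b μ : ℝ, a ≤ b → 0 < μ →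
      (∀ x ∈ Set.Icc a b, μ ≤ |iteratedDeriv (k + 1) φ x|) →
      (∀ x ∈ Set.Icc a b, 0 ≤ iteratedDeriv (k + 2) φ x) →
      ‖∫ x in a..b, Complex.exp (Complex.I * φ x)‖ ≤ C * μ ^ (-(1 / (k + 1 : ℝ))) := by
  induction k with
  | zero =>
    refine ⟨4, by norm_num, fun φ hφ a b μ hab hμ h1 h2 => ?_⟩
    refine (norm_integral_exp_le_of_monotone_deriv hφ hab hμ h1 h2).trans (le_of_eq ?_)
    simp [Real.rpow_neg_one, div_eq_mul_inv]
  | succ k ih =>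
    obtain ⟨C, hC, H⟩ := ih
    refine ⟨2 + 2 * C, by positivity, fun φ hφ a b μ hab hμ h1 _ => ?_⟩
    have := vanDerCorput_succ hC H hφ hab hμ h1
    push_cast
    convert this using 4
    ring

/-- Van der Corput's lemma for the `k`-th derivative; the second derivative bound is only
needed for `k = 1`. -/
theorem vanDerCorput (k : ℕ) {K : ℝ} (hK : 0 ≤ K) : ∃ C : ℝ, 0 < C ∧
    ∀ φ : ℝ → ℝ, ContDiff ℝ (⊤ : ℕ∞) φ → ∀ a b μ : ℝ, a ≤ b → b - a ≤ 1 → 0 < μ →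
      (∀ x ∈ Set.Icc a b, μ ≤ |iteratedDeriv (k + 1) φ x|) →
      (∀ x ∈ Set.Icc a b, |iteratedDeriv 2 φ x| ≤ K * μ) →
      ‖∫ x in a..b, Complex.exp (Complex.I * φ x)‖ ≤ C * μ ^ (-(1 / (k + 1 : ℝ))) := by
  rcases k with _ | k
  · refine ⟨2 + K, by positivity, fun φ hφ a b μ hab hb hμ h1 h2 => ?_⟩
    refine (norm_integral_exp_le_of_second_deriv_le hφ hab hμ hK hb h1 h2).trans (le_of_eq ?_)
    simp [Real.rpow_neg_one, div_eq_mul_inv]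
  · obtain ⟨C, hC, H⟩ := vanDerCorput_monotone k
    refine ⟨2 + 2 * C, by positivity, fun φ hφ a b μ hab _ hμ h1 _ => ?_⟩
    have := vanDerCorput_succ hC H hφ hab hμ h1
    push_cast
    convert this using 4
    ring

lemma exists_vanDerCorput_const (n : ℕ) {K : ℝ} (hK : 0 ≤ K) : ∃ C : ℝ, 0 < C ∧
    ∀ k < n, ∀ φ : ℝ → ℝ, ContDiff ℝ (⊤ : ℕ∞) φ → ∀ a b μ : ℝ, a ≤ b → b - a ≤ 1 → 0 < μ →
      (∀ x ∈ Set.Icc a b, μ ≤ |iteratedDeriv (k + 1) φ x|) →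
      (∀ x ∈ Set.Icc a b, |iteratedDeriv 2 φ x| ≤ K * μ) →
      ‖∫ x in a..b, Complex.exp (Complex.I * φ x)‖ ≤ C * μ ^ (-(1 / (k + 1 : ℝ))) := by
  choose C hC H using fun k => vanDerCorput k hK
  have hle : ∀ k < n, C k ≤ 1 + ∑ i ∈ Finset.range n, C i := fun k hk => by
    have := Finset.single_le_sum (f := C) (fun i _ => (hC i).le) (Finset.mem_range.2 hk)
    linarith
  refine ⟨1 + ∑ i ∈ Finset.range n, C i, ?_, fun k hk φ hφ a b μ hab hb hμ h1 h2 => ?_⟩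
  · have := Finset.sum_nonneg (s := Finset.range n) (f := C) fun i _ => (hC i).le
    linarith
  · refine (H k φ hφ a b μ hab hb hμ h1 h2).trans ?_
    gcongr
    exact hle k hk

/-- If at each point of a short interval some derivative of order at most `n` of `φ` is comparable
to `Λ`, and all derivatives up to order `n + 1` are `O(Λ)`, then `∫ e^{iφ}` is `O(Λ^{-1/n})`. -/
theorem norm_integral_exp_le_of_exists_deriv {n : ℕ} (hn : 0 < n) {c C : ℝ} (hc : 0 < c)
    (hC : 0 < C) : ∃ C' : ℝ, 0 < C' ∧
    ∀ φ : ℝ → ℝ, ContDiff ℝ (⊤ : ℕ∞) φ → ∀ a b Λ : ℝ, a ≤ b → b - a ≤ 1 → 1 ≤ Λ →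
      (∀ x ∈ Set.Icc a b, ∃ k < n, c * Λ ≤ |iteratedDeriv (k + 1) φ x|) →
      (∀ x ∈ Set.Icc a b, ∀ k ≤ n, |iteratedDeriv (k + 1) φ x| ≤ C * Λ) →
      ‖∫ x in a..b, Complex.exp (Complex.I * φ x)‖ ≤ C' * Λ ^ (-(1 / (n : ℝ))) := by
  obtain ⟨B, hB, H⟩ := exists_vanDerCorput_const n (K := 2 * C / c) (by positivity)
  obtain ⟨N, hN⟩ := exists_nat_gt (2 * C / c)
  have hN0 : (0 : ℝ) < N := lt_trans (by positivity) hN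
  set D : ℝ := max 1 ((c / 2) ^ (-1 : ℝ))
  have hD : 1 ≤ D := le_max_left _ _
  refine ⟨N * (B * D), by positivity, fun φ hφ a b Λ hab hb hΛ hlow hup => ?_⟩
  have hΛ0 : 0 < Λ := by linarith
  set h := (b - a) / N with hh
  have hh0 : 0 ≤ h := div_nonneg (by linarith) hN0.le
  have hNh : N * h = b - a := by rw [hh]; field_simp
  set pt : ℕ → ℝ := fun i => a + i * h
  have hci : ∀ s t, IntervalIntegrable (fun x => Complex.exp (Complex.I * φ x)) volume s t :=
    fun s t => by
      have := hφ.continuous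
      exact Continuous.intervalIntegrable (by fun_prop) _ _
  have hsum : ∑ i ∈ Finset.range N, ∫ x in pt i..pt (i + 1), Complex.exp (Complex.I * φ x) =
      ∫ x in a..b, Complex.exp (Complex.I * φ x) := by
    rw [intervalIntegral.sum_integral_adjacent_intervals fun k _ => hci _ _]
    congr 1
    · simp [pt]
    · simp only [pt]; linarith
  have hpiece : ∀ i < N, ‖∫ x in pt i..pt (i + 1), Complex.exp (Complex.I * φ x)‖ ≤
      B * D * Λ ^ (-(1 / (n : ℝ))) := by
    intro i hi
    have hstep : pt (i + 1) = pt i + h := by simp only [pt]; push_cast; ring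
    have hai : a ≤ pt i := by simp only [pt]; have : (0:ℝ) ≤ i * h := by positivity
                              linarith
    have hib : pt (i + 1) ≤ b := by
      simp only [pt]
      have h1 : ((i + 1 : ℕ) : ℝ) ≤ N := by exact_mod_cast hi
      have := mul_le_mul_of_nonneg_right h1 hh0
      linarith
    have hh1 : h ≤ 1 := by linarith
    have hle : pt i ≤ pt (i + 1) := by linarith
    have hsub : ∀ x ∈ Set.Icc (pt i) (pt (i + 1)), x ∈ Set.Icc a b := fun x hx =>
      ⟨hai.trans hx.1, hx.2.trans hib⟩
    obtain ⟨k, hk, hkl⟩ := hlow (pt i) (hsub _ ⟨le_rfl, hle⟩)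
    have hCh : C * h ≤ c / 2 := by
      have h1 : C * h ≤ C * (1 / N) := by
        rw [hh]
        gcongr
      have h2 : C * (1 / N) ≤ c / 2 := by
        rw [div_lt_iff₀ hc] at hN
        rw [mul_one_div, div_le_iff₀ hN0]
        linarith
      exact h1.trans h2
    have hlow' : ∀ x ∈ Set.Icc (pt i) (pt (i + 1)), c / 2 * Λ ≤ |iteratedDeriv (k + 1) φ x| := by
      intro x hx
      have hmv : |iteratedDeriv (k + 1) φ x - iteratedDeriv (k + 1) φ (pt i)| ≤
          C * Λ * |x - pt i| :=
        (convex_Icc (pt i) (pt (i + 1))).norm_image_sub_le_of_norm_hasDerivWithin_le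
          (fun y _ => (hφ.hasDerivAt_iteratedDeriv (k + 1) y).hasDerivWithinAt)
          (fun y hy => hup y (hsub y hy) (k + 1) hk) ⟨le_rfl, hle⟩ hx
      have h1 : |x - pt i| ≤ h := by
        rw [abs_of_nonneg (by linarith [hx.1])]; linarith [hx.2]
      have h2 : C * Λ * |x - pt i| ≤ c / 2 * Λ := by
        calc C * Λ * |x - pt i| ≤ C * Λ * h := by gcongr
          _ = C * h * Λ := by ring
          _ ≤ _ := by gcongr
      have h3 := abs_sub_abs_le_abs_sub (iteratedDeriv (k + 1) φ (pt i)) (iteratedDeriv (k + 1) φ x)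
      rw [abs_sub_comm] at h3
      linarith
    refine (H k hk φ hφ _ _ (c / 2 * Λ) hle (by linarith) (by positivity) hlow'
      fun x hx => ?_).trans ?_
    · refine (hup x (hsub x hx) 1 hn).trans (le_of_eq ?_)
      field_simp
    · rw [Real.mul_rpow (by positivity) hΛ0.le, mul_assoc]
      have hk1 : (0 : ℝ) < k + 1 := by positivity
      have e1 : (c / 2) ^ (-(1 / (k + 1 : ℝ))) ≤ D := by
        rcases le_total 1 (c / 2) with h | h
        · exact (Real.rpow_le_one_of_one_le_of_nonpos h (by
            rw [neg_nonpos]; positivity)).trans hD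
        · refine (Real.rpow_le_rpow_of_exponent_ge (by positivity) h ?_).trans (le_max_right _ _)
          rw [neg_le_neg_iff, div_le_one hk1]
          linarith [(Nat.cast_nonneg k : (0:ℝ) ≤ k)]
      have e2 : Λ ^ (-(1 / (k + 1 : ℝ))) ≤ Λ ^ (-(1 / (n : ℝ))) := by
        refine Real.rpow_le_rpow_of_exponent_le hΛ ?_
        rw [neg_le_neg_iff]
        refine one_div_le_one_div_of_le hk1 ?_
        exact_mod_cast hk
      gcongr
  rw [← hsum]
  refine (norm_sum_le_of_le _ fun i hi => hpiece i (Finset.mem_range.1 hi)).trans (le_of_eq ?_)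
  simp; ring

lemma norm_integral_mul_exp_le {φ : ℝ → ℝ} (hφ : Continuous φ) {α a b M : ℝ} (hα : 0 ≤ α)
    (hab : a ≤ b)
    (h : ∀ x ∈ Set.Icc a b, ‖∫ y in a..x, Complex.exp (Complex.I * φ y)‖ ≤ M) :
    ‖∫ x in a..b, (Real.exp (α * x) : ℂ) * Complex.exp (Complex.I * φ x)‖ ≤
      2 * Real.exp (α * b) * M := by
  have hcont : Continuous fun y => Complex.exp (Complex.I * φ y) := by fun_prop
  set F : ℝ → ℂ := fun x => ∫ y in a..x, Complex.exp (Complex.I * φ y)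
  have hF : ∀ x, HasDerivAt F (Complex.exp (Complex.I * φ x)) x := fun x =>
    intervalIntegral.integral_hasDerivAt_right (hcont.intervalIntegrable _ _)
      (hcont.stronglyMeasurableAtFilter _ _) hcont.continuousAt
  have hFc : Continuous F := continuous_iff_continuousAt.2 fun x => (hF x).continuousAt
  have hA' : ∀ x, HasDerivAt (fun x => Real.exp (α * x)) (Real.exp (α * x) * α) x := fun x => by
    simpa using ((hasDerivAt_id x).const_mul α).exp
  have hA : ∀ x, HasDerivAt (fun x => (Real.exp (α * x) : ℂ))
      ((Real.exp (α * x) * α : ℝ) : ℂ) x := fun x => (hA' x).ofReal_comp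
  have hM : 0 ≤ M := (norm_nonneg _).trans (h a ⟨le_rfl, hab⟩)
  rw [intervalIntegral.integral_mul_deriv_eq_deriv_mul (fun x _ => hA x) (fun x _ => hF x)
    (Continuous.intervalIntegrable (by fun_prop) _ _) (hcont.intervalIntegrable _ _)]
  have hFa : F a = 0 := intervalIntegral.integral_same
  have h1 : ‖∫ x in a..b, ((Real.exp (α * x) * α : ℝ) : ℂ) * F x‖ ≤
      ∫ x in a..b, (Real.exp (α * x) * α) * M := by
    refine intervalIntegral.norm_integral_le_of_norm_le hab (.of_forall fun x hx => ?_)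
      (Continuous.intervalIntegrable (by fun_prop) _ _)
    rw [norm_mul, Complex.norm_real, Real.norm_of_nonneg (by positivity)]
    gcongr
    exact h x (Set.Ioc_subset_Icc_self hx)
  have h2 : ∫ x in a..b, (Real.exp (α * x) * α) * M =
      (Real.exp (α * b) - Real.exp (α * a)) * M := by
    rw [intervalIntegral.integral_mul_const,
      intervalIntegral.integral_eq_sub_of_hasDerivAt (fun x _ => hA' x)
        (Continuous.intervalIntegrable (by fun_prop) _ _)]
  have h3 : ‖(Real.exp (α * b) : ℂ) * F b‖ ≤ Real.exp (α * b) * M := by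
    rw [norm_mul, Complex.norm_real, Real.norm_of_nonneg (Real.exp_nonneg _)]
    gcongr
    exact h b ⟨hab, le_rfl⟩
  rw [hFa, mul_zero, sub_zero]
  refine (norm_sub_le _ _).trans ((add_le_add h3 (h1.trans h2.le)).trans ?_)
  have : 0 ≤ Real.exp (α * a) * M := by positivity
  linarith

theorem exists_abs_le_mul_pow_of_iteratedDeriv_eq_zero (n : ℕ) {f : ℝ → ℝ}
    (hf : ContDiff ℝ (⊤ : ℕ∞) f) (h0 : ∀ m < n, iteratedDeriv m f 0 = 0) :
    ∃ C > 0, ∀ t ∈ Set.Icc (0 : ℝ) 1, |f t| ≤ C * t ^ n := by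
  induction n generalizing f with
  | zero =>
    obtain ⟨C, hC⟩ := isCompact_Icc.exists_bound_of_continuousOn
      (s := Set.Icc (0 : ℝ) 1) hf.continuous.continuousOn
    refine ⟨|C| + 1, by positivity, fun t ht => ?_⟩
    have h1 := hC t ht
    rw [Real.norm_eq_abs] at h1
    rw [pow_zero, mul_one]
    linarith [le_abs_self C]
  | succ n ih =>
    have hd : ContDiff ℝ (⊤ : ℕ∞) (deriv f) := by
      have := hf.iterate_deriv 1
      simpa using this
    obtain ⟨C, hC, h⟩ := ih hd fun m hm => by
      have := h0 (m + 1) (by omega)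
      rwa [iteratedDeriv_succ'] at this
    refine ⟨C, hC, fun t ht => ?_⟩
    have h00 : f 0 = 0 := by simpa using h0 0 (by omega)
    have key : ‖f t - f 0‖ ≤ C * t ^ n * ‖t - 0‖ := by
      refine (convex_Icc (0 : ℝ) t).norm_image_sub_le_of_norm_deriv_le
        (fun x _ => (hf.differentiable (by simp)).differentiableAt) (fun x hx => ?_)
        (Set.left_mem_Icc.2 ht.1) (Set.right_mem_Icc.2 ht.1)
      refine (h x ⟨hx.1, hx.2.trans ht.2⟩).trans ?_
      have := pow_le_pow_left₀ hx.1 hx.2 n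
      gcongr
    rw [h00, sub_zero, sub_zero, Real.norm_eq_abs, Real.norm_eq_abs, abs_of_nonneg ht.1] at key
    rw [pow_succ, ← mul_assoc]
    exact key

theorem iteratedDeriv_id_mul_deriv {f : ℝ → ℝ} (hf : ContDiff ℝ (⊤ : ℕ∞) f) (m : ℕ) (x : ℝ) :
    iteratedDeriv m (fun t => t * deriv f t) x =
      x * iteratedDeriv (m + 1) f x + m * iteratedDeriv m f x := by
  induction m generalizing x with
  | zero => simp [iteratedDeriv_one]
  | succ m ih =>
    rw [iteratedDeriv_succ, funext ih]
    have h := ((hasDerivAt_id x).mul (hf.hasDerivAt_iteratedDeriv (m + 1) x)).add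
      ((hf.hasDerivAt_iteratedDeriv m x).const_mul (m : ℝ))
    refine h.deriv.trans ?_
    simp only [id]
    push_cast
    ring

theorem exists_abs_iteratedDeriv_comp_exp_neg_le (n k : ℕ) {f : ℝ → ℝ}
    (hf : ContDiff ℝ (⊤ : ℕ∞) f) (h0 : ∀ m < n, iteratedDeriv m f 0 = 0) :
    ∃ C > 0, ∀ u : ℝ, 0 ≤ u →
      |iteratedDeriv k (fun u => f (Real.exp (-u))) u| ≤ C * Real.exp (-(n * u)) := by
  induction k generalizing f with
  | zero =>
    obtain ⟨C, hC, h⟩ := exists_abs_le_mul_pow_of_iteratedDeriv_eq_zero n hf h0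
    refine ⟨C, hC, fun u hu => ?_⟩
    have := h (Real.exp (-u)) ⟨(Real.exp_pos _).le, Real.exp_le_one_iff.2 (by linarith)⟩
    rw [← Real.exp_nat_mul] at this
    simpa [iteratedDeriv_zero] using this
  | succ k ih =>
    have hd : ContDiff ℝ (⊤ : ℕ∞) (deriv f) := by
      have := hf.iterate_deriv 1
      simpa using this
    have hg : ContDiff ℝ (⊤ : ℕ∞) (fun t => t * deriv f t) := contDiff_id.mul hd
    obtain ⟨C, hC, h⟩ := ih hg fun m hm => by
      rw [iteratedDeriv_id_mul_deriv hf, h0 m hm]; ring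
    refine ⟨C, hC, fun u hu => ?_⟩
    have hder : deriv (fun u => f (Real.exp (-u))) =
        fun u => -(Real.exp (-u) * deriv f (Real.exp (-u))) := by
      funext u
      have h1 : HasDerivAt (fun u : ℝ => Real.exp (-u)) (Real.exp (-u) * (-1)) u :=
        (hasDerivAt_neg u).exp
      have h2 := ((hf.differentiable (by simp)).differentiableAt (x := Real.exp (-u))).hasDerivAt.comp
        u h1
      refine h2.deriv.trans ?_
      ring
    rw [iteratedDeriv_succ', hder, iteratedDeriv_fun_neg, abs_neg]
    exact h u hu

theorem iteratedDeriv_exp_mul (b : ℝ) (k : ℕ) (u : ℝ) :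
    iteratedDeriv k (fun u => Real.exp (b * u)) u = b ^ k * Real.exp (b * u) := by
  induction k generalizing u with
  | zero => simp
  | succ k ih =>
    rw [iteratedDeriv_succ, funext ih]
    have h := (((hasDerivAt_id u).const_mul b).exp).const_mul (b ^ k)
    refine h.deriv.trans ?_
    simp only [id]
    ring

/-- Leading-order asymptotics, with all derivatives, of `u ↦ g (e^{-u})` when `g` vanishes to
order exactly `a` at the origin with Taylor coefficient `1`. -/
theorem exists_abs_iteratedDeriv_comp_exp_neg_sub_le (a k : ℕ) {g : ℝ → ℝ}
    (hg : ContDiff ℝ (⊤ : ℕ∞) g) (h0 : ∀ m < a, iteratedDeriv m g 0 = 0)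
    (ha : iteratedDeriv a g 0 = (a.factorial : ℝ)) :
    ∃ C > 0, ∀ u : ℝ, 0 ≤ u →
      |iteratedDeriv k (fun u => g (Real.exp (-u))) u - (-a : ℝ) ^ k * Real.exp (-a * u)| ≤
        C * Real.exp (-u) * Real.exp (-a * u) := by
  have hpow : ContDiff ℝ (⊤ : ℕ∞) (fun t : ℝ => t ^ a) := contDiff_id.pow a
  have hf : ContDiff ℝ (⊤ : ℕ∞) (fun t => g t - t ^ a) := hg.sub hpow
  obtain ⟨C, hC, h⟩ := exists_abs_iteratedDeriv_comp_exp_neg_le (a + 1) k hf fun m hm => by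
    rw [iteratedDeriv_fun_sub (hg.contDiffAt.of_le (by exact_mod_cast le_top))
      (hpow.contDiffAt.of_le (by exact_mod_cast le_top)), iteratedDeriv_fun_pow_zero]
    rcases Nat.lt_succ_iff_lt_or_eq.1 hm with h | h
    · rw [h0 m h]; simp [h.ne]
    · subst h; rw [ha]; simp
  refine ⟨C, hC, fun u hu => ?_⟩
  have h1 := h u hu
  have hge : ContDiff ℝ (⊤ : ℕ∞) (fun u => g (Real.exp (-u))) :=
    hg.comp (Real.contDiff_exp.comp contDiff_neg)
  have hpe : ContDiff ℝ (⊤ : ℕ∞) (fun u : ℝ => Real.exp (-u) ^ a) :=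
    hpow.comp (Real.contDiff_exp.comp contDiff_neg)
  rw [iteratedDeriv_fun_sub (hge.contDiffAt.of_le (by exact_mod_cast le_top))
    (hpe.contDiffAt.of_le (by exact_mod_cast le_top))] at h1
  have h2 : (fun u : ℝ => Real.exp (-u) ^ a) = fun u => Real.exp (-a * u) := by
    funext u; rw [← Real.exp_nat_mul]; ring_nf
  rw [h2, iteratedDeriv_exp_mul] at h1
  rw [mul_assoc, ← Real.exp_add]
  refine h1.trans (le_of_eq ?_)
  congr 2
  push_cast; ring

theorem exists_spanning_distinct_orders (n : ℕ) {V : Type*} [AddCommGroup V] [Module ℝ V]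
    [FiniteDimensional ℝ V] (hV : Module.finrank ℝ V = n) (L : ℕ → V →ₗ[ℝ] ℝ)
    (hL : ∀ v, (∀ m, L m v = 0) → v = 0) :
    ∃ (u : Fin n → V) (a : Fin n → ℕ), Function.Injective a ∧
      (∀ i, ∀ m < a i, L m (u i) = 0) ∧ (∀ i, L (a i) (u i) ≠ 0) ∧
      ∀ v, ∃ ζ : Fin n → ℝ, v = ∑ i, ζ i • u i := by
  induction n generalizing V with
  | zero =>
    have : Subsingleton V := Module.finrank_zero_iff.1 hV
    exact ⟨Fin.elim0, Fin.elim0, fun i => i.elim0, fun i => i.elim0, fun i => i.elim0,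
      fun v => ⟨Fin.elim0, Subsingleton.elim _ _⟩⟩
  | succ n ih =>
    classical
    have hex : ∃ a, L a ≠ 0 := by
      by_contra! hall
      have : Subsingleton V := ⟨fun x y => by
        rw [hL x fun m => by simp [hall m], hL y fun m => by simp [hall m]]⟩
      rw [Module.finrank_zero_of_subsingleton] at hV
      omega
    set a₀ := Nat.find hex with ha₀
    have ha : L a₀ ≠ 0 := Nat.find_spec hex
    have hlt : ∀ m < a₀, L m = 0 := fun m hm => not_not.1 (Nat.find_min hex hm)
    obtain ⟨u₀, hu₀⟩ : ∃ u, L a₀ u ≠ 0 := by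
      by_contra! hall
      exact ha (LinearMap.ext hall)
    have hrank := Module.Dual.finrank_ker_add_one_of_ne_zero (f := L a₀) ha
    obtain ⟨u, a, hainj, hvan, hne, hsp⟩ := ih (V := LinearMap.ker (L a₀)) (by omega)
      (fun m => (L m).comp (LinearMap.ker (L a₀)).subtype)
      (fun v hv => Subtype.ext (hL v hv))
    have hgt : ∀ i, a i ≠ a₀ := fun i hi => hne i (by
      rw [hi]; exact LinearMap.mem_ker.1 (u i).2)
    refine ⟨Fin.cons u₀ fun i => (u i : V), Fin.cons a₀ a, ?_, ?_, ?_, ?_⟩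
    · rw [Fin.cons_injective_iff]
      exact ⟨by rintro ⟨i, hi⟩; exact hgt i hi, hainj⟩
    · refine Fin.cases ?_ ?_
      · intro m hm
        simp only [Fin.cons_zero] at hm ⊢
        simp [hlt m hm]
      · intro i m hm
        simp only [Fin.cons_succ] at hm ⊢
        exact hvan i m hm
    · refine Fin.cases ?_ ?_
      · simpa using hu₀
      · intro i
        simpa using hne i
    · intro v
      obtain ⟨ζ, hζ⟩ := hsp ⟨v - (L a₀ v / L a₀ u₀) • u₀, by
        rw [LinearMap.mem_ker, map_sub, map_smul, smul_eq_mul, div_mul_cancel₀ _ hu₀, sub_self]⟩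
      refine ⟨Fin.cons (L a₀ v / L a₀ u₀) ζ, ?_⟩
      have := congrArg Subtype.val hζ
      simp only [AddSubmonoidClass.coe_finsetSum, Submodule.coe_smul] at this
      rw [Fin.sum_univ_succ]
      simp only [Fin.cons_zero, Fin.cons_succ]
      rw [← this]
      abel

/-- Coordinates in which a well-curved curve has components of distinct orders of vanishing. -/
theorem IsWellCurved.exists_normal_form {d : ℕ} {γ : ℝ → EuclideanSpace ℝ (Fin d)}
    (hγ : IsWellCurved d γ) :
    ∃ (a : Fin d → ℕ) (g : Fin d → ℝ → ℝ), Function.Injective a ∧ (∀ i, 0 < a i) ∧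
      (∀ i, ContDiff ℝ (⊤ : ℕ∞) (g i)) ∧
      (∀ i k, ∃ C > 0, ∀ u : ℝ, 0 ≤ u →
        |iteratedDeriv k (fun u => g i (Real.exp (-u))) u -
          (-a i : ℝ) ^ k * Real.exp (-a i * u)| ≤
            C * Real.exp (-u) * Real.exp (-a i * u)) ∧
      ∀ ξ : EuclideanSpace ℝ (Fin d), ∃ ζ : Fin d → ℝ, ∀ t,
        inner ℝ ξ (γ t) = ∑ i, ζ i * g i t := by
  obtain ⟨hsm, h0, hspan⟩ := hγ
  have hinner : ∀ (v : EuclideanSpace ℝ (Fin d)) (m : ℕ) (t : ℝ),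
      iteratedDeriv m (fun t => inner ℝ v (γ t)) t = inner ℝ v (iteratedDeriv m γ t) := by
    intro v m
    have hdγ : ∀ m t, HasDerivAt (iteratedDeriv m γ) (iteratedDeriv (m + 1) γ t) t := by
      intro m t
      rw [iteratedDeriv_succ]
      exact ((hsm.differentiable_iteratedDeriv m (by exact_mod_cast WithTop.coe_lt_top _))
        t).hasDerivAt
    induction m with
    | zero => simp
    | succ m ih =>
      intro t
      rw [iteratedDeriv_succ, funext ih]
      have := (hasDerivAt_const t v).inner ℝ (hdγ m t)
      simpa using this.deriv
  obtain ⟨u, a, hainj, hvan, hne, hsp⟩ := exists_spanning_distinct_orders d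
    (V := EuclideanSpace ℝ (Fin d)) (by simp)
    (fun m => (innerₛₗ ℝ).flip (iteratedDeriv m γ 0)) (by
      intro v hv
      have : ∀ w : EuclideanSpace ℝ (Fin d), inner ℝ v w = 0 := by
        intro w
        have hw : w ∈ Submodule.span ℝ (Set.range fun k : ℕ => iteratedDeriv (k + 1) γ 0) := by
          rw [hspan]; trivial
        induction hw using Submodule.span_induction with
        | mem x hx => obtain ⟨k, rfl⟩ := hx; simpa using hv (k + 1)
        | zero => simp
        | add x y _ _ hx hy => rw [inner_add_right, hx, hy, add_zero]
        | smul c x _ hx => rw [inner_smul_right, hx, mul_zero]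
      exact inner_self_eq_zero.1 (this v))
  simp only [LinearMap.flip_apply, innerₛₗ_apply_apply] at hvan hne
  set c : Fin d → ℝ := fun i => inner ℝ (u i) (iteratedDeriv (a i) γ 0) / (a i).factorial with hc
  have hc0 : ∀ i, c i ≠ 0 := fun i => div_ne_zero (hne i) (by positivity)
  have hgs : ∀ i, ContDiff ℝ (⊤ : ℕ∞) (fun t => inner ℝ (u i) (γ t)) :=
    fun i => contDiff_const.inner ℝ hsm
  have hit : ∀ i m t, iteratedDeriv m (fun t => (c i)⁻¹ * inner ℝ (u i) (γ t)) t =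
      (c i)⁻¹ * inner ℝ (u i) (iteratedDeriv m γ t) := by
    intro i m t
    rw [iteratedDeriv_const_mul_field, hinner]
  refine ⟨a, fun i t => (c i)⁻¹ * inner ℝ (u i) (γ t), hainj, fun i => ?_,
    fun i => contDiff_const.mul (hgs i), fun i k => ?_, fun ξ => ?_⟩
  · rcases Nat.eq_zero_or_pos (a i) with h | h
    · have := hne i
      rw [h] at this
      simp [h0] at this
    · exact h
  · refine exists_abs_iteratedDeriv_comp_exp_neg_sub_le (a i) k (contDiff_const.mul (hgs i))
      (fun m hm => ?_) ?_
    · rw [hit, hvan i m hm, mul_zero]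
    · rw [hit, inv_mul_eq_div, hc, div_div_cancel₀ (hne i)]
  · obtain ⟨ζ, hζ⟩ := hsp ξ
    refine ⟨fun i => ζ i * c i, fun t => ?_⟩
    rw [hζ, sum_inner]
    refine Finset.sum_congr rfl fun i _ => ?_
    rw [inner_smul_left, mul_assoc, mul_inv_cancel_left₀ (hc0 i)]
    rfl

theorem IsWellCurved.comp_neg {d : ℕ} {γ : ℝ → EuclideanSpace ℝ (Fin d)}
    (hγ : IsWellCurved d γ) : IsWellCurved d (fun t => γ (-t)) := by
  obtain ⟨hsm, h0, hspan⟩ := hγ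
  refine ⟨hsm.comp contDiff_neg, by simpa using h0, ?_⟩
  rw [eq_top_iff, ← hspan, Submodule.span_le]
  rintro _ ⟨k, rfl⟩
  have : iteratedDeriv (k + 1) γ 0 =
      (-1 : ℝ) ^ (k + 1) • iteratedDeriv (k + 1) (fun t => γ (-t)) 0 := by
    rw [iteratedDeriv_comp_neg, smul_smul, ← mul_pow]
    simp
  simp only
  rw [this]
  exact Submodule.smul_mem _ _ (Submodule.subset_span ⟨k, rfl⟩)

theorem exists_mul_sum_abs_le_abs_sum_pow_mul {n : ℕ} (hn : 0 < n) {b : Fin n → ℝ}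
    (hb : Function.Injective b) (hb0 : ∀ i, b i ≠ 0) :
    ∃ c > 0, ∀ w : Fin n → ℝ, ∃ k < n, c * ∑ i, |w i| ≤ |∑ i, b i ^ (k + 1) * w i| := by
  have : Nonempty (Fin n) := ⟨⟨0, hn⟩⟩
  let f : (Fin n → ℝ) →ₗ[ℝ] (Fin n → ℝ) :=
    LinearMap.pi fun k => ∑ i, (b i ^ ((k : ℕ) + 1)) • LinearMap.proj i
  have hf : ∀ w k, f w k = ∑ i, b i ^ ((k : ℕ) + 1) * w i := fun w k => by
    simp [f]
  have hker : LinearMap.ker f = ⊥ := by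
    rw [LinearMap.ker_eq_bot']
    intro w hw
    have h1 : (fun i => b i * w i) = 0 := by
      refine Matrix.eq_zero_of_forall_pow_sum_mul_pow_eq_zero hb fun k => ?_
      have := congrFun hw k
      rw [hf] at this
      rw [← Pi.zero_apply (M := fun _ => ℝ) k, ← this]
      exact Finset.sum_congr rfl fun i _ => by ring
    funext i
    exact (mul_eq_zero.1 (congrFun h1 i)).resolve_left (hb0 i)
  obtain ⟨K, hK, hanti⟩ := LinearMap.exists_antilipschitzWith f hker
  have hKr : (0 : ℝ) < K := by exact_mod_cast hK
  have hnr : (0 : ℝ) < n := by exact_mod_cast hn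
  refine ⟨(n * K : ℝ)⁻¹, by positivity, fun w => ?_⟩
  obtain ⟨k, -, hk⟩ := Finset.exists_mem_eq_sup' Finset.univ_nonempty fun k => ‖f w k‖
  refine ⟨k, k.2, ?_⟩
  have h1 : ‖f w‖ ≤ |∑ i, b i ^ ((k : ℕ) + 1) * w i| := by
    rw [← hf, ← Real.norm_eq_abs, ← hk]
    exact (pi_norm_le_iff_of_nonempty _).2 fun i =>
      Finset.le_sup' (fun k => ‖f w k‖) (Finset.mem_univ i)
  have h2 : ‖w‖ ≤ K * ‖f w‖ := by
    simpa using hanti.le_mul_dist w 0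
  have h3 : ∑ i, |w i| ≤ n * ‖w‖ := by
    have := Finset.sum_le_card_nsmul Finset.univ (fun i => |w i|) ‖w‖ fun i _ => norm_le_pi_norm w i
    simpa using this
  rw [inv_mul_le_iff₀ (by positivity)]
  calc ∑ i, |w i| ≤ n * ‖w‖ := h3
    _ ≤ n * (K * ‖f w‖) := by gcongr
    _ ≤ n * (K * |∑ i, b i ^ ((k : ℕ) + 1) * w i|) := by gcongr
    _ = _ := by ring

/-- The size of the phase `e^{βu} + ∑ ζᵢ gᵢ(e^{-u})` and of its derivatives. -/
noncomputable def phaseSize {d : ℕ} (β : ℝ) (a : Fin d → ℕ) (ζ : Fin d → ℝ) (u : ℝ) : ℝ :=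
  Real.exp (β * u) + ∑ i, |ζ i| * Real.exp (-a i * u)

section Phase

variable {d : ℕ} {β : ℝ} {a : Fin d → ℕ} {g : Fin d → ℝ → ℝ}

theorem phaseSize_le (hβ : 0 < β) (ζ : Fin d → ℝ) {s u : ℝ} (hsu : s ≤ u) (hus : u ≤ s + 1) :
    phaseSize β a ζ u ≤ Real.exp β * phaseSize β a ζ s := by
  have h1 : Real.exp (β * u) ≤ Real.exp β * Real.exp (β * s) := by
    rw [← Real.exp_add]; gcongr; nlinarith
  have h2 : ∀ i, |ζ i| * Real.exp (-a i * u) ≤ Real.exp β * (|ζ i| * Real.exp (-a i * s)) := by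
    intro i
    rw [mul_left_comm, ← Real.exp_add]
    gcongr
    have : (0 : ℝ) ≤ a i := by positivity
    nlinarith
  unfold phaseSize
  rw [mul_add, Finset.mul_sum]
  exact add_le_add h1 (Finset.sum_le_sum fun i _ => h2 i)

theorem le_phaseSize (hβ : 0 < β) (ζ : Fin d → ℝ) {s u : ℝ} (hsu : s ≤ u) (hus : u ≤ s + 1) :
    Real.exp (-(∑ i, (a i : ℝ))) * phaseSize β a ζ s ≤ phaseSize β a ζ u := by
  have hA : (0 : ℝ) ≤ ∑ i, (a i : ℝ) := by positivity
  have h1 : Real.exp (-(∑ i, (a i : ℝ))) * Real.exp (β * s) ≤ Real.exp (β * u) := by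
    rw [← Real.exp_add]; gcongr; nlinarith
  have h2 : ∀ i, Real.exp (-(∑ i, (a i : ℝ))) * (|ζ i| * Real.exp (-a i * s)) ≤
      |ζ i| * Real.exp (-a i * u) := by
    intro i
    rw [mul_left_comm, ← Real.exp_add]
    gcongr
    have h0 : (0 : ℝ) ≤ a i := by positivity
    have h3 : (a i : ℝ) ≤ ∑ i, (a i : ℝ) :=
      Finset.single_le_sum (f := fun i => (a i : ℝ)) (fun i _ => by positivity) (Finset.mem_univ i)
    nlinarith
  unfold phaseSize
  rw [mul_add, Finset.mul_sum]
  exact add_le_add h1 (Finset.sum_le_sum fun i _ => h2 i)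

theorem exp_le_phaseSize (ζ : Fin d → ℝ) (u : ℝ) : Real.exp (β * u) ≤ phaseSize β a ζ u :=
  le_add_of_nonneg_right (by positivity)

theorem contDiff_phase (hg : ∀ i, ContDiff ℝ (⊤ : ℕ∞) (g i)) (ζ : Fin d → ℝ) :
    ContDiff ℝ (⊤ : ℕ∞) (fun u : ℝ => Real.exp (β * u) + ∑ i, ζ i * g i (Real.exp (-u))) :=
  (Real.contDiff_exp.comp (contDiff_const.mul contDiff_id)).add
    (ContDiff.sum fun i _ => contDiff_const.mul
      ((hg i).comp (Real.contDiff_exp.comp contDiff_neg)))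

theorem iteratedDeriv_phase (hg : ∀ i, ContDiff ℝ (⊤ : ℕ∞) (g i)) (ζ : Fin d → ℝ) (k : ℕ) (u : ℝ) :
    iteratedDeriv k (fun u : ℝ => Real.exp (β * u) + ∑ i, ζ i * g i (Real.exp (-u))) u =
      β ^ k * Real.exp (β * u) + ∑ i, ζ i * iteratedDeriv k (fun u => g i (Real.exp (-u))) u := by
  have h1 : ContDiff ℝ (⊤ : ℕ∞) (fun u : ℝ => Real.exp (β * u)) :=
    Real.contDiff_exp.comp (contDiff_const.mul contDiff_id)
  have h2 : ∀ i, ContDiff ℝ (⊤ : ℕ∞) (fun u : ℝ => ζ i * g i (Real.exp (-u))) := fun i =>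
    contDiff_const.mul ((hg i).comp (Real.contDiff_exp.comp contDiff_neg))
  have hle : ((k : ℕ∞) : WithTop ℕ∞) ≤ ((⊤ : ℕ∞) : WithTop ℕ∞) := by exact_mod_cast le_top
  rw [iteratedDeriv_fun_add (h1.contDiffAt.of_le hle)
    ((ContDiff.sum fun i _ => h2 i).contDiffAt.of_le hle), iteratedDeriv_exp_mul,
    iteratedDeriv_fun_sum fun i _ => (h2 i).contDiffAt.of_le hle]
  simp only [iteratedDeriv_const_mul_field]

theorem exists_iteratedDeriv_sub_le_uniform
    (hga : ∀ i k, ∃ C > 0, ∀ u : ℝ, 0 ≤ u →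
      |iteratedDeriv k (fun u => g i (Real.exp (-u))) u - (-a i : ℝ) ^ k * Real.exp (-a i * u)| ≤
        C * Real.exp (-u) * Real.exp (-a i * u)) (K : ℕ) : ∃ C > 0, ∀ i, ∀ k ≤ K, ∀ u : ℝ, 0 ≤ u →
    |iteratedDeriv k (fun u => g i (Real.exp (-u))) u - (-a i : ℝ) ^ k * Real.exp (-a i * u)| ≤
      C * Real.exp (-u) * Real.exp (-a i * u) := by
  choose C hC h using hga
  refine ⟨(∑ i, ∑ k ∈ Finset.range (K + 1), C i k) + 1, ?_, fun i k hk u hu => ?_⟩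
  · have : 0 ≤ ∑ i, ∑ k ∈ Finset.range (K + 1), C i k :=
      Finset.sum_nonneg fun i _ => Finset.sum_nonneg fun k _ => (hC i k).le
    linarith
  · refine (h i k u hu).trans ?_
    have h1 : C i k ≤ ∑ k ∈ Finset.range (K + 1), C i k :=
      Finset.single_le_sum (fun k _ => (hC i k).le) (Finset.mem_range.2 (by omega))
    have h2 : ∑ k ∈ Finset.range (K + 1), C i k ≤ ∑ i, ∑ k ∈ Finset.range (K + 1), C i k :=
      Finset.single_le_sum (f := fun i => ∑ k ∈ Finset.range (K + 1), C i k)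
        (fun i _ => Finset.sum_nonneg fun k _ => (hC i k).le) (Finset.mem_univ i)
    gcongr
    linarith

theorem exists_phase_deriv_sub_le
    (hgsm : ∀ i, ContDiff ℝ (⊤ : ℕ∞) (g i))
    (hga : ∀ i k, ∃ C > 0, ∀ u : ℝ, 0 ≤ u →
      |iteratedDeriv k (fun u => g i (Real.exp (-u))) u - (-a i : ℝ) ^ k * Real.exp (-a i * u)| ≤
        C * Real.exp (-u) * Real.exp (-a i * u)) (K : ℕ) :
    ∃ C > 0, ∀ ζ : Fin d → ℝ, ∀ k ≤ K, ∀ u : ℝ, 0 ≤ u →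
    |iteratedDeriv k (fun u : ℝ => Real.exp (β * u) + ∑ i, ζ i * g i (Real.exp (-u))) u -
      (β ^ k * Real.exp (β * u) + ∑ i, (-a i : ℝ) ^ k * (ζ i * Real.exp (-a i * u)))| ≤
      C * Real.exp (-u) * ∑ i, |ζ i| * Real.exp (-a i * u) := by
  obtain ⟨C, hC, h⟩ := exists_iteratedDeriv_sub_le_uniform hga K
  refine ⟨C, hC, fun ζ k hk u hu => ?_⟩
  rw [iteratedDeriv_phase hgsm, add_sub_add_left_eq_sub, ← Finset.sum_sub_distrib, Finset.mul_sum]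
  refine (Finset.abs_sum_le_sum_abs _ _).trans (Finset.sum_le_sum fun i _ => ?_)
  rw [mul_left_comm _ (ζ i), ← mul_sub, abs_mul, mul_left_comm]
  exact mul_le_mul_of_nonneg_left (h i k hk u hu) (abs_nonneg _)

theorem exists_phase_deriv_le
    (hgsm : ∀ i, ContDiff ℝ (⊤ : ℕ∞) (g i))
    (hga : ∀ i k, ∃ C > 0, ∀ u : ℝ, 0 ≤ u →
      |iteratedDeriv k (fun u => g i (Real.exp (-u))) u - (-a i : ℝ) ^ k * Real.exp (-a i * u)| ≤
        C * Real.exp (-u) * Real.exp (-a i * u)) (hβ : 0 < β) (K : ℕ) :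
    ∃ C > 0, ∀ ζ : Fin d → ℝ, ∀ k ≤ K, ∀ u : ℝ, 0 ≤ u →
    |iteratedDeriv k (fun u : ℝ => Real.exp (β * u) + ∑ i, ζ i * g i (Real.exp (-u))) u| ≤
      C * phaseSize β a ζ u := by
  obtain ⟨C, hC, h⟩ := exists_phase_deriv_sub_le (β := β) hgsm hga K
  set B : ℝ := 1 + β + ∑ i, (a i : ℝ) with hB
  have hA : (0 : ℝ) ≤ ∑ i, (a i : ℝ) := by positivity
  have hB1 : 1 ≤ B := by rw [hB]; linarith
  refine ⟨C + B ^ K, by positivity, fun ζ k hk u hu => ?_⟩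
  have h1 := h ζ k hk u hu
  have hS : 0 ≤ ∑ i, |ζ i| * Real.exp (-a i * u) := by positivity
  have hpow : ∀ x : ℝ, |x| ≤ B → |x ^ k| ≤ B ^ K := fun x hx => by
    rw [abs_pow]
    exact (pow_le_pow_left₀ (abs_nonneg x) hx k).trans (pow_le_pow_right₀ hB1 hk)
  have h2 : |β ^ k * Real.exp (β * u) + ∑ i, (-a i : ℝ) ^ k * (ζ i * Real.exp (-a i * u))| ≤
      B ^ K * phaseSize β a ζ u := by
    unfold phaseSize
    rw [mul_add, Finset.mul_sum]
    refine (abs_add_le _ _).trans (add_le_add ?_ ((Finset.abs_sum_le_sum_abs _ _).trans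
      (Finset.sum_le_sum fun i _ => ?_)))
    · rw [abs_mul, Real.abs_exp]
      gcongr
      exact hpow β (by rw [abs_of_pos hβ, hB]; linarith)
    · rw [abs_mul, abs_mul, Real.abs_exp]
      gcongr
      refine hpow _ ?_
      rw [abs_neg, Nat.abs_cast, hB]
      have := Finset.single_le_sum (f := fun i => (a i : ℝ)) (fun i _ => by positivity)
        (Finset.mem_univ i)
      linarith
  have h3 : C * Real.exp (-u) * ∑ i, |ζ i| * Real.exp (-a i * u) ≤ C * phaseSize β a ζ u := by
    have he : Real.exp (-u) ≤ 1 := Real.exp_le_one_iff.2 (by linarith)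
    have : ∑ i, |ζ i| * Real.exp (-a i * u) ≤ phaseSize β a ζ u :=
      le_add_of_nonneg_left (Real.exp_pos _).le
    calc C * Real.exp (-u) * ∑ i, |ζ i| * Real.exp (-a i * u) ≤
        C * 1 * ∑ i, |ζ i| * Real.exp (-a i * u) := by gcongr
      _ ≤ C * 1 * phaseSize β a ζ u := by gcongr
      _ = _ := by ring
  rw [add_mul]
  have h4 := abs_sub_abs_le_abs_sub
    (iteratedDeriv k (fun u : ℝ => Real.exp (β * u) + ∑ i, ζ i * g i (Real.exp (-u))) u)
    (β ^ k * Real.exp (β * u) + ∑ i, (-a i : ℝ) ^ k * (ζ i * Real.exp (-a i * u)))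
  linarith

theorem exists_le_phase_deriv
    (hgsm : ∀ i, ContDiff ℝ (⊤ : ℕ∞) (g i))
    (hga : ∀ i k, ∃ C > 0, ∀ u : ℝ, 0 ≤ u →
      |iteratedDeriv k (fun u => g i (Real.exp (-u))) u - (-a i : ℝ) ^ k * Real.exp (-a i * u)| ≤
        C * Real.exp (-u) * Real.exp (-a i * u)) (hβ : 0 < β)
    (hinj : Function.Injective a) (hpos : ∀ i, 0 < a i) :
    ∃ c > 0, ∃ u₀ ≥ 0, ∀ ζ : Fin d → ℝ, ∀ u : ℝ, u₀ ≤ u → ∃ k < d + 1,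
    c * phaseSize β a ζ u ≤
    |iteratedDeriv (k + 1)
      (fun u : ℝ => Real.exp (β * u) + ∑ i, ζ i * g i (Real.exp (-u))) u| := by
  obtain ⟨C, hC, h⟩ := exists_phase_deriv_sub_le (β := β) hgsm hga (d + 1)
  obtain ⟨c, hc, hV⟩ := exists_mul_sum_abs_le_abs_sum_pow_mul (Nat.succ_pos d)
    (b := Fin.cons β fun i => (-a i : ℝ)) (by
      rw [Fin.cons_injective_iff]
      refine ⟨?_, fun i j hij => hinj (by simpa using hij)⟩
      rintro ⟨i, hi⟩
      have : (0 : ℝ) ≤ a i := by positivity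
      simp only at hi
      linarith) (by
      refine Fin.cases ?_ fun i => ?_
      · simpa using hβ.ne'
      · simpa using (hpos i).ne')
  have hlim : Tendsto (fun u : ℝ => C * Real.exp (-u)) atTop (𝓝 0) := by
    simpa using (Real.tendsto_exp_neg_atTop_nhds_zero).const_mul C
  obtain ⟨u₁, hu₁⟩ := eventually_atTop.1 (hlim.eventually (ge_mem_nhds (half_pos hc)))
  refine ⟨c / 2, by positivity, max u₁ 0, le_max_right _ _, fun ζ u hu => ?_⟩
  obtain ⟨k, hk, hle⟩ := hV (Fin.cons (Real.exp (β * u)) fun i => ζ i * Real.exp (-a i * u))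
  refine ⟨k, hk, ?_⟩
  have h1 := h ζ (k + 1) (by omega) u ((le_max_right _ _).trans hu)
  have h2 := hu₁ u ((le_max_left _ _).trans hu)
  rw [Fin.sum_univ_succ, Fin.sum_univ_succ] at hle
  simp only [Fin.cons_zero, Fin.cons_succ, Real.abs_exp, abs_mul] at hle
  have hS : 0 ≤ ∑ i, |ζ i| * Real.exp (-a i * u) := by positivity
  have h3 : C * Real.exp (-u) * ∑ i, |ζ i| * Real.exp (-a i * u) ≤ c / 2 * phaseSize β a ζ u := by
    have : ∑ i, |ζ i| * Real.exp (-a i * u) ≤ phaseSize β a ζ u :=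
      le_add_of_nonneg_left (Real.exp_pos _).le
    gcongr
  have h4 : c * phaseSize β a ζ u ≤ |β ^ (k + 1) * Real.exp (β * u) +
      ∑ i, (-a i : ℝ) ^ (k + 1) * (ζ i * Real.exp (-a i * u))| := hle
  have h5 := abs_sub_abs_le_abs_sub
    (β ^ (k + 1) * Real.exp (β * u) + ∑ i, (-a i : ℝ) ^ (k + 1) * (ζ i * Real.exp (-a i * u)))
    (iteratedDeriv (k + 1) (fun u : ℝ => Real.exp (β * u) + ∑ i, ζ i * g i (Real.exp (-u))) u)
  rw [abs_sub_comm] at h5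
  linarith

theorem exists_norm_multiplier_le_phaseSize
    (hgsm : ∀ i, ContDiff ℝ (⊤ : ℕ∞) (g i))
    (hga : ∀ i k, ∃ C > 0, ∀ u : ℝ, 0 ≤ u →
      |iteratedDeriv k (fun u => g i (Real.exp (-u))) u - (-a i : ℝ) ^ k * Real.exp (-a i * u)| ≤
        C * Real.exp (-u) * Real.exp (-a i * u)) (hβ : 0 < β) (hinj : Function.Injective a)
    (hpos : ∀ i, 0 < a i) {α : ℝ} (hα : 0 ≤ α) :
    ∃ C > 0, ∃ u₀ ≥ 0, ∀ ζ : Fin d → ℝ, ∀ s : ℝ, u₀ ≤ s →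
      ‖∫ u in s..(s + 1), (Real.exp (α * u) : ℂ) * Complex.exp (Complex.I *
        (Real.exp (β * u) + ∑ i, ζ i * g i (Real.exp (-u)) : ℝ))‖ ≤
      C * Real.exp (α * s) * phaseSize β a ζ s ^ (-(1 / ((d + 1 : ℕ) : ℝ))) := by
  obtain ⟨c, hc, u₀, hu₀, hlow⟩ := exists_le_phase_deriv hgsm hga hβ hinj hpos
  obtain ⟨B, hB, hup⟩ := exists_phase_deriv_le hgsm hga hβ (d + 2)
  obtain ⟨C', hC', h⟩ := norm_integral_exp_le_of_exists_deriv (Nat.succ_pos d)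
    (c := c * Real.exp (-(∑ i, (a i : ℝ)))) (C := B * Real.exp β) (by positivity) (by positivity)
  refine ⟨2 * Real.exp α * C', by positivity, u₀, hu₀, fun ζ s hs => ?_⟩
  have hsm := contDiff_phase (β := β) hgsm ζ
  have hs0 : 0 ≤ s := hu₀.trans hs
  refine (norm_integral_mul_exp_le hsm.continuous hα (by linarith)
    (M := C' * phaseSize β a ζ s ^ (-(1 / ((d + 1 : ℕ) : ℝ)))) fun x hx => ?_).trans
    (le_of_eq ?_)
  · refine h _ hsm s x _ hx.1 (by linarith [hx.2]) ?_ (fun y hy => ?_) fun y hy k hk => ?_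
    · refine le_trans ?_ (exp_le_phaseSize ζ s)
      exact Real.one_le_exp (by positivity)
    · obtain ⟨k, hk, hk'⟩ := hlow ζ y (hs.trans hy.1)
      refine ⟨k, hk, le_trans ?_ hk'⟩
      rw [mul_assoc]
      exact mul_le_mul_of_nonneg_left (le_phaseSize hβ ζ hy.1 (hy.2.trans hx.2)) hc.le
    · refine (hup ζ (k + 1) (by omega) y (hs0.trans hy.1)).trans ?_
      rw [mul_assoc]
      exact mul_le_mul_of_nonneg_left (phaseSize_le hβ ζ hy.1 (hy.2.trans hx.2)) hB.le
  · rw [mul_add, mul_one, Real.exp_add]; ring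

theorem exists_norm_multiplier_le_exp
    (hgsm : ∀ i, ContDiff ℝ (⊤ : ℕ∞) (g i))
    (hga : ∀ i k, ∃ C > 0, ∀ u : ℝ, 0 ≤ u →
      |iteratedDeriv k (fun u => g i (Real.exp (-u))) u - (-a i : ℝ) ^ k * Real.exp (-a i * u)| ≤
        C * Real.exp (-u) * Real.exp (-a i * u)) (hβ : 0 < β) {α : ℝ} (hα : 0 ≤ α) :
    ∃ C > 0, ∃ c₀ > 0, ∀ ζ : Fin d → ℝ, ∀ s : ℝ, 0 ≤ s →
      ∑ i, |ζ i| * Real.exp (-a i * s) ≤ c₀ * Real.exp (β * s) →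
      ‖∫ u in s..(s + 1), (Real.exp (α * u) : ℂ) * Complex.exp (Complex.I *
        (Real.exp (β * u) + ∑ i, ζ i * g i (Real.exp (-u)) : ℝ))‖ ≤
      C * Real.exp (α * s) * Real.exp (-(β * s)) := by
  obtain ⟨C₁, hC₁, hsub⟩ := exists_phase_deriv_sub_le (β := β) hgsm hga 1
  obtain ⟨B, hB, hup⟩ := exists_phase_deriv_le hgsm hga hβ 2
  have hA : (0 : ℝ) ≤ ∑ i, (a i : ℝ) := by positivity
  set A : ℝ := ∑ i, (a i : ℝ)
  set c₀ : ℝ := β / (2 * (C₁ + A)) with hc₀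
  have hc₀p : 0 < c₀ := by positivity
  set K : ℝ := B * Real.exp β * (1 + c₀) / (β / 2) with hK
  refine ⟨2 * Real.exp α * ((2 + K) / (β / 2)), by positivity, c₀, hc₀p, fun ζ s hs hζ => ?_⟩
  have hsm := contDiff_phase (β := β) hgsm ζ
  refine (norm_integral_mul_exp_le hsm.continuous hα (by linarith)
    (M := (2 + K) / (β / 2 * Real.exp (β * s))) fun x hx => ?_).trans (le_of_eq ?_)
  · refine norm_integral_exp_le_of_second_deriv_le hsm hx.1 (by positivity) (by positivity)
      (by linarith [hx.2]) (fun y hy => ?_) fun y hy => ?_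
    · have hy0 : 0 ≤ y := hs.trans hy.1
      have h1 := hsub ζ 1 le_rfl y hy0
      have hey : Real.exp (-y) ≤ 1 := Real.exp_le_one_iff.2 (by linarith)
      have hmono : ∑ i, |ζ i| * Real.exp (-a i * y) ≤ ∑ i, |ζ i| * Real.exp (-a i * s) := by
        refine Finset.sum_le_sum fun i _ => ?_
        gcongr _ * Real.exp ?_
        have : (0 : ℝ) ≤ a i := by positivity
        nlinarith [hy.1]
      have hS : 0 ≤ ∑ i, |ζ i| * Real.exp (-a i * y) := by positivity
      have h2 : C₁ * Real.exp (-y) * ∑ i, |ζ i| * Real.exp (-a i * y) ≤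
          C₁ * (c₀ * Real.exp (β * s)) := by
        calc _ ≤ C₁ * 1 * ∑ i, |ζ i| * Real.exp (-a i * y) := by gcongr
          _ ≤ C₁ * 1 * (c₀ * Real.exp (β * s)) := by
            have := hmono.trans hζ
            gcongr
          _ = _ := by ring
      have h3 : |∑ i, (-a i : ℝ) ^ 1 * (ζ i * Real.exp (-a i * y))| ≤
          A * (c₀ * Real.exp (β * s)) := by
        calc _ ≤ ∑ i, A * (|ζ i| * Real.exp (-a i * y)) := by
              refine (Finset.abs_sum_le_sum_abs _ _).trans (Finset.sum_le_sum fun i _ => ?_)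
              rw [pow_one, abs_mul, abs_mul, Real.abs_exp, abs_neg, Nat.abs_cast]
              gcongr
              exact Finset.single_le_sum (f := fun i => (a i : ℝ)) (fun i _ => by positivity)
                (Finset.mem_univ i)
          _ = A * ∑ i, |ζ i| * Real.exp (-a i * y) := by rw [Finset.mul_sum]
          _ ≤ _ := by
            have := hmono.trans hζ
            gcongr
      have h4 : β * Real.exp (β * s) ≤ β * Real.exp (β * y) := by
        have := hy.1
        gcongr
      have h5 : (C₁ + A) * c₀ = β / 2 := by rw [hc₀]; field_simp
      have h6 : C₁ * (c₀ * Real.exp (β * s)) + A * (c₀ * Real.exp (β * s)) =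
          β / 2 * Real.exp (β * s) := by rw [← h5]; ring
      rw [abs_le] at h1 h3
      refine le_trans ?_ (le_abs_self _)
      rw [pow_one] at h1
      linarith [h1.1, h3.1]
    · refine (hup ζ 2 le_rfl y (hs.trans hy.1)).trans ?_
      have h1 := phaseSize_le (a := a) hβ ζ hy.1 (hy.2.trans hx.2)
      have h2 : phaseSize β a ζ s ≤ (1 + c₀) * Real.exp (β * s) := by
        unfold phaseSize; linarith
      calc B * phaseSize β a ζ y ≤ B * (Real.exp β * ((1 + c₀) * Real.exp (β * s))) := by
            have := h1.trans (mul_le_mul_of_nonneg_left h2 (Real.exp_pos β).le)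
            gcongr
        _ = _ := by rw [hK]; field_simp
  · rw [mul_add, mul_one, Real.exp_add, Real.exp_neg]; field_simp

end Phase

theorem sum_range_le_of_mul_le_succ {s : ℕ → ℝ} {r : ℝ} (hr : 1 < r) (hs : ∀ j, 0 ≤ s j)
    (hstep : ∀ j, r * s j ≤ s (j + 1)) (N : ℕ) :
    ∑ j ∈ Finset.range N, s j ≤ s N / (r - 1) := by
  have hr' : 0 < r - 1 := by linarith
  induction N with
  | zero => simpa using div_nonneg (hs 0) hr'.le
  | succ N ih =>
    rw [Finset.sum_range_succ]
    calc _ ≤ s N / (r - 1) + s N := by gcongr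
      _ = r * s N / (r - 1) := by field_simp; ring
      _ ≤ _ := by gcongr; exact hstep N

theorem sum_range_ite_le_of_mul_le_succ {s : ℕ → ℝ} {r M : ℝ} (hr : 1 < r) (hs : ∀ j, 0 ≤ s j)
    (hstep : ∀ j, r * s j ≤ s (j + 1)) (hM : 0 ≤ M) (N : ℕ) :
    ∑ j ∈ Finset.range N, (if s j ≤ M then s j else 0) ≤ M * r / (r - 1) := by
  have hr' : 0 < r - 1 := by linarith
  induction N with
  | zero => simpa using div_nonneg (by positivity) hr'.le
  | succ N ih =>
    rw [Finset.sum_range_succ]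
    split_ifs with h
    · have h1 : ∑ j ∈ Finset.range N, (if s j ≤ M then s j else 0) ≤
          ∑ j ∈ Finset.range N, s j := by
        refine Finset.sum_le_sum fun j _ => ?_
        split_ifs
        · rfl
        · exact hs j
      calc _ ≤ s N / (r - 1) + s N := by
            gcongr
            exact h1.trans (sum_range_le_of_mul_le_succ hr hs hstep N)
        _ = s N * r / (r - 1) := by field_simp; ring
        _ ≤ _ := by gcongr
    · simpa using ih

section Phase

variable {d : ℕ} {β : ℝ} {a : Fin d → ℕ} {g : Fin d → ℝ → ℝ}

theorem norm_integral_exp_mul_le {α : ℝ} (hα : 0 ≤ α) (φ : ℝ → ℝ) (s : ℝ) :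
    ‖∫ u in s..(s + 1), (Real.exp (α * u) : ℂ) * Complex.exp (Complex.I * (φ u : ℝ))‖ ≤
      Real.exp α * Real.exp (α * s) := by
  have := intervalIntegral.norm_integral_le_of_norm_le_const (a := s) (b := s + 1)
    (C := Real.exp α * Real.exp (α * s))
    (f := fun u => (Real.exp (α * u) : ℂ) * Complex.exp (Complex.I * (φ u : ℝ))) fun u hu => by
      rw [Set.uIoc_of_le (by linarith)] at hu
      rw [norm_mul, mul_comm Complex.I, Complex.norm_exp_ofReal_mul_I, mul_one,
        Complex.norm_real, Real.norm_eq_abs, Real.abs_exp, ← Real.exp_add]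
      gcongr
      nlinarith [hu.2]
  simpa using this

theorem exists_sum_norm_multiplier_le (hd : 0 < d)
    (hgsm : ∀ i, ContDiff ℝ (⊤ : ℕ∞) (g i))
    (hga : ∀ i k, ∃ C > 0, ∀ u : ℝ, 0 ≤ u →
      |iteratedDeriv k (fun u => g i (Real.exp (-u))) u - (-a i : ℝ) ^ k * Real.exp (-a i * u)| ≤
        C * Real.exp (-u) * Real.exp (-a i * u))
    (hβ : 0 < β) (hinj : Function.Injective a) (hpos : ∀ i, 0 < a i) {α : ℝ} (hα : 0 ≤ α) :
    ∃ C > 0, ∀ (ζ : Fin d → ℝ) (N : ℕ),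
      ∑ j ∈ Finset.range N, Real.exp (j * (β / (d + 1) - α)) *
        ‖∫ u in (j : ℝ)..(j + 1), (Real.exp (α * u) : ℂ) * Complex.exp (Complex.I *
          (Real.exp (β * u) + ∑ i, ζ i * g i (Real.exp (-u)) : ℝ))‖ ≤ C := by
  obtain ⟨C₁, hC₁, u₀, hu₀, h₁⟩ :=
    exists_norm_multiplier_le_phaseSize hgsm hga hβ hinj hpos hα
  obtain ⟨C₂, hC₂, c₀, hc₀, h₂⟩ := exists_norm_multiplier_le_exp hgsm hga hβ hα
  have hd1 : (0 : ℝ) < d + 1 := by positivity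
  have hdr : (0 : ℝ) < d := by exact_mod_cast hd
  set e : ℝ := 1 / (d + 1) with he
  have he0 : 0 < e := by positivity
  set r : ℝ := Real.exp (β * e) with hr
  have hr1 : 1 < r := Real.one_lt_exp_iff.2 (by positivity)
  set J : ℕ := ⌈u₀⌉₊ with hJ
  set C₃ : ℝ := Real.exp (J * (β * e)) * Real.exp α
  set τ : ℝ := Real.exp (-(β * (d * e)))
  have hτ1 : τ < 1 := Real.exp_lt_one_iff.2 (by
    have : 0 < β * (d * e) := by positivity
    linarith)
  have hτ0 : 0 < τ := Real.exp_pos _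
  set M : ℝ := c₀ ^ (-e) with hM
  have hM0 : 0 < M := by positivity
  refine ⟨C₁ * (M * r / (r - 1)) + C₂ * (1 - τ)⁻¹ + J * C₃, ?_, fun ζ N => ?_⟩
  · have : 0 < r - 1 := by linarith
    have : 0 < 1 - τ := by linarith
    positivity
  set R : ℕ → ℝ := fun j => ∑ i, |ζ i| * Real.exp (-(a i + β) * j) with hR
  have hR0 : ∀ j, 0 ≤ R j := fun j => by positivity
  set s : ℕ → ℝ := fun j => R j ^ (-e) with hs
  have hs0 : ∀ j, 0 ≤ s j := fun j => Real.rpow_nonneg (hR0 j) _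
  have hRstep : ∀ j, R (j + 1) ≤ Real.exp (-β) * R j := fun j => by
    simp only [hR]
    rw [Finset.mul_sum]
    refine Finset.sum_le_sum fun i _ => ?_
    rw [mul_left_comm, ← Real.exp_add]
    gcongr
    have : (0 : ℝ) ≤ a i := by positivity
    push_cast
    nlinarith
  have hRzero : ∀ j, R j = 0 → ∀ k, R k = 0 := fun j hj k => by
    have h0 := (Finset.sum_eq_zero_iff_of_nonneg fun i _ => by positivity).1 hj
    refine Finset.sum_eq_zero fun i hi => ?_
    rcases mul_eq_zero.1 (h0 i hi) with h | h
    · rw [h, zero_mul]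
    · exact absurd h (Real.exp_pos _).ne'
  have hstep : ∀ j, r * s j ≤ s (j + 1) := fun j => by
    simp only [hs]
    rcases (hR0 j).eq_or_lt with h | h
    · rw [hRzero j h.symm (j + 1), ← h, Real.zero_rpow (by linarith), mul_zero]
    · have h' : 0 < R (j + 1) := (hR0 _).lt_of_ne fun h' => h.ne' (hRzero _ h'.symm j)
      calc r * R j ^ (-e) = (Real.exp (-β) * R j) ^ (-e) := by
            rw [Real.mul_rpow (Real.exp_pos _).le h.le, ← Real.exp_mul, hr]
            ring_nf
        _ ≤ _ := Real.rpow_le_rpow_of_nonpos h' (hRstep j) (by linarith)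
  have hRV : ∀ j : ℕ, ∑ i, |ζ i| * Real.exp (-a i * j) = Real.exp (β * j) * R j := fun j => by
    simp only [hR]
    rw [Finset.mul_sum]
    refine Finset.sum_congr rfl fun i _ => ?_
    rw [mul_left_comm, ← Real.exp_add]
    ring_nf
  have key : ∀ j : ℕ, Real.exp (j * (β / (d + 1) - α)) *
        ‖∫ u in (j : ℝ)..(j + 1), (Real.exp (α * u) : ℂ) * Complex.exp (Complex.I *
          (Real.exp (β * u) + ∑ i, ζ i * g i (Real.exp (-u)) : ℝ))‖ ≤
      C₁ * (if s j ≤ M then s j else 0) + C₂ * τ ^ j + (if j < J then C₃ else 0) := by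
    intro j
    have hn1 : 0 ≤ C₁ * (if s j ≤ M then s j else 0) := by
      have := hs0 j
      split_ifs <;> positivity
    have hn2 : 0 ≤ C₂ * τ ^ j := by positivity
    have hn3 : (0 : ℝ) ≤ if j < J then C₃ else 0 := by
      split_ifs <;> positivity
    have hj0 : (0 : ℝ) ≤ j := by positivity
    by_cases hjJ : j < J
    · have h := norm_integral_exp_mul_le hα
        (fun u => Real.exp (β * u) + ∑ i, ζ i * g i (Real.exp (-u))) j
      have hjJ' : (j : ℝ) ≤ J := by exact_mod_cast hjJ.le
      have : Real.exp (j * (β / (d + 1) - α)) * (Real.exp α * Real.exp (α * j)) ≤ C₃ := by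
        calc _ = Real.exp (j * (β * e)) * Real.exp α := by
              rw [← Real.exp_add, ← Real.exp_add, ← Real.exp_add, he]; ring_nf
          _ ≤ _ := mul_le_mul_of_nonneg_right
              (Real.exp_le_exp.2 (mul_le_mul_of_nonneg_right hjJ' (by positivity)))
              (Real.exp_pos _).le
      rw [if_pos hjJ]
      have := (mul_le_mul_of_nonneg_left h (Real.exp_pos (j * (β / (d + 1) - α))).le).trans this
      linarith
    by_cases hc : R j ≤ c₀
    · have h := h₂ ζ j hj0 (by
        rw [hRV, mul_comm (Real.exp _)]; exact mul_le_mul_of_nonneg_right hc (Real.exp_pos _).le)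
      have : Real.exp (j * (β / (d + 1) - α)) * (C₂ * Real.exp (α * j) * Real.exp (-(β * j))) =
          C₂ * τ ^ j := by
        rw [← Real.exp_nat_mul, mul_assoc C₂, ← Real.exp_add, mul_left_comm, ← Real.exp_add]
        congr 2
        rw [he]; field_simp; ring
      have := (mul_le_mul_of_nonneg_left h (Real.exp_pos (j * (β / (d + 1) - α))).le).trans this.le
      linarith
    · push Not at hc
      have hRp : 0 < R j := hc₀.trans hc
      have h := h₁ ζ j (by
        rw [not_lt] at hjJ
        exact (Nat.le_ceil u₀).trans (by exact_mod_cast hjJ))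
      have hV : phaseSize β a ζ j ^ (-(1 / ((d + 1 : ℕ) : ℝ))) ≤ (Real.exp (β * j) * R j) ^ (-e) := by
        have : (-(1 / ((d + 1 : ℕ) : ℝ))) = -e := by rw [he]; push_cast; rfl
        rw [this]
        refine Real.rpow_le_rpow_of_nonpos (by positivity) ?_ (by linarith)
        rw [← hRV]
        exact le_add_of_nonneg_left (Real.exp_pos _).le
      have hsM : s j ≤ M := Real.rpow_le_rpow_of_nonpos hc₀ hc.le (by linarith)
      rw [if_pos hsM] at hn1 ⊢
      have : Real.exp (j * (β / (d + 1) - α)) * (C₁ * Real.exp (α * j) *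
          phaseSize β a ζ j ^ (-(1 / ((d + 1 : ℕ) : ℝ)))) ≤ C₁ * s j := by
        calc _ ≤ Real.exp (j * (β / (d + 1) - α)) * (C₁ * Real.exp (α * j) *
              (Real.exp (β * j) * R j) ^ (-e)) := by gcongr
          _ = C₁ * (Real.exp (j * (β / (d + 1) - α)) * Real.exp (α * j) *
              Real.exp (β * j * (-e))) * s j := by
            rw [Real.mul_rpow (Real.exp_pos _).le hRp.le, ← Real.exp_mul]; ring
          _ = C₁ * s j := by
            rw [← Real.exp_add, ← Real.exp_add]
            have : (j * (β / (d + 1) - α) + α * j + β * j * (-e) : ℝ) = 0 := by rw [he]; ring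
            rw [this, Real.exp_zero, mul_one]
      have := (mul_le_mul_of_nonneg_left h (Real.exp_pos (j * (β / (d + 1) - α))).le).trans this
      linarith
  refine (Finset.sum_le_sum fun j _ => key j).trans ?_
  rw [Finset.sum_add_distrib, Finset.sum_add_distrib, ← Finset.mul_sum, ← Finset.mul_sum]
  have e1 := sum_range_ite_le_of_mul_le_succ hr1 hs0 hstep hM0.le N
  have e2 : ∑ j ∈ Finset.range N, τ ^ j ≤ (1 - τ)⁻¹ := by
    rw [← tsum_geometric_of_lt_one hτ0.le hτ1]
    exact (summable_geometric_of_lt_one hτ0.le hτ1).sum_le_tsum _ fun j _ => by positivity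
  have e3 : ∑ j ∈ Finset.range N, (if j < J then C₃ else 0) ≤ J * C₃ := by
    rw [← Finset.sum_filter, Finset.sum_const, nsmul_eq_mul]
    have : ((Finset.range N).filter (· < J)).card ≤ J := by
      calc _ ≤ (Finset.range J).card := Finset.card_le_card fun x hx => by
            simpa using (Finset.mem_filter.1 hx).2
        _ = J := Finset.card_range J
    gcongr
  gcongr

end Phase

/-- Weighted summability of the dyadic multipliers along a well-curved curve. -/
theorem IsWellCurved.exists_sum_norm_multiplier_le {d : ℕ} (hd : 0 < d)
    {γ : ℝ → EuclideanSpace ℝ (Fin d)} (hγ : IsWellCurved d γ) {α β : ℝ} (hα : 0 ≤ α)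
    (hβ : 0 < β) :
    ∃ C > 0, ∀ (ξ : EuclideanSpace ℝ (Fin d)) (N : ℕ),
      ∑ j ∈ Finset.range N, Real.exp (j * (β / (d + 1) - α)) *
        ‖∫ u in (j : ℝ)..(j + 1), (Real.exp (α * u) : ℂ) * Complex.exp (Complex.I *
          (Real.exp (β * u) + inner ℝ ξ (γ (Real.exp (-u))) : ℝ))‖ ≤ C := by
  obtain ⟨a, g, hinj, hpos, hsm, hga, hξ⟩ := hγ.exists_normal_form
  obtain ⟨C, hC, h⟩ := _root_.exists_sum_norm_multiplier_le hd hsm hga hβ hinj hpos hα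
  refine ⟨C, hC, fun ξ N => ?_⟩
  obtain ⟨ζ, hζ⟩ := hξ ξ
  simp only [hζ]
  exact h ζ N

section Fourier

variable {E : Type*} [NormedAddCommGroup E] [InnerProductSpace ℝ E] [FiniteDimensional ℝ E]
  [MeasurableSpace E] [BorelSpace E]

open scoped FourierTransform ContDiff SchwartzMap

theorem continuous_fourier_of_integrable {f : E → ℂ} (hf : Integrable f) : Continuous (𝓕 f) :=
  VectorFourier.fourierIntegral_continuous Real.continuous_fourierChar
    (by exact continuous_inner) hf

/-- On `L¹ ∩ L²`, the `L²` Fourier transform is given by the Fourier integral. -/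
theorem coeFn_fourier_toLp_two {f : E → ℂ} (hf : Integrable f) (hf2 : MemLp f 2) :
    (𝓕 (hf2.toLp f) : Lp (α := E) ℂ 2) =ᵐ[volume] 𝓕 f := by
  refine ae_eq_of_integral_contDiff_smul_eq
    ((Lp.memLp (𝓕 (hf2.toLp f))).locallyIntegrable (by norm_num))
    (continuous_fourier_of_integrable hf).locallyIntegrable fun g hg hgc => ?_
  have hg₁ : HasCompactSupport (Complex.ofRealCLM ∘ g) := hgc.comp_left rfl
  have hg₂ : ContDiff ℝ ∞ (Complex.ofRealCLM ∘ g) := by fun_prop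
  set G : 𝓢(E, ℂ) := hg₁.toSchwartzMap hg₂ with hG
  have hGg : ∀ x, G x = (g x : ℂ) := fun x => by simp [hG]
  set φ : Lp (α := E) ℂ 2 (volume : Measure E) := 𝓕 (hf2.toLp f) with hφ
  have h1 : ∫ x, g x • φ x = Lp.toTemperedDistribution (μ := volume) φ G := by
    rw [Lp.toTemperedDistribution_apply]
    simp [hGg]
  have h2 : Lp.toTemperedDistribution (μ := volume) φ G = ∫ x, (𝓕 G) x • f x := by
    rw [hφ, ← Lp.fourier_toTemperedDistribution_eq, TemperedDistribution.fourier_apply,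
      Lp.toTemperedDistribution_apply]
    refine integral_congr_ae ?_
    filter_upwards [hf2.coeFn_toLp] with x hx
    rw [hx]
  have h3 : ∫ x, (𝓕 G) x • f x = ∫ x, g x • 𝓕 f x := by
    have := VectorFourier.integral_fourierIntegral_smul_eq_flip (L := innerₗ E)
      (μ := volume) (ν := volume) Real.continuous_fourierChar continuous_inner G.integrable hf
    rw [flip_innerₗ] at this
    refine this.trans (integral_congr_ae (Eventually.of_forall fun x => ?_))
    simp only [hGg]
    rfl
  rw [h1, h2, h3]

theorem lintegral_enorm_fourier_sq {f : E → ℂ} (hf : Integrable f) (hf2 : MemLp f 2) :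
    ∫⁻ ξ, ‖𝓕 f ξ‖ₑ ^ 2 = ∫⁻ x, ‖f x‖ₑ ^ 2 := by
  have h : eLpNorm (𝓕 f) 2 volume = eLpNorm f 2 volume := by
    rw [← eLpNorm_congr_ae (coeFn_fourier_toLp_two hf hf2), ← eLpNorm_congr_ae hf2.coeFn_toLp,
      ← ENNReal.toReal_eq_toReal_iff' (Lp.eLpNorm_ne_top _) (Lp.eLpNorm_ne_top _),
      ← Lp.norm_def, ← Lp.norm_def, Lp.norm_fourier_eq]
  have key : ∀ g : E → ℂ, ∫⁻ x, ‖g x‖ₑ ^ 2 = eLpNorm g 2 volume ^ 2 := fun g => by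
    rw [eLpNorm_eq_lintegral_rpow_enorm_toReal (by norm_num) (by norm_num),
      ← ENNReal.rpow_natCast, ← ENNReal.rpow_mul]
    simp
  rw [key, key, h]

/-- Bounded, integrable, Borel measurable functions. -/
structure BoundedIntegrable (F : E → ℂ) : Prop where
  measurable : Measurable F
  integrable : Integrable F
  bounded : ∃ B, ∀ x, ‖F x‖ ≤ B

namespace BoundedIntegrable

variable {F G : E → ℂ}

theorem memLp_two (hF : BoundedIntegrable F) : MemLp F 2 := by
  obtain ⟨B, hB⟩ := hF.bounded
  rw [memLp_two_iff_integrable_sq_norm hF.measurable.aestronglyMeasurable]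
  refine (hF.integrable.norm.const_mul B).mono'
    (hF.measurable.norm.pow_const 2).aestronglyMeasurable (Eventually.of_forall fun x => ?_)
  rw [norm_pow, norm_norm, sq]
  exact mul_le_mul_of_nonneg_right (hB x) (norm_nonneg _)

theorem add (hF : BoundedIntegrable F) (hG : BoundedIntegrable G) :
    BoundedIntegrable fun x => F x + G x := by
  obtain ⟨B, hB⟩ := hF.bounded
  obtain ⟨B', hB'⟩ := hG.bounded
  exact ⟨hF.measurable.add hG.measurable, hF.integrable.add hG.integrable, B + B',
    fun x => (norm_add_le _ _).trans (add_le_add (hB x) (hB' x))⟩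

theorem sub (hF : BoundedIntegrable F) (hG : BoundedIntegrable G) :
    BoundedIntegrable fun x => F x - G x := by
  obtain ⟨B, hB⟩ := hF.bounded
  obtain ⟨B', hB'⟩ := hG.bounded
  exact ⟨hF.measurable.sub hG.measurable, hF.integrable.sub hG.integrable, B + B',
    fun x => (norm_sub_le _ _).trans (add_le_add (hB x) (hB' x))⟩

theorem sum {ι : Type*} (s : Finset ι) {F : ι → E → ℂ} (hF : ∀ i ∈ s, BoundedIntegrable (F i)) :
    BoundedIntegrable fun x => ∑ i ∈ s, F i x := by
  classical
  induction s using Finset.induction_on with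
  | empty => exact ⟨by simp, by simp, 0, by simp⟩
  | insert i s his ih =>
    simp only [Finset.sum_insert his]
    exact (hF i (Finset.mem_insert_self i s)).add
      (ih fun j hj => hF j (Finset.mem_insert_of_mem hj))

theorem indicator (hF : BoundedIntegrable F) {s : Set E} (hs : MeasurableSet s) :
    BoundedIntegrable (s.indicator F) := by
  obtain ⟨B, hB⟩ := hF.bounded
  exact ⟨hF.measurable.indicator hs, hF.integrable.indicator hs, B,
    fun x => (norm_indicator_le_norm_self F x).trans (hB x)⟩

end BoundedIntegrable

variable {Γ : ℝ → E} {k : ℝ → ℂ} {a b : ℝ} {F : E → ℂ}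

/-- Average of translates of `F` along the curve `Γ` with weight `k`. -/
noncomputable def curveAverage (k : ℝ → ℂ) (Γ : ℝ → E) (a b : ℝ) (F : E → ℂ) (x : E) : ℂ :=
  ∫ u in Set.Ioc a b, k u * F (x - Γ u)

theorem integrable_curveAverage_integrand (hk : Continuous k) (hΓ : Continuous Γ)
    (hF : BoundedIntegrable F) (x : E) :
    Integrable (fun u => k u * F (x - Γ u)) (volume.restrict (Set.Ioc a b)) := by
  obtain ⟨B, hB⟩ := hF.bounded
  have hki : Integrable k (volume.restrict (Set.Ioc a b)) :=
    (hk.integrableOn_Icc).mono_set Set.Ioc_subset_Icc_self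
  exact hki.mul_bdd (c := B)
    (hF.measurable.comp (measurable_const.sub hΓ.measurable)).aestronglyMeasurable
    (Eventually.of_forall fun u => hB _)

theorem integrable_curveAverage_prod (hk : Continuous k) (hΓ : Continuous Γ)
    (hF : BoundedIntegrable F) :
    Integrable (fun q : ℝ × E => k q.1 * F (q.2 - Γ q.1))
      ((volume.restrict (Set.Ioc a b)).prod volume) := by
  have hki : Integrable k (volume.restrict (Set.Ioc a b)) :=
    (hk.integrableOn_Icc).mono_set Set.Ioc_subset_Icc_self
  have hm : Measurable fun q : ℝ × E => k q.1 * F (q.2 - Γ q.1) :=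
    (hk.measurable.comp measurable_fst).mul
      (hF.measurable.comp (measurable_snd.sub (hΓ.measurable.comp measurable_fst)))
  rw [integrable_prod_iff hm.aestronglyMeasurable]
  refine ⟨Eventually.of_forall fun u => ?_, ?_⟩
  · exact (hF.integrable.comp_sub_right (Γ u)).const_mul (k u)
  · have : ∀ u, ∫ x, ‖k u * F (x - Γ u)‖ = ‖k u‖ * ∫ x, ‖F x‖ := fun u => by
      simp only [norm_mul]
      rw [integral_const_mul, integral_sub_right_eq_self (fun x => ‖F x‖)]
    simp only [this]
    exact hki.norm.mul_const _

theorem BoundedIntegrable.curveAverage (hk : Continuous k) (hΓ : Continuous Γ)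
    (hF : BoundedIntegrable F) : BoundedIntegrable (curveAverage k Γ a b F) := by
  obtain ⟨B, hB⟩ := hF.bounded
  have hm : Measurable fun q : E × ℝ => k q.2 * F (q.1 - Γ q.2) :=
    (hk.measurable.comp measurable_snd).mul
      (hF.measurable.comp (measurable_fst.sub (hΓ.measurable.comp measurable_snd)))
  refine ⟨(hm.stronglyMeasurable.integral_prod_right
    (ν := volume.restrict (Set.Ioc a b))).measurable,
    (integrable_curveAverage_prod hk hΓ hF).integral_prod_right,
    ∫ u in Set.Ioc a b, ‖k u‖ * B, fun x => ?_⟩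
  have hki : Integrable k (volume.restrict (Set.Ioc a b)) :=
    (hk.integrableOn_Icc).mono_set Set.Ioc_subset_Icc_self
  refine (norm_integral_le_integral_norm _).trans
    (integral_mono (integrable_curveAverage_integrand hk hΓ hF x).norm (hki.norm.mul_const _)
      fun u => ?_)
  simp only [norm_mul]
  exact mul_le_mul_of_nonneg_left (hB _) (norm_nonneg _)

theorem curveAverage_add (hk : Continuous k) (hΓ : Continuous Γ) {G : E → ℂ}
    (hF : BoundedIntegrable F) (hG : BoundedIntegrable G) (x : E) :
    curveAverage k Γ a b (fun x => F x + G x) x =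
      curveAverage k Γ a b F x + curveAverage k Γ a b G x := by
  unfold curveAverage
  rw [← integral_add (integrable_curveAverage_integrand hk hΓ hF x)
    (integrable_curveAverage_integrand hk hΓ hG x)]
  simp only [mul_add]

theorem lintegral_enorm_curveAverage_le (hk : Continuous k) (hΓ : Continuous Γ)
    (hF : BoundedIntegrable F) :
    ∫⁻ x, ‖curveAverage k Γ a b F x‖ₑ ≤ (∫⁻ u in Set.Ioc a b, ‖k u‖ₑ) * ∫⁻ x, ‖F x‖ₑ := by
  have hm : Measurable fun q : E × ℝ => ‖k q.2 * F (q.1 - Γ q.2)‖ₑ :=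
    ((hk.measurable.comp measurable_snd).mul
      (hF.measurable.comp (measurable_fst.sub (hΓ.measurable.comp measurable_snd)))).enorm
  calc ∫⁻ x, ‖curveAverage k Γ a b F x‖ₑ
      ≤ ∫⁻ x, ∫⁻ u in Set.Ioc a b, ‖k u * F (x - Γ u)‖ₑ :=
        lintegral_mono fun x => enorm_integral_le_lintegral_enorm _
    _ = ∫⁻ u in Set.Ioc a b, ∫⁻ x, ‖k u * F (x - Γ u)‖ₑ :=
        lintegral_lintegral_swap hm.aemeasurable
    _ = ∫⁻ u in Set.Ioc a b, ‖k u‖ₑ * ∫⁻ x, ‖F x‖ₑ := by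
        refine lintegral_congr fun u => ?_
        simp only [enorm_mul]
        rw [lintegral_const_mul _ (by
          exact (hF.measurable.comp (measurable_id.sub_const _)).enorm),
          lintegral_sub_right_eq_self (fun x => ‖F x‖ₑ)]
    _ = _ := lintegral_mul_const _ hk.measurable.enorm

theorem fourier_curveAverage (hk : Continuous k) (hΓ : Continuous Γ)
    (hF : BoundedIntegrable F) (ξ : E) :
    𝓕 (curveAverage k Γ a b F) ξ =
      (∫ u in Set.Ioc a b, k u * Complex.exp (Complex.I * (inner ℝ (-(2 * π) • ξ) (Γ u) : ℝ))) *
        𝓕 F ξ := by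
  have hint := integrable_curveAverage_prod (a := a) (b := b) hk hΓ hF
  set e : E → ℂ := fun x => Complex.exp (((-2 * π * inner ℝ x ξ : ℝ) : ℂ) * Complex.I) with he
  have hen : ∀ x, ‖e x‖ = 1 := fun x => Complex.norm_exp_ofReal_mul_I _
  have hec : Continuous e := by rw [he]; fun_prop
  have hshift : ∀ u, ∫ x, e x * F (x - Γ u) = e (Γ u) * 𝓕 F ξ := fun u => by
    have h := integral_sub_right_eq_self (μ := volume) (fun x => e (x + Γ u) * F x) (Γ u)
    simp only [sub_add_cancel] at h
    rw [h, Real.fourier_eq', ← integral_const_mul]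
    refine integral_congr_ae (Eventually.of_forall fun x => ?_)
    simp only [smul_eq_mul, he]
    rw [← mul_assoc, ← Complex.exp_add]
    congr 2
    rw [inner_add_left]
    push_cast; ring
  calc 𝓕 (curveAverage k Γ a b F) ξ
      = ∫ x, ∫ u in Set.Ioc a b, e x * (k u * F (x - Γ u)) := by
        rw [Real.fourier_eq']
        simp only [smul_eq_mul, curveAverage, ← integral_const_mul, he]
    _ = ∫ u in Set.Ioc a b, ∫ x, e x * (k u * F (x - Γ u)) := by
        refine integral_integral_swap ?_
        exact hint.swap.bdd_mul (c := 1) (hec.comp continuous_fst).aestronglyMeasurable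
          (Eventually.of_forall fun q => (hen _).le)
    _ = ∫ u in Set.Ioc a b, k u * e (Γ u) * 𝓕 F ξ := by
        refine integral_congr_ae (Eventually.of_forall fun u => ?_)
        simp only
        rw [mul_assoc, ← hshift u, ← integral_const_mul]
        simp only [mul_left_comm]
    _ = _ := by
        rw [integral_mul_const]
        congr 1
        refine integral_congr_ae (Eventually.of_forall fun u => ?_)
        simp only [he]
        congr 2
        rw [inner_smul_left, real_inner_comm]
        simp only [conj_trivial]
        push_cast; ring

end Fourier

section FourierLinear

variable {E : Type*} [NormedAddCommGroup E] [InnerProductSpace ℝ E] [FiniteDimensional ℝ E]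
  [MeasurableSpace E] [BorelSpace E]

open scoped FourierTransform

theorem fourier_sub_of_integrable {f g : E → ℂ} (hf : Integrable f) (hg : Integrable g) (ξ : E) :
    𝓕 (fun x => f x - g x) ξ = 𝓕 f ξ - 𝓕 g ξ := by
  have key : ∀ {h : E → ℂ}, Integrable h → Integrable fun v =>
      Complex.exp (((-2 * π * inner ℝ v ξ : ℝ) : ℂ) * Complex.I) • h v := fun hh => by
    refine hh.bdd_mul (c := 1) (Continuous.aestronglyMeasurable (by fun_prop))
      (Eventually.of_forall fun v => (Complex.norm_exp_ofReal_mul_I _).le)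
  simp only [Real.fourier_eq', smul_sub]
  exact integral_sub (key hf) (key hg)

theorem fourier_sum_of_integrable {ι : Type*} (s : Finset ι) {f : ι → E → ℂ}
    (hf : ∀ i ∈ s, Integrable (f i)) (ξ : E) :
    𝓕 (fun x => ∑ i ∈ s, f i x) ξ = ∑ i ∈ s, 𝓕 (f i) ξ := by
  simp only [Real.fourier_eq', Finset.smul_sum]
  refine integral_finsetSum s fun i hi => ?_
  exact (hf i hi).bdd_mul (c := 1) (Continuous.aestronglyMeasurable (by fun_prop))
      (Eventually.of_forall fun v => (Complex.norm_exp_ofReal_mul_I _).le)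

end FourierLinear

section DyadicPieces

open scoped FourierTransform

/-- The kernel `t⁻¹ |t|^{-α} e^{i|t|^{-β}} dt` in the variable `u = -log |t|`. -/
noncomputable def oscKernel (α β u : ℝ) : ℂ :=
  (Real.exp (α * u) : ℂ) * Complex.exp (Complex.I * (Real.exp (β * u) : ℝ))

theorem continuous_oscKernel (α β : ℝ) : Continuous (oscKernel α β) := by
  unfold oscKernel; fun_prop

theorem norm_oscKernel (α β u : ℝ) : ‖oscKernel α β u‖ = Real.exp (α * u) := by
  rw [oscKernel, norm_mul, mul_comm Complex.I, Complex.norm_exp_ofReal_mul_I, mul_one,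
    Complex.norm_real, Real.norm_of_nonneg (Real.exp_pos _).le]

variable {d : ℕ} {γ : ℝ → EuclideanSpace ℝ (Fin d)} {α β : ℝ}

/-- The part of the strongly singular integral with `e^{-j-1} ≤ |t| < e^{-j}`. -/
noncomputable def dyadicPiece (γ : ℝ → EuclideanSpace ℝ (Fin d)) (α β : ℝ) (j : ℕ)
    (F : EuclideanSpace ℝ (Fin d) → ℂ) (x : EuclideanSpace ℝ (Fin d)) : ℂ :=
  curveAverage (oscKernel α β) (fun u => γ (Real.exp (-u))) j (j + 1) F x -
    curveAverage (oscKernel α β) (fun u => γ (-Real.exp (-u))) j (j + 1) F x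

/-- The Fourier multiplier of `dyadicPiece`. -/
noncomputable def dyadicMultiplier (γ : ℝ → EuclideanSpace ℝ (Fin d)) (α β : ℝ) (j : ℕ)
    (ξ : EuclideanSpace ℝ (Fin d)) : ℂ :=
  (∫ u in Set.Ioc (j : ℝ) (j + 1), oscKernel α β u *
      Complex.exp (Complex.I * (inner ℝ (-(2 * π) • ξ) (γ (Real.exp (-u))) : ℝ))) -
    ∫ u in Set.Ioc (j : ℝ) (j + 1), oscKernel α β u *
      Complex.exp (Complex.I * (inner ℝ (-(2 * π) • ξ) (γ (-Real.exp (-u))) : ℝ))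

variable {F G : EuclideanSpace ℝ (Fin d) → ℂ}

theorem BoundedIntegrable.dyadicPiece (hγ : Continuous γ) (hF : BoundedIntegrable F) (j : ℕ) :
    BoundedIntegrable (dyadicPiece γ α β j F) :=
  (hF.curveAverage (continuous_oscKernel α β) (by fun_prop)).sub
    (hF.curveAverage (continuous_oscKernel α β) (by fun_prop))

theorem dyadicPiece_add (hγ : Continuous γ) (hF : BoundedIntegrable F) (hG : BoundedIntegrable G)
    (j : ℕ) (x : EuclideanSpace ℝ (Fin d)) :
    dyadicPiece γ α β j (fun x => F x + G x) x =
      dyadicPiece γ α β j F x + dyadicPiece γ α β j G x := by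
  unfold dyadicPiece
  rw [curveAverage_add (continuous_oscKernel α β) (by fun_prop) hF hG,
    curveAverage_add (continuous_oscKernel α β) (by fun_prop) hF hG]
  ring

theorem lintegral_enorm_oscKernel_le (hα : 0 ≤ α) (j : ℕ) :
    ∫⁻ u in Set.Ioc (j : ℝ) (j + 1), ‖oscKernel α β u‖ₑ ≤
      ENNReal.ofReal (Real.exp α * Real.exp (α * j)) := by
  calc _ ≤ ∫⁻ u in Set.Ioc (j : ℝ) (j + 1), ENNReal.ofReal (Real.exp α * Real.exp (α * j)) := by
        refine setLIntegral_mono' measurableSet_Ioc fun u hu => ?_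
        rw [← ofReal_norm, norm_oscKernel, ← Real.exp_add]
        refine ENNReal.ofReal_le_ofReal (Real.exp_le_exp.2 ?_)
        nlinarith [mul_le_mul_of_nonneg_left hu.2 hα]
    _ = _ := by simp

theorem lintegral_enorm_dyadicPiece_le (hγ : Continuous γ) (hα : 0 ≤ α)
    (hF : BoundedIntegrable F) (j : ℕ) :
    ∫⁻ x, ‖dyadicPiece γ α β j F x‖ₑ ≤
      ENNReal.ofReal (2 * Real.exp α * Real.exp (α * j)) * ∫⁻ x, ‖F x‖ₑ := by
  have hk := continuous_oscKernel α β
  have h1 : Continuous fun u => γ (Real.exp (-u)) := by fun_prop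
  have h2 : Continuous fun u => γ (-Real.exp (-u)) := by fun_prop
  calc _ ≤ ∫⁻ x, (‖curveAverage (oscKernel α β) (fun u => γ (Real.exp (-u))) j (j + 1) F x‖ₑ +
        ‖curveAverage (oscKernel α β) (fun u => γ (-Real.exp (-u))) j (j + 1) F x‖ₑ) :=
        lintegral_mono fun x => by unfold dyadicPiece; exact enorm_sub_le
    _ = _ := lintegral_add_left (hF.curveAverage hk h1).measurable.enorm _
    _ ≤ (ENNReal.ofReal (Real.exp α * Real.exp (α * j)) * ∫⁻ x, ‖F x‖ₑ) +
        ENNReal.ofReal (Real.exp α * Real.exp (α * j)) * ∫⁻ x, ‖F x‖ₑ := by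
        gcongr
        · exact (lintegral_enorm_curveAverage_le hk h1 hF).trans
            (by gcongr; exact lintegral_enorm_oscKernel_le hα j)
        · exact (lintegral_enorm_curveAverage_le hk h2 hF).trans
            (by gcongr; exact lintegral_enorm_oscKernel_le hα j)
    _ = _ := by
        rw [← add_mul, ← ENNReal.ofReal_add (by positivity) (by positivity)]
        congr 2; ring

theorem fourier_dyadicPiece (hγ : Continuous γ) (hF : BoundedIntegrable F) (j : ℕ)
    (ξ : EuclideanSpace ℝ (Fin d)) :
    𝓕 (dyadicPiece γ α β j F) ξ = dyadicMultiplier γ α β j ξ * 𝓕 F ξ := by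
  have hk := continuous_oscKernel α β
  have h1 : Continuous fun u => γ (Real.exp (-u)) := by fun_prop
  have h2 : Continuous fun u => γ (-Real.exp (-u)) := by fun_prop
  have := fourier_sub_of_integrable (hF.curveAverage (a := j) (b := j + 1) hk h1).integrable
    (hF.curveAverage (a := j) (b := j + 1) hk h2).integrable ξ
  rw [fourier_curveAverage hk h1 hF, fourier_curveAverage hk h2 hF] at this
  rw [dyadicMultiplier, sub_mul]
  exact this

theorem measurable_dyadicMultiplier (hγ : Continuous γ) (j : ℕ) :
    Measurable (dyadicMultiplier γ α β j) := by
  have hk := continuous_oscKernel α β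
  have key : ∀ Γ : ℝ → EuclideanSpace ℝ (Fin d), Continuous Γ →
      Measurable fun ξ : EuclideanSpace ℝ (Fin d) => ∫ u in Set.Ioc (j : ℝ) (j + 1),
        oscKernel α β u * Complex.exp (Complex.I * (inner ℝ (-(2 * π) • ξ) (Γ u) : ℝ)) :=
    fun Γ hΓ => by
      have : Continuous fun q : EuclideanSpace ℝ (Fin d) × ℝ => oscKernel α β q.2 *
          Complex.exp (Complex.I * (inner ℝ (-(2 * π) • q.1) (Γ q.2) : ℝ)) := by fun_prop
      exact (this.stronglyMeasurable.integral_prod_right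
        (ν := volume.restrict (Set.Ioc (j : ℝ) (j + 1)))).measurable
  exact (key _ (by fun_prop)).sub (key _ (by fun_prop))

theorem IsWellCurved.exists_sum_norm_dyadicMultiplier_le (hd : 0 < d) (hγ : IsWellCurved d γ)
    (hα : 0 ≤ α) (hβ : 0 < β) : ∃ C > 0, ∀ (ξ : EuclideanSpace ℝ (Fin d)) (N : ℕ),
      ∑ j ∈ Finset.range N, Real.exp (j * (β / (d + 1) - α)) * ‖dyadicMultiplier γ α β j ξ‖ ≤ C := by
  obtain ⟨C, hC, h⟩ := hγ.exists_sum_norm_multiplier_le hd hα hβ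
  obtain ⟨C', hC', h'⟩ := hγ.comp_neg.exists_sum_norm_multiplier_le hd hα hβ
  refine ⟨C + C', by positivity, fun ξ N => ?_⟩
  refine le_trans ?_ (add_le_add (h (-(2 * π) • ξ) N) (h' (-(2 * π) • ξ) N))
  rw [← Finset.sum_add_distrib]
  refine Finset.sum_le_sum fun j _ => ?_
  rw [← mul_add]
  refine mul_le_mul_of_nonneg_left ?_ (Real.exp_pos _).le
  refine (norm_sub_le _ _).trans (le_of_eq ?_)
  rw [intervalIntegral.integral_of_le (by linarith), intervalIntegral.integral_of_le (by linarith)]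
  congr 2 <;>
  · refine integral_congr_ae (Eventually.of_forall fun u => ?_)
    simp only [oscKernel]
    rw [mul_assoc, ← Complex.exp_add]
    congr 2
    push_cast; ring

/-- Weighted `L²` size of a function with respect to the `j`-th multiplier. -/
noncomputable def dyadicEnergy (γ : ℝ → EuclideanSpace ℝ (Fin d)) (α β δ : ℝ) (j : ℕ)
    (F : EuclideanSpace ℝ (Fin d) → ℂ) : ℝ≥0∞ :=
  ∫⁻ ξ, ENNReal.ofReal (Real.exp (j * δ) * ‖dyadicMultiplier γ α β j ξ‖) * ‖𝓕 F ξ‖ₑ ^ 2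

variable {δ C : ℝ}

theorem sum_dyadicEnergy_le (hγ : Continuous γ)
    (hC : ∀ (ξ : EuclideanSpace ℝ (Fin d)) (N : ℕ),
      ∑ j ∈ Finset.range N, Real.exp (j * δ) * ‖dyadicMultiplier γ α β j ξ‖ ≤ C)
    (hF : BoundedIntegrable F) (N : ℕ) :
    ∑ j ∈ Finset.range N, dyadicEnergy γ α β δ j F ≤ ENNReal.ofReal C * ∫⁻ x, ‖F x‖ₑ ^ 2 := by
  have hm := fun j => (measurable_dyadicMultiplier (α := α) (β := β) hγ j)
  have hFm : Measurable (𝓕 F) := (continuous_fourier_of_integrable hF.integrable).measurable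
  unfold dyadicEnergy
  rw [← lintegral_finsetSum _ fun j _ => by have := hm j; fun_prop]
  calc _ ≤ ∫⁻ ξ, ENNReal.ofReal C * ‖𝓕 F ξ‖ₑ ^ 2 := by
        refine lintegral_mono fun ξ => ?_
        rw [← Finset.sum_mul]
        gcongr
        rw [← ENNReal.ofReal_sum_of_nonneg fun j _ => by positivity]
        exact ENNReal.ofReal_le_ofReal (hC ξ N)
    _ = _ := by
        rw [lintegral_const_mul _ (hFm.enorm.pow_const 2),
          lintegral_enorm_fourier_sq hF.integrable hF.memLp_two]

theorem lintegral_enorm_sum_dyadicPiece_sq_le (hγ : Continuous γ)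
    (hC : ∀ (ξ : EuclideanSpace ℝ (Fin d)) (N : ℕ),
      ∑ j ∈ Finset.range N, Real.exp (j * δ) * ‖dyadicMultiplier γ α β j ξ‖ ≤ C)
    {F : ℕ → EuclideanSpace ℝ (Fin d) → ℂ} (hF : ∀ j, BoundedIntegrable (F j)) (N : ℕ) :
    ∫⁻ x, ‖∑ j ∈ Finset.range N, dyadicPiece γ α β j (F j) x‖ₑ ^ 2 ≤
      ENNReal.ofReal C * ∑ j ∈ Finset.range N,
        ENNReal.ofReal (Real.exp (j * δ) ^ (-2 : ℤ)) * dyadicEnergy γ α β δ j (F j) := by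
  have hm := fun j => (measurable_dyadicMultiplier (α := α) (β := β) hγ j)
  have hFm : ∀ j, Measurable (𝓕 (F j)) := fun j =>
    (continuous_fourier_of_integrable (hF j).integrable).measurable
  have hB := BoundedIntegrable.sum (Finset.range N) (F := fun j => dyadicPiece γ α β j (F j))
    fun j _ => (hF j).dyadicPiece hγ j
  rw [← lintegral_enorm_fourier_sq hB.integrable hB.memLp_two]
  have hpt : ∀ ξ, ‖𝓕 (fun x => ∑ j ∈ Finset.range N, dyadicPiece γ α β j (F j) x) ξ‖ₑ ^ 2 ≤
      ENNReal.ofReal C * ∑ j ∈ Finset.range N, ENNReal.ofReal (Real.exp (j * δ) ^ (-2 : ℤ)) *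
        (ENNReal.ofReal (Real.exp (j * δ) * ‖dyadicMultiplier γ α β j ξ‖) * ‖𝓕 (F j) ξ‖ₑ ^ 2) := by
    intro ξ
    rw [fourier_sum_of_integrable _ fun j _ => ((hF j).dyadicPiece hγ j).integrable]
    simp only [fourier_dyadicPiece hγ (hF _)]
    have h1 : ‖∑ j ∈ Finset.range N, dyadicMultiplier γ α β j ξ * 𝓕 (F j) ξ‖ ^ 2 ≤
        C * ∑ j ∈ Finset.range N, Real.exp (j * δ) ^ (-2 : ℤ) *
        (Real.exp (j * δ) * ‖dyadicMultiplier γ α β j ξ‖ * ‖𝓕 (F j) ξ‖ ^ 2) := by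
      calc _ ≤ (∑ j ∈ Finset.range N, ‖dyadicMultiplier γ α β j ξ‖ * ‖𝓕 (F j) ξ‖) ^ 2 := by
            gcongr
            refine (norm_sum_le _ _).trans (le_of_eq ?_)
            simp only [norm_mul]
        _ ≤ (∑ j ∈ Finset.range N, Real.exp (j * δ) * ‖dyadicMultiplier γ α β j ξ‖) *
            ∑ j ∈ Finset.range N, Real.exp (j * δ) ^ (-2 : ℤ) *
              (Real.exp (j * δ) * ‖dyadicMultiplier γ α β j ξ‖ * ‖𝓕 (F j) ξ‖ ^ 2) := by
            refine Finset.sum_sq_le_sum_mul_sum_of_sq_le_mul _ (fun j _ => by positivity)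
              (fun j _ => by positivity) fun j _ => ?_
            have := Real.exp_pos (j * δ)
            apply le_of_eq
            field_simp
        _ ≤ _ := by
            refine mul_le_mul_of_nonneg_right (hC ξ N) (Finset.sum_nonneg fun j _ => by positivity)
    have h2 := ENNReal.ofReal_le_ofReal h1
    rw [ENNReal.ofReal_mul' (Finset.sum_nonneg fun j _ => by positivity),
      ENNReal.ofReal_sum_of_nonneg fun j _ => by positivity, ENNReal.ofReal_pow (norm_nonneg _),
      ofReal_norm] at h2
    refine h2.trans (le_of_eq ?_)
    congr 1
    refine Finset.sum_congr rfl fun j _ => ?_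
    rw [ENNReal.ofReal_mul (by positivity), ENNReal.ofReal_mul (by positivity),
      ENNReal.ofReal_pow (norm_nonneg _), ofReal_norm]
  refine (lintegral_mono hpt).trans (le_of_eq ?_)
  have hmm : ∀ j : ℕ, Measurable fun ξ =>
      ENNReal.ofReal (Real.exp (j * δ) * ‖dyadicMultiplier γ α β j ξ‖) *
      ‖𝓕 (F j) ξ‖ₑ ^ 2 := fun j => by have := hm j; have := hFm j; fun_prop
  rw [lintegral_const_mul _ (Finset.measurable_fun_sum _ fun j _ => (hmm j).const_mul _),
    lintegral_finsetSum _ fun j _ => (hmm j).const_mul _]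
  congr 1
  exact Finset.sum_congr rfl fun j _ => lintegral_const_mul _ (hmm j)

theorem integral_truncated_kernel_eq_sum_dyadicPiece (hγ : Continuous γ) (hF : Continuous F)
    (N : ℕ) (x : EuclideanSpace ℝ (Fin d)) :
    ∫ t in {t : ℝ | Real.exp (-N) ≤ |t| ∧ |t| ≤ 1}, (t : ℂ)⁻¹ * ((|t| ^ (-α) : ℝ) : ℂ) *
      Complex.exp (Complex.I * ((|t| ^ (-β) : ℝ) : ℂ)) * F (x - γ t) =
      ∑ j ∈ Finset.range N, dyadicPiece γ α β j F x := by
  set g : ℝ → ℂ := fun t => (t : ℂ)⁻¹ * ((|t| ^ (-α) : ℝ) : ℂ) *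
      Complex.exp (Complex.I * ((|t| ^ (-β) : ℝ) : ℂ)) * F (x - γ t) with hg
  have hk := continuous_oscKernel α β
  have habs : ∀ u a : ℝ, |Real.exp (-u)| ^ (-a) = Real.exp (a * u) := fun u a => by
    rw [abs_of_pos (Real.exp_pos _), ← Real.exp_mul]
    congr 1; ring
  have hgp : ∀ u, |-Real.exp (-u)| • g (Real.exp (-u)) =
      oscKernel α β u * F (x - γ (Real.exp (-u))) := fun u => by
    have h0 : ((Real.exp (-u) : ℝ) : ℂ) ≠ 0 := Complex.ofReal_ne_zero.2 (Real.exp_pos _).ne'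
    simp only [hg, habs]
    rw [abs_neg, abs_of_pos (Real.exp_pos _), Complex.real_smul, ← mul_assoc, ← mul_assoc,
      ← mul_assoc, mul_inv_cancel₀ h0, one_mul, oscKernel]
  have hgn : ∀ u, |Real.exp (-u)| • g (-Real.exp (-u)) =
      -(oscKernel α β u * F (x - γ (-Real.exp (-u)))) := fun u => by
    have h0 : ((Real.exp (-u) : ℝ) : ℂ) ≠ 0 := Complex.ofReal_ne_zero.2 (Real.exp_pos _).ne'
    simp only [hg, abs_neg, habs]
    rw [abs_of_pos (Real.exp_pos _), Complex.real_smul, ← mul_assoc, ← mul_assoc,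
      ← mul_assoc, Complex.ofReal_neg, inv_neg, mul_neg, mul_inv_cancel₀ h0, oscKernel]
    ring
  have hdp : ∀ u ∈ Set.Icc (0 : ℝ) N, HasDerivWithinAt (fun u => Real.exp (-u))
      (-Real.exp (-u)) (Set.Icc (0 : ℝ) N) u := fun u _ => by
    simpa using ((hasDerivAt_neg u).exp).hasDerivWithinAt
  have hdn : ∀ u ∈ Set.Icc (0 : ℝ) N, HasDerivWithinAt (fun u => -Real.exp (-u))
      (Real.exp (-u)) (Set.Icc (0 : ℝ) N) u := fun u hu => by
    have := (hdp u hu).neg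
    rw [neg_neg] at this
    exact this
  have hip : Set.InjOn (fun u : ℝ => Real.exp (-u)) (Set.Icc 0 N) := fun u _ v _ h => by
    simpa using h
  have hin : Set.InjOn (fun u : ℝ => -Real.exp (-u)) (Set.Icc 0 N) := fun u _ v _ h => by
    simpa using h
  have hset : {t : ℝ | Real.exp (-N) ≤ |t| ∧ |t| ≤ 1} =
      ((fun u : ℝ => Real.exp (-u)) '' Set.Icc 0 N) ∪
        ((fun u : ℝ => -Real.exp (-u)) '' Set.Icc 0 N) := by
    ext t
    constructor
    · rintro ⟨h1, h2⟩
      have ht : 0 < |t| := (Real.exp_pos _).trans_le h1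
      have hmem : -Real.log |t| ∈ Set.Icc (0 : ℝ) N := by
        have := Real.log_le_log (Real.exp_pos _) h1
        rw [Real.log_exp] at this
        have h3 := Real.log_nonpos ht.le h2
        constructor <;> linarith
      rcases abs_cases t with ⟨h, -⟩ | ⟨h, -⟩
      · refine Or.inl ⟨_, hmem, ?_⟩
        simp only [neg_neg]
        rw [Real.exp_log ht, h]
      · refine Or.inr ⟨_, hmem, ?_⟩
        simp only [neg_neg]
        rw [Real.exp_log ht, h, neg_neg]
    · have key : ∀ u ∈ Set.Icc (0 : ℝ) N, Real.exp (-N) ≤ Real.exp (-u) ∧ Real.exp (-u) ≤ 1 :=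
        fun u hu => ⟨Real.exp_le_exp.2 (neg_le_neg hu.2),
          Real.exp_le_one_iff.2 (by linarith [hu.1])⟩
      rintro (⟨u, hu, rfl⟩ | ⟨u, hu, rfl⟩)
      · simpa only [Set.mem_ofPred_eq, abs_of_pos (Real.exp_pos _)] using key u hu
      · simpa only [Set.mem_ofPred_eq, abs_neg, abs_of_pos (Real.exp_pos _)] using key u hu
  have hcp : Continuous fun u => oscKernel α β u * F (x - γ (Real.exp (-u))) := by fun_prop
  have hcn : Continuous fun u => oscKernel α β u * F (x - γ (-Real.exp (-u))) := by fun_prop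
  have hdisj : Disjoint ((fun u : ℝ => Real.exp (-u)) '' Set.Icc 0 N)
      ((fun u : ℝ => -Real.exp (-u)) '' Set.Icc (0 : ℝ) N) := by
    rw [Set.disjoint_left]
    rintro _ ⟨u, -, rfl⟩ ⟨v, -, hv⟩
    have := Real.exp_pos (-u); have := Real.exp_pos (-v)
    simp only at hv
    linarith
  have hmeas : MeasurableSet ((fun u : ℝ => -Real.exp (-u)) '' Set.Icc (0 : ℝ) N) :=
    (isCompact_Icc.image (by fun_prop)).measurableSet
  have hsum : ∀ h : ℝ → ℂ, Continuous h → ∫ u in Set.Icc (0 : ℝ) N, h u =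
      ∑ j ∈ Finset.range N, ∫ u in Set.Ioc (j : ℝ) (j + 1), h u := fun h hh => by
    have := intervalIntegral.sum_integral_adjacent_intervals (μ := volume) (f := h)
      (a := fun j : ℕ => (j : ℝ)) (n := N) fun k _ => hh.intervalIntegrable _ _
    rw [integral_Icc_eq_integral_Ioc, ← intervalIntegral.integral_of_le (by positivity)]
    simp only [Nat.cast_zero] at this
    rw [← this]
    refine Finset.sum_congr rfl fun j _ => ?_
    rw [intervalIntegral.integral_of_le (by simp), Nat.cast_succ]
  have hint₁ : IntegrableOn g ((fun u : ℝ => Real.exp (-u)) '' Set.Icc 0 N) := by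
    rw [integrableOn_image_iff_integrableOn_abs_deriv_smul measurableSet_Icc hdp hip, funext hgp]
    exact hcp.integrableOn_Icc
  have hint₂ : IntegrableOn g ((fun u : ℝ => -Real.exp (-u)) '' Set.Icc 0 N) := by
    rw [integrableOn_image_iff_integrableOn_abs_deriv_smul measurableSet_Icc hdn hin, funext hgn]
    exact hcn.neg.integrableOn_Icc
  rw [hset, setIntegral_union hdisj hmeas hint₁ hint₂,
    integral_image_eq_integral_abs_deriv_smul measurableSet_Icc hdp hip,
    integral_image_eq_integral_abs_deriv_smul measurableSet_Icc hdn hin,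
    funext hgp, funext hgn, integral_neg, ← sub_eq_add_neg, hsum _ hcp, hsum _ hcn,
    ← Finset.sum_sub_distrib]
  rfl

/-- Combination of the `L¹` and `L²` bounds for the dyadic pieces. -/
theorem volume_lt_norm_sum_dyadicPiece_le (hγ : Continuous γ) (hα : 0 ≤ α)
    (hC : ∀ (ξ : EuclideanSpace ℝ (Fin d)) (N : ℕ),
      ∑ j ∈ Finset.range N, Real.exp (j * δ) * ‖dyadicMultiplier γ α β j ξ‖ ≤ C)
    {F G : ℕ → EuclideanSpace ℝ (Fin d) → ℂ} (hF : ∀ j, BoundedIntegrable (F j))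
    (hG : ∀ j, BoundedIntegrable (G j)) {f : EuclideanSpace ℝ (Fin d) → ℂ}
    (hf : ∀ j x, f x = F j x + G j x) (N : ℕ) {lam : ℝ} (hlam : 0 < lam) :
    volume {x | lam < ‖∑ j ∈ Finset.range N, dyadicPiece γ α β j f x‖} ≤
      (∑ j ∈ Finset.range N, ENNReal.ofReal (2 * Real.exp α * Real.exp (α * j)) *
        ∫⁻ x, ‖G j x‖ₑ) / ENNReal.ofReal (lam / 2) +
      (ENNReal.ofReal C * ∑ j ∈ Finset.range N,
        ENNReal.ofReal (Real.exp (j * δ) ^ (-2 : ℤ)) * dyadicEnergy γ α β δ j (F j)) /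
        ENNReal.ofReal (lam / 2) ^ 2 := by
  have hsplit : ∀ x, ∑ j ∈ Finset.range N, dyadicPiece γ α β j f x =
      ∑ j ∈ Finset.range N, dyadicPiece γ α β j (F j) x +
        ∑ j ∈ Finset.range N, dyadicPiece γ α β j (G j) x := fun x => by
    rw [← Finset.sum_add_distrib]
    refine Finset.sum_congr rfl fun j _ => ?_
    rw [← dyadicPiece_add hγ (hF j) (hG j), ← funext (hf j)]
  have hl0 : ENNReal.ofReal (lam / 2) ≠ 0 := by simpa using hlam
  have hsub : {x | lam < ‖∑ j ∈ Finset.range N, dyadicPiece γ α β j f x‖} ⊆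
      {x | ENNReal.ofReal (lam / 2) ≤ ‖∑ j ∈ Finset.range N, dyadicPiece γ α β j (G j) x‖ₑ} ∪
      {x | ENNReal.ofReal (lam / 2) ^ 2 ≤
        ‖∑ j ∈ Finset.range N, dyadicPiece γ α β j (F j) x‖ₑ ^ 2} := fun x hx => by
    rw [Set.mem_ofPred_eq, hsplit x] at hx
    have := norm_add_le (∑ j ∈ Finset.range N, dyadicPiece γ α β j (F j) x)
      (∑ j ∈ Finset.range N, dyadicPiece γ α β j (G j) x)
    by_cases h : lam / 2 ≤ ‖∑ j ∈ Finset.range N, dyadicPiece γ α β j (G j) x‖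
    · left
      rw [Set.mem_ofPred_eq, ← ofReal_norm]
      exact ENNReal.ofReal_le_ofReal h
    · right
      rw [Set.mem_ofPred_eq, ← ofReal_norm]
      gcongr
      linarith
  have hmG := (BoundedIntegrable.sum (Finset.range N) (F := fun j => dyadicPiece γ α β j (G j))
    fun j _ => (hG j).dyadicPiece hγ j).measurable
  have hmF := (BoundedIntegrable.sum (Finset.range N) (F := fun j => dyadicPiece γ α β j (F j))
    fun j _ => (hF j).dyadicPiece hγ j).measurable
  refine (measure_mono hsub).trans ((measure_union_le _ _).trans (add_le_add ?_ ?_))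
  · refine (meas_ge_le_lintegral_div hmG.enorm.aemeasurable hl0 ENNReal.ofReal_ne_top).trans ?_
    gcongr
    calc _ ≤ ∫⁻ x, ∑ j ∈ Finset.range N, ‖dyadicPiece γ α β j (G j) x‖ₑ :=
          lintegral_mono fun x => enorm_sum_le _ _
      _ = ∑ j ∈ Finset.range N, ∫⁻ x, ‖dyadicPiece γ α β j (G j) x‖ₑ :=
          lintegral_finsetSum _ fun j _ => ((hG j).dyadicPiece hγ j).measurable.enorm
      _ ≤ _ := Finset.sum_le_sum fun j _ => lintegral_enorm_dyadicPiece_le hγ hα (hG j) j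
  · refine (meas_ge_le_lintegral_div (hmF.enorm.pow_const 2).aemeasurable (pow_ne_zero 2 hl0)
      (ENNReal.pow_ne_top ENNReal.ofReal_ne_top)).trans ?_
    gcongr
    exact lintegral_enorm_sum_dyadicPiece_sq_le hγ hC hF N

end DyadicPieces

/-- Selection of a truncation height at which an `L¹` error and an `L²` main term balance. -/
theorem exists_balanced_height {p lam R : ℝ} (hp1 : 1 < p) (hp2 : p < 2) (hlam : 0 < lam)
    (hR : 0 < R) {a₁ a₂ b e : ℤ → ℝ} (ha₁ : ∀ κ, 0 ≤ a₁ κ) (hb : ∀ κ, 0 ≤ b κ)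
    (hba : ∀ κ, b κ ≤ a₂ κ) (hmono : Monotone a₂)
    (hstep : ∀ κ, a₁ κ ≤ a₁ (κ + 1) + ((2 : ℝ) ^ κ)⁻¹ * a₂ (κ + 1))
    (he : ∀ κ, e κ = ((2 : ℝ) ^ κ) ^ (p - 1) * a₁ κ + ((2 : ℝ) ^ κ) ^ (p - 2) * a₂ κ)
    {K : ℤ} (hK₁ : ∀ κ, K ≤ κ → a₁ κ = 0) (hK₂ : ∀ κ, K ≤ κ → a₂ κ = a₂ K)
    (hKb : ∀ κ, K ≤ κ → b κ = b K) :
    ∃ κ, lam⁻¹ * (R ^ (p - 1) * a₁ κ) + (lam ^ 2)⁻¹ * (R ^ (p - 2) * b κ) ≤ 0 ∨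
      ∃ s : ℤ, 0 < b s ∧ lam * R / 2 ^ s * e s ≤ ((2 : ℝ) ^ s) ^ (p - 2) * b s ∧
        lam⁻¹ * (R ^ (p - 1) * a₁ κ) + (lam ^ 2)⁻¹ * (R ^ (p - 2) * b κ) ≤
          16 * lam ^ (-p) * ((lam * R / 2 ^ s) ^ (p - 1) * e s) := by
  classical
  have h2 : ∀ κ : ℤ, (0 : ℝ) < 2 ^ κ := fun κ => by positivity
  have ha₂ : ∀ κ, 0 ≤ a₂ κ := fun κ => (hb κ).trans (hba κ)
  have he0 : ∀ κ, 0 ≤ e κ := fun κ => by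
    rw [he]
    have := ha₁ κ; have := ha₂ κ; have := h2 κ
    positivity
  have hea₂ : ∀ κ, ((2 : ℝ) ^ κ) ^ (p - 2) * a₂ κ ≤ e κ := fun κ => by
    rw [he]
    have := ha₁ κ; have := h2 κ
    exact le_add_of_nonneg_left (by positivity)
  have hestep : ∀ κ, e κ ≤ 4 * e (κ + 1) := fun κ => by
    have hz : (2 : ℝ) ^ (κ + 1) = 2 ^ κ * 2 := zpow_add_one₀ two_ne_zero κ
    have h21 : (1 : ℝ) ≤ 2 ^ (p - 1) := Real.one_le_rpow one_le_two (by linarith)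
    have h22 : (1 / 2 : ℝ) ≤ 2 ^ (p - 2) := by
      have := Real.rpow_le_rpow_of_exponent_le one_le_two (show (-1 : ℝ) ≤ p - 2 by linarith)
      rw [Real.rpow_neg_one] at this
      linarith
    have hX : ((2 : ℝ) ^ κ) ^ (p - 1) * ((2 : ℝ) ^ κ)⁻¹ = ((2 : ℝ) ^ κ) ^ (p - 2) := by
      rw [← Real.rpow_neg_one, ← Real.rpow_add (h2 κ)]
      congr 1; ring
    rw [he, he, hz, Real.mul_rpow (h2 κ).le zero_le_two, Real.mul_rpow (h2 κ).le zero_le_two]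
    have hP : 0 ≤ ((2 : ℝ) ^ κ) ^ (p - 1) := by positivity
    have hQ : 0 ≤ ((2 : ℝ) ^ κ) ^ (p - 2) := by positivity
    calc _ ≤ ((2 : ℝ) ^ κ) ^ (p - 1) * (a₁ (κ + 1) + ((2 : ℝ) ^ κ)⁻¹ * a₂ (κ + 1)) +
          ((2 : ℝ) ^ κ) ^ (p - 2) * a₂ (κ + 1) :=
          add_le_add (mul_le_mul_of_nonneg_left (hstep κ) hP)
            (mul_le_mul_of_nonneg_left (hmono (by lia)) hQ)
      _ = ((2 : ℝ) ^ κ) ^ (p - 1) * a₁ (κ + 1) * 1 +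
          4 * (((2 : ℝ) ^ κ) ^ (p - 2) * a₂ (κ + 1) * (1 / 2)) := by
          rw [mul_add, ← mul_assoc, hX]; ring
      _ ≤ ((2 : ℝ) ^ κ) ^ (p - 1) * a₁ (κ + 1) * (4 * 2 ^ (p - 1)) +
          4 * (((2 : ℝ) ^ κ) ^ (p - 2) * a₂ (κ + 1) * 2 ^ (p - 2)) := by
          have := ha₁ (κ + 1); have := ha₂ (κ + 1)
          gcongr
          linarith
      _ = _ := by ring
  set P : ℤ → Prop := fun s =>
    0 < b s ∧ lam * R / 2 ^ s * e s ≤ ((2 : ℝ) ^ s) ^ (p - 2) * b s with hPdef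
  by_cases hne : ∃ s, P s
  · have hbdd : ∃ m : ℤ, ∀ s, P s → m ≤ s := by
      obtain ⟨m, hm, -⟩ := exists_mem_Ico_zpow (mul_pos hlam hR) (one_lt_two : (1 : ℝ) < 2)
      refine ⟨m, fun s hs => ?_⟩
      have hes : 0 < e s := lt_of_lt_of_le
        (mul_pos (Real.rpow_pos_of_pos (h2 s) _) (hs.1.trans_le (hba s))) (hea₂ s)
      have hBe : ((2 : ℝ) ^ s) ^ (p - 2) * b s ≤ e s :=
        (mul_le_mul_of_nonneg_left (hba s) (Real.rpow_nonneg (h2 s).le _)).trans (hea₂ s)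
      have hx1 : lam * R / 2 ^ s ≤ 1 :=
        le_of_mul_le_mul_right ((hs.2.trans hBe).trans_eq (one_mul _).symm) hes
      rw [div_le_one (h2 s)] at hx1
      exact (zpow_le_zpow_iff_right₀ one_lt_two).1 (hm.trans hx1)
    obtain ⟨s, hs, hmin⟩ := Int.exists_least_of_bdd hbdd hne
    refine ⟨s - 1, Or.inr ⟨s, hs.1, hs.2, ?_⟩⟩
    set κ := s - 1 with hκ
    have hsκ : s = κ + 1 := by lia
    have hBκ : ((2 : ℝ) ^ κ) ^ (p - 2) * b κ ≤ lam * R / 2 ^ κ * e κ := by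
      by_contra hcon
      push Not at hcon
      have hpos : 0 < b κ := by
        rcases (hb κ).eq_or_lt with h | h
        · rw [← h, mul_zero] at hcon
          have := he0 κ; have := h2 κ
          exact absurd hcon (not_lt.2 (by positivity))
        · exact h
      have := hmin κ ⟨hpos, hcon.le⟩
      lia
    set x := lam * R / 2 ^ κ with hx
    have hx0 : 0 < x := by have := h2 κ; positivity
    have hlR : lam * R = x * 2 ^ κ := by rw [hx]; field_simp
    have hR' : R = lam⁻¹ * (x * 2 ^ κ) := by rw [← hlR]; field_simp
    have e1 : lam⁻¹ * R ^ (p - 1) = lam ^ (-p) * (x ^ (p - 1) * ((2 : ℝ) ^ κ) ^ (p - 1)) := by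
      rw [← Real.mul_rpow hx0.le (h2 κ).le, ← hlR, Real.mul_rpow hlam.le hR.le, ← mul_assoc,
        ← Real.rpow_add hlam, ← Real.rpow_neg_one]
      congr 2; ring
    have e2 : (lam ^ 2)⁻¹ * R ^ (p - 2) = lam ^ (-p) * (x ^ (p - 2) * ((2 : ℝ) ^ κ) ^ (p - 2)) := by
      rw [← Real.mul_rpow hx0.le (h2 κ).le, ← hlR, Real.mul_rpow hlam.le hR.le, ← mul_assoc,
        ← Real.rpow_add hlam, ← Real.rpow_natCast, ← Real.rpow_neg hlam.le]
      congr 2; push_cast; ring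
    have e3 : x ^ (p - 2) * x = x ^ (p - 1) := by
      rw [← Real.rpow_add_one hx0.ne']; congr 1; ring
    have hl0 : 0 < lam ^ (-p) := Real.rpow_pos_of_pos hlam _
    have hea₁ : ((2 : ℝ) ^ κ) ^ (p - 1) * a₁ κ ≤ e κ := by
      rw [he]
      have := ha₂ κ; have := h2 κ
      exact le_add_of_nonneg_right (by positivity)
    have hxs : x = 2 * (lam * R / 2 ^ s) := by
      rw [hx, hsκ, zpow_add_one₀ two_ne_zero]; field_simp
    have hy0 : 0 < lam * R / 2 ^ s := by have := h2 s; positivity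
    have h22 : (2 : ℝ) ^ (p - 1) ≤ 2 := by
      simpa using Real.rpow_le_rpow_of_exponent_le one_le_two (show p - 1 ≤ 1 by linarith)
    calc lam⁻¹ * (R ^ (p - 1) * a₁ κ) + (lam ^ 2)⁻¹ * (R ^ (p - 2) * b κ)
        = lam ^ (-p) * (x ^ (p - 1) * (((2 : ℝ) ^ κ) ^ (p - 1) * a₁ κ) +
            x ^ (p - 2) * (((2 : ℝ) ^ κ) ^ (p - 2) * b κ)) := by
          rw [← mul_assoc, ← mul_assoc, e1, e2]; ring
      _ ≤ lam ^ (-p) * (x ^ (p - 1) * e κ + x ^ (p - 2) * (x * e κ)) := by gcongr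
      _ = 2 * lam ^ (-p) * (x ^ (p - 1) * e κ) := by rw [← mul_assoc (x ^ (p - 2)), e3]; ring
      _ = 2 * lam ^ (-p) * (2 ^ (p - 1) * (lam * R / 2 ^ s) ^ (p - 1) * e κ) := by
          rw [hxs, Real.mul_rpow zero_le_two hy0.le]
      _ ≤ 2 * lam ^ (-p) * (2 * (lam * R / 2 ^ s) ^ (p - 1) * (4 * e s)) := by
          have h4 := hestep κ
          rw [← hsκ] at h4
          have := he0 κ
          gcongr
      _ = _ := by ring
  · refine ⟨K, Or.inl ?_⟩
    have hbK : b K = 0 := by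
      by_contra hb0
      have hbpos : 0 < b K := lt_of_le_of_ne (hb K) (Ne.symm hb0)
      obtain ⟨n, hn⟩ := pow_unbounded_of_one_lt (lam * R * a₂ K / b K) (one_lt_two : (1 : ℝ) < 2)
      have hKs : K ≤ max K n := le_max_left _ _
      refine hne ⟨max K n, by rwa [hKb _ hKs], ?_⟩
      have hns : (2 : ℝ) ^ n ≤ 2 ^ (max K n : ℤ) := by
        rw [← zpow_natCast]
        exact zpow_le_zpow_right₀ one_le_two (le_max_right _ _)
      have h3 : lam * R * a₂ K ≤ b K * 2 ^ (max K n : ℤ) := by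
        rw [← div_le_iff₀' hbpos]
        exact hn.le.trans hns
      have h0 := h2 (max K n)
      rw [he, hK₁ _ hKs, hK₂ _ hKs, hKb _ hKs, mul_zero, zero_add]
      calc _ = ((2 : ℝ) ^ (max K n : ℤ)) ^ (p - 2) * (lam * R * a₂ K / 2 ^ (max K n : ℤ)) := by
            ring
        _ ≤ _ := by
            refine mul_le_mul_of_nonneg_left ?_ (by positivity)
            rwa [div_le_iff₀ h0]
    rw [hK₁ K le_rfl, hbK]
    simp

theorem sum_rpow_rpow_inv_le {ρ θ c : ℝ} (hρ : 1 < ρ) (hθ : 0 < θ) (hc : 0 ≤ c)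
    (N : ℕ) (Q : ℕ → Prop) [DecidablePred Q] :
    (∑ j ∈ Finset.range N, if Q j then (c * ρ ^ j) ^ θ else 0) ^ θ⁻¹ ≤
      (ρ ^ θ / (ρ ^ θ - 1)) ^ θ⁻¹ * ∑ j ∈ Finset.range N, if Q j then c * ρ ^ j else 0 := by
  have hr : 1 < ρ ^ θ := Real.one_lt_rpow hρ hθ
  have hρ0 : 0 < ρ := by linarith
  by_cases hQ : ((Finset.range N).filter Q).Nonempty
  · set J := ((Finset.range N).filter Q).max' hQ with hJ
    have hJm := Finset.max'_mem _ hQ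
    rw [← hJ, Finset.mem_filter] at hJm
    have hM : 0 ≤ (c * ρ ^ J) ^ θ := by positivity
    have h1 : (∑ j ∈ Finset.range N, if Q j then (c * ρ ^ j) ^ θ else 0) ≤
        (c * ρ ^ J) ^ θ * ρ ^ θ / (ρ ^ θ - 1) := by
      refine le_trans (Finset.sum_le_sum fun j hj => ?_)
        (sum_range_ite_le_of_mul_le_succ (s := fun j => (c * ρ ^ j) ^ θ) hr
          (fun j => by positivity) (fun j => ?_) hM N)
      · split_ifs with h1 h2 h2
        · exact le_rfl
        · refine absurd ?_ h2
          have : j ≤ J := Finset.le_max' _ _ (Finset.mem_filter.2 ⟨hj, h1⟩)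
          gcongr
          exact hρ.le
        · positivity
        · exact le_rfl
      · rw [← Real.mul_rpow hρ0.le (by positivity)]
        apply le_of_eq; congr 1; ring
    calc _ ≤ ((c * ρ ^ J) ^ θ * ρ ^ θ / (ρ ^ θ - 1)) ^ θ⁻¹ := by
          refine Real.rpow_le_rpow (Finset.sum_nonneg fun j _ => ?_) h1 (by positivity)
          split_ifs <;> positivity
      _ = (ρ ^ θ / (ρ ^ θ - 1)) ^ θ⁻¹ * (c * ρ ^ J) := by
          have : 0 ≤ ρ ^ θ / (ρ ^ θ - 1) := div_nonneg (by positivity) (by linarith)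
          rw [mul_div_assoc, Real.mul_rpow hM this, ← Real.rpow_mul (by positivity),
            mul_inv_cancel₀ hθ.ne', Real.rpow_one, mul_comm]
      _ ≤ _ := by
          have h0 : 0 ≤ (ρ ^ θ / (ρ ^ θ - 1)) ^ θ⁻¹ :=
            Real.rpow_nonneg (div_nonneg (by positivity) (by linarith)) _
          refine mul_le_mul_of_nonneg_left ?_ h0
          refine le_trans (le_of_eq ?_) (Finset.single_le_sum
            (f := fun j => if Q j then c * ρ ^ j else 0) (fun j _ => ?_) hJm.1)
          · simp only [if_pos hJm.2]
          · split_ifs <;> positivity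
  · rw [Finset.not_nonempty_iff_eq_empty, Finset.filter_eq_empty_iff] at hQ
    rw [Finset.sum_eq_zero fun j hj => if_neg (hQ hj), Finset.sum_eq_zero fun j hj => if_neg (hQ hj),
      Real.zero_rpow (by positivity), mul_zero]

/-- Integrating distributional estimates that are balanced at dyadic heights. -/
theorem lintegral_rpow_le_of_dyadic_bounds {p ρ S : ℝ} (hp1 : 1 < p) (hp2 : p < 2) (hρ : 1 < ρ)
    {a₁ a₂ e : ℤ → ℝ} {b : ℕ → ℤ → ℝ} (ha₁ : ∀ κ, 0 ≤ a₁ κ) (hb : ∀ j κ, 0 ≤ b j κ)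
    (hba : ∀ N κ, ∑ j ∈ Finset.range N, b j κ ≤ a₂ κ) (hmono : Monotone a₂)
    (hstep : ∀ κ, a₁ κ ≤ a₁ (κ + 1) + ((2 : ℝ) ^ κ)⁻¹ * a₂ (κ + 1))
    (he : ∀ κ, e κ = ((2 : ℝ) ^ κ) ^ (p - 1) * a₁ κ + ((2 : ℝ) ^ κ) ^ (p - 2) * a₂ κ)
    {K : ℤ} (hK₁ : ∀ κ, K ≤ κ → a₁ κ = 0) (hK₂ : ∀ κ, K ≤ κ → a₂ κ = a₂ K)
    (hKb : ∀ j κ, K ≤ κ → b j κ = b j K) (hS : ∀ s : Finset ℤ, ∑ κ ∈ s, e κ ≤ S) {N : ℕ}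
    {D : ℝ → ℝ≥0∞}
    (hD : ∀ lam : ℝ, 0 < lam → ∀ κ : ℕ → ℤ, D lam ≤ ENNReal.ofReal
      (∑ j ∈ Finset.range N, (lam⁻¹ * ((ρ ^ j) ^ (p - 1) * a₁ (κ j)) +
        (lam ^ 2)⁻¹ * ((ρ ^ j) ^ (p - 2) * b j (κ j))))) :
    ∫⁻ lam in Set.Ioi (0 : ℝ), ENNReal.ofReal (lam ^ (p - 1)⁻¹) * D lam ^ (p - 1)⁻¹ ≤
      ENNReal.ofReal
        ((16 : ℝ) ^ (p - 1)⁻¹ * (ρ ^ (p - 1) / (ρ ^ (p - 1) - 1)) ^ (p - 1)⁻¹ * S ^ (p - 1)⁻¹) := by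
  classical
  have h2 : ∀ κ : ℤ, (0 : ℝ) < 2 ^ κ := fun κ => by positivity
  have hρ0 : 0 < ρ := by linarith
  have hθ : 0 < p - 1 := by linarith
  have hq1 : 1 ≤ (p - 1)⁻¹ := (one_le_inv₀ hθ).2 (by linarith)
  have hbj : ∀ j κ, b j κ ≤ a₂ κ := fun j κ =>
    (Finset.single_le_sum (f := fun j => b j κ) (fun i _ => hb i κ)
      (Finset.mem_range.2 j.lt_succ_self)).trans (hba (j + 1) κ)
  have ha₂ : ∀ κ, 0 ≤ a₂ κ := fun κ => (hb 0 κ).trans (hbj 0 κ)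
  have he0 : ∀ κ, 0 ≤ e κ := fun κ => by
    rw [he]
    have := ha₁ κ; have := ha₂ κ; have := h2 κ
    positivity
  have hea₂ : ∀ κ, ((2 : ℝ) ^ κ) ^ (p - 2) * a₂ κ ≤ e κ := fun κ => by
    rw [he]
    have := ha₁ κ; have := h2 κ
    exact le_add_of_nonneg_left (by positivity)
  have hS0 : 0 ≤ S := by simpa using hS ∅
  set M : ℝ := (ρ ^ (p - 1) / (ρ ^ (p - 1) - 1)) ^ (p - 1)⁻¹ with hM
  have hM0 : 0 ≤ M := Real.rpow_nonneg (div_nonneg (by positivity)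
    (sub_nonneg.2 (Real.one_lt_rpow hρ hθ).le)) _
  set Q : ℝ → ℤ → ℕ → Prop := fun lam s j =>
    0 < b j s ∧ lam / 2 ^ s * ρ ^ j * e s ≤ ((2 : ℝ) ^ s) ^ (p - 2) * b j s with hQ
  have hpt : ∀ lam : ℝ, 0 < lam → ∃ s : Finset ℤ, D lam ≤ ENNReal.ofReal (16 * lam ^ (-p) *
      ∑ κ ∈ s, e κ * ∑ j ∈ Finset.range N,
        if Q lam κ j then (lam / 2 ^ κ * ρ ^ j) ^ (p - 1) else 0) := by
    intro lam hlam
    have hl0 : 0 < lam ^ (-p) := Real.rpow_pos_of_pos hlam _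
    choose κ hκ using fun j : ℕ => exists_balanced_height hp1 hp2 hlam (pow_pos hρ0 j) ha₁ (hb j)
      (hbj j) hmono hstep he hK₁ hK₂ (hKb j)
    set good : ℕ → Prop := fun j => ∃ s : ℤ, 0 < b j s ∧
      lam * ρ ^ j / 2 ^ s * e s ≤ ((2 : ℝ) ^ s) ^ (p - 2) * b j s ∧
        lam⁻¹ * ((ρ ^ j) ^ (p - 1) * a₁ (κ j)) + (lam ^ 2)⁻¹ * ((ρ ^ j) ^ (p - 2) * b j (κ j)) ≤
          16 * lam ^ (-p) * ((lam * ρ ^ j / 2 ^ s) ^ (p - 1) * e s) with hgood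
    have : ∀ j, ∃ s, good j → 0 < b j s ∧
      lam * ρ ^ j / 2 ^ s * e s ≤ ((2 : ℝ) ^ s) ^ (p - 2) * b j s ∧
        lam⁻¹ * ((ρ ^ j) ^ (p - 1) * a₁ (κ j)) + (lam ^ 2)⁻¹ * ((ρ ^ j) ^ (p - 2) * b j (κ j)) ≤
          16 * lam ^ (-p) * ((lam * ρ ^ j / 2 ^ s) ^ (p - 1) * e s) := fun j => by
      by_cases h : good j
      · obtain ⟨s, hs⟩ := h
        exact ⟨s, fun _ => hs⟩
      · exact ⟨0, fun h' => absurd h' h⟩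
    choose σ hσ using this
    refine ⟨(Finset.range N).image σ, (hD lam hlam κ).trans (ENNReal.ofReal_le_ofReal ?_)⟩
    have hcomm : ∀ (κ : ℤ) (j : ℕ), lam * ρ ^ j / 2 ^ κ = lam / 2 ^ κ * ρ ^ j := fun κ j => by ring
    have hterm : ∀ κ j, 0 ≤ e κ * if Q lam κ j then (lam / 2 ^ κ * ρ ^ j) ^ (p - 1) else 0 :=
      fun κ j => by
        have := he0 κ; have := h2 κ
        split_ifs <;> positivity
    calc _ ≤ ∑ j ∈ Finset.range N, 16 * lam ^ (-p) * ∑ κ ∈ (Finset.range N).image σ,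
          (e κ * if Q lam κ j then (lam / 2 ^ κ * ρ ^ j) ^ (p - 1) else 0) := by
          refine Finset.sum_le_sum fun j hj => ?_
          rcases hκ j with h | h
          · exact h.trans (mul_nonneg (by positivity) (Finset.sum_nonneg fun κ _ => hterm κ j))
          · obtain ⟨h1, h3, h4⟩ := hσ j h
            refine h4.trans (mul_le_mul_of_nonneg_left ?_ (by positivity))
            refine le_trans (le_of_eq ?_) (Finset.single_le_sum (fun κ _ => hterm κ j)
              (Finset.mem_image_of_mem σ hj))
            rw [if_pos ⟨h1, by rwa [← hcomm]⟩, hcomm, mul_comm]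
      _ = _ := by
          rw [← Finset.mul_sum, Finset.sum_comm]
          simp only [Finset.mul_sum]
  set G : ℤ → ℕ → ℝ → ℝ≥0∞ := fun κ j lam =>
    ENNReal.ofReal (e κ * (ρ ^ j / 2 ^ κ)) * if Q lam κ j then 1 else 0 with hG
  have hq0 : 0 < (p - 1)⁻¹ := by positivity
  have hpt2 : ∀ lam ∈ Set.Ioi (0 : ℝ), ENNReal.ofReal (lam ^ (p - 1)⁻¹) * D lam ^ (p - 1)⁻¹ ≤
      ENNReal.ofReal ((16 : ℝ) ^ (p - 1)⁻¹ * M * S ^ ((p - 1)⁻¹ - 1)) *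
        ∑' κ, ∑ j ∈ Finset.range N, G κ j lam := by
    intro lam hlam
    have hlam : 0 < lam := hlam
    obtain ⟨s, hs⟩ := hpt lam hlam
    set Y : ℤ → ℝ := fun κ => ∑ j ∈ Finset.range N,
        if Q lam κ j then (lam / 2 ^ κ * ρ ^ j) ^ (p - 1) else 0 with hY
    have hY0 : ∀ κ, 0 ≤ Y κ := fun κ => Finset.sum_nonneg fun j _ => by
      have := h2 κ
      split_ifs <;> positivity
    have hH := Real.inner_le_weight_mul_Lp_of_nonneg s hq1 e Y he0 hY0
    have hl0 : 0 < lam ^ (-p) := Real.rpow_pos_of_pos hlam _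
    have hsum0 : 0 ≤ ∑ κ ∈ s, e κ * Y κ :=
      Finset.sum_nonneg fun κ _ => mul_nonneg (he0 κ) (hY0 κ)
    have hsum1 : 0 ≤ ∑ κ ∈ s, e κ * Y κ ^ (p - 1)⁻¹ :=
      Finset.sum_nonneg fun κ _ => mul_nonneg (he0 κ) (Real.rpow_nonneg (hY0 κ) _)
    have hsum2 : 0 ≤ ∑ κ ∈ s, e κ := Finset.sum_nonneg fun κ _ => he0 κ
    have hH' : (∑ κ ∈ s, e κ * Y κ) ^ (p - 1)⁻¹ ≤
        S ^ ((p - 1)⁻¹ - 1) * ∑ κ ∈ s, e κ * Y κ ^ (p - 1)⁻¹ := by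
      refine (Real.rpow_le_rpow hsum0 hH hq0.le).trans ?_
      rw [Real.mul_rpow (by positivity) (by positivity), ← Real.rpow_mul hsum2,
        ← Real.rpow_mul hsum1, inv_mul_cancel₀ hq0.ne', Real.rpow_one]
      refine mul_le_mul_of_nonneg_right ?_ hsum1
      rw [sub_mul, inv_mul_cancel₀ hq0.ne', one_mul]
      exact Real.rpow_le_rpow hsum2 (hS s) (by linarith)
    have hreal : lam ^ (p - 1)⁻¹ * (16 * lam ^ (-p) * ∑ κ ∈ s, e κ * Y κ) ^ (p - 1)⁻¹ ≤
        (16 : ℝ) ^ (p - 1)⁻¹ * M * S ^ ((p - 1)⁻¹ - 1) * ∑ κ ∈ s, ∑ j ∈ Finset.range N,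
          e κ * (ρ ^ j / 2 ^ κ) * if Q lam κ j then 1 else 0 := by
      rw [Real.mul_rpow (by positivity) hsum0, Real.mul_rpow (by norm_num) hl0.le]
      have hexp : lam ^ (p - 1)⁻¹ * (lam ^ (-p)) ^ (p - 1)⁻¹ = lam⁻¹ := by
        rw [← Real.rpow_mul hlam.le, ← Real.rpow_add hlam, ← Real.rpow_neg_one lam]
        congr 1; field_simp; ring
      calc _ = (16 : ℝ) ^ (p - 1)⁻¹ * lam⁻¹ * (∑ κ ∈ s, e κ * Y κ) ^ (p - 1)⁻¹ := by
            rw [← hexp]; ring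
        _ ≤ (16 : ℝ) ^ (p - 1)⁻¹ * lam⁻¹ *
            (S ^ ((p - 1)⁻¹ - 1) * ∑ κ ∈ s, e κ * (M * ∑ j ∈ Finset.range N,
              if Q lam κ j then lam / 2 ^ κ * ρ ^ j else 0)) := by
            refine mul_le_mul_of_nonneg_left (hH'.trans (mul_le_mul_of_nonneg_left
              (Finset.sum_le_sum fun κ _ => mul_le_mul_of_nonneg_left ?_ (he0 κ))
              (by positivity))) (by positivity)
            exact sum_rpow_rpow_inv_le hρ hθ (by have := h2 κ; positivity) N _
        _ = _ := by
            simp only [Finset.mul_sum]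
            refine Finset.sum_congr rfl fun κ _ => Finset.sum_congr rfl fun j _ => ?_
            split_ifs
            · field_simp
            · simp
    have hG' : ∀ κ j, G κ j lam =
        ENNReal.ofReal (e κ * (ρ ^ j / 2 ^ κ) * if Q lam κ j then 1 else 0) := fun κ j => by
      simp only [hG]
      split_ifs <;> simp
    have hGn : ∀ κ j, 0 ≤ e κ * (ρ ^ j / 2 ^ κ) * if Q lam κ j then (1 : ℝ) else 0 := fun κ j => by
      have := he0 κ; have := h2 κ
      split_ifs <;> positivity
    calc _ ≤ ENNReal.ofReal (lam ^ (p - 1)⁻¹) *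
          ENNReal.ofReal (16 * lam ^ (-p) * ∑ κ ∈ s, e κ * Y κ) ^ (p - 1)⁻¹ := by gcongr
      _ = ENNReal.ofReal (lam ^ (p - 1)⁻¹ *
          (16 * lam ^ (-p) * ∑ κ ∈ s, e κ * Y κ) ^ (p - 1)⁻¹) := by
          rw [ENNReal.ofReal_rpow_of_nonneg (by positivity) hq0.le,
            ENNReal.ofReal_mul (by positivity)]
      _ ≤ _ := ENNReal.ofReal_le_ofReal hreal
      _ = ENNReal.ofReal ((16 : ℝ) ^ (p - 1)⁻¹ * M * S ^ ((p - 1)⁻¹ - 1)) *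
          ∑ κ ∈ s, ∑ j ∈ Finset.range N, G κ j lam := by
          rw [ENNReal.ofReal_mul (by positivity), ENNReal.ofReal_sum_of_nonneg
            fun κ _ => Finset.sum_nonneg fun j _ => hGn κ j]
          congr 1
          refine Finset.sum_congr rfl fun κ _ => ?_
          rw [ENNReal.ofReal_sum_of_nonneg fun j _ => hGn κ j]
          exact Finset.sum_congr rfl fun j _ => (hG' κ j).symm
      _ ≤ _ := by gcongr; exact ENNReal.sum_le_tsum s
  have hQm : ∀ κ j, MeasurableSet {lam | Q lam κ j} := fun κ j => by
    have : {lam | Q lam κ j} = {lam | 0 < b j κ} ∩ {lam : ℝ | lam / 2 ^ κ * ρ ^ j * e κ ≤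
      ((2 : ℝ) ^ κ) ^ (p - 2) * b j κ} := rfl
    rw [this]
    exact (MeasurableSet.const _).inter (measurableSet_le (by fun_prop) measurable_const)
  have hGm : ∀ κ j, Measurable (G κ j) := fun κ j =>
    (Measurable.ite (hQm κ j) measurable_const measurable_const).const_mul _
  have hGint : ∀ κ j, ∫⁻ lam in Set.Ioi (0 : ℝ), G κ j lam ≤
      ENNReal.ofReal (((2 : ℝ) ^ κ) ^ (p - 2) * b j κ) := fun κ j => by
    have hB0 : 0 ≤ ((2 : ℝ) ^ κ) ^ (p - 2) * b j κ := by
      have := hb j κ; have := h2 κ; positivity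
    rcases (hb j κ).eq_or_lt with h | h
    · have : ∀ lam, G κ j lam = 0 := fun lam => by
        simp only [hG]
        rw [if_neg fun hc => hc.1.ne h, mul_zero]
      simp [this]
    · have hes : 0 < e κ := lt_of_lt_of_le
        (mul_pos (Real.rpow_pos_of_pos (h2 κ) _) (h.trans_le (hbj j κ))) (hea₂ κ)
      have hc : 0 < e κ * (ρ ^ j / 2 ^ κ) := by have := h2 κ; positivity
      calc ∫⁻ lam in Set.Ioi (0 : ℝ), G κ j lam
          ≤ ∫⁻ lam in Set.Ioi (0 : ℝ), (Set.Iic (((2 : ℝ) ^ κ) ^ (p - 2) * b j κ /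
              (e κ * (ρ ^ j / 2 ^ κ)))).indicator
              (fun _ => ENNReal.ofReal (e κ * (ρ ^ j / 2 ^ κ))) lam := by
            refine lintegral_mono fun lam => ?_
            simp only [hG]
            split_ifs with hq
            · rw [Set.indicator_of_mem, mul_one]
              rw [Set.mem_Iic, le_div_iff₀ hc]
              refine le_trans (le_of_eq ?_) hq.2
              ring
            · simp
        _ = ENNReal.ofReal (((2 : ℝ) ^ κ) ^ (p - 2) * b j κ) := by
            rw [lintegral_indicator_const measurableSet_Iic, Measure.restrict_apply measurableSet_Iic,
              Set.inter_comm, Set.Ioi_inter_Iic, Real.volume_Ioc, sub_zero,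
              ← ENNReal.ofReal_mul hc.le, mul_div_cancel₀ _ hc.ne']
        _ ≤ _ := le_rfl
  calc _ ≤ ∫⁻ lam in Set.Ioi (0 : ℝ),
        ENNReal.ofReal ((16 : ℝ) ^ (p - 1)⁻¹ * M * S ^ ((p - 1)⁻¹ - 1)) *
        ∑' κ, ∑ j ∈ Finset.range N, G κ j lam := setLIntegral_mono' measurableSet_Ioi hpt2
    _ = ENNReal.ofReal ((16 : ℝ) ^ (p - 1)⁻¹ * M * S ^ ((p - 1)⁻¹ - 1)) *
        ∑' κ, ∑ j ∈ Finset.range N, ∫⁻ lam in Set.Ioi (0 : ℝ), G κ j lam := by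
        rw [lintegral_const_mul _ (Measurable.tsum fun κ =>
          Finset.measurable_fun_sum _ fun j _ => hGm κ j), lintegral_tsum fun κ =>
          (Finset.measurable_fun_sum _ fun j _ => hGm κ j).aemeasurable]
        congr 2 with κ
        rw [lintegral_finsetSum _ fun j _ => hGm κ j]
    _ ≤ ENNReal.ofReal ((16 : ℝ) ^ (p - 1)⁻¹ * M * S ^ ((p - 1)⁻¹ - 1)) * ENNReal.ofReal S := by
        gcongr
        rw [ENNReal.tsum_eq_iSup_sum]
        refine iSup_le fun s => ?_
        calc _ ≤ ∑ κ ∈ s, ENNReal.ofReal (e κ) := by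
              refine Finset.sum_le_sum fun κ _ => (Finset.sum_le_sum fun j _ => hGint κ j).trans ?_
              rw [← ENNReal.ofReal_sum_of_nonneg fun j _ => by
                have := hb j κ; have := h2 κ; positivity, ← Finset.mul_sum]
              refine ENNReal.ofReal_le_ofReal (le_trans ?_ (hea₂ κ))
              exact mul_le_mul_of_nonneg_left (hba N κ) (by have := h2 κ; positivity)
          _ = ENNReal.ofReal (∑ κ ∈ s, e κ) :=
              (ENNReal.ofReal_sum_of_nonneg fun κ _ => he0 κ).symm
          _ ≤ _ := ENNReal.ofReal_le_ofReal (hS s)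
    _ = _ := by
        rw [← ENNReal.ofReal_mul (by positivity)]
        congr 1
        rcases hS0.eq_or_lt with h | h
        · rw [← h, Real.zero_rpow hq0.ne']; simp
        · rw [mul_assoc, ← Real.rpow_add_one h.ne', sub_add_cancel]

theorem sum_zpow_rpow_ite_le {θ v : ℝ} (hθ : 0 < θ) (hv : 0 ≤ v) (s : Finset ℤ) :
    ∑ κ ∈ s, (if (2 : ℝ) ^ κ ≤ v then ((2 : ℝ) ^ κ) ^ θ else 0) ≤
      v ^ θ * 2 ^ θ / (2 ^ θ - 1) := by
  have h2 : ∀ κ : ℤ, (0 : ℝ) < 2 ^ κ := fun κ => by positivity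
  obtain ⟨m, hm⟩ : ∃ m : ℕ, ∀ κ ∈ s, -(m : ℤ) ≤ κ ∧ κ < m := by
    refine ⟨∑ κ ∈ s, (κ.natAbs + 1), fun κ hκ => ?_⟩
    have := Finset.single_le_sum (f := fun κ : ℤ => κ.natAbs + 1) (fun _ _ => Nat.zero_le _) hκ
    lia
  have hsub : s ⊆ (Finset.range (2 * m)).image fun j : ℕ => (j : ℤ) - m := fun κ hκ => by
    have := hm κ hκ
    exact Finset.mem_image.2 ⟨(κ + m).toNat, Finset.mem_range.2 (by lia), by lia⟩
  refine (Finset.sum_le_sum_of_subset_of_nonneg hsub fun κ _ _ => by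
    have := h2 κ; split_ifs <;> positivity).trans ?_
  rw [Finset.sum_image fun i _ j _ h => by lia]
  refine le_trans (le_of_eq ?_) (sum_range_ite_le_of_mul_le_succ
    (s := fun j : ℕ => ((2 : ℝ) ^ ((j : ℤ) - m)) ^ θ) (Real.one_lt_rpow one_lt_two hθ)
    (fun j => Real.rpow_nonneg (h2 _).le _) (fun j => ?_) (Real.rpow_nonneg hv θ) (2 * m))
  · refine Finset.sum_congr rfl fun j _ => ?_
    simp only [Real.rpow_le_rpow_iff (h2 _).le hv hθ]
  · rw [← Real.mul_rpow zero_le_two (h2 _).le]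
    apply le_of_eq
    congr 1
    rw [Nat.cast_succ, add_sub_right_comm, zpow_add_one₀ two_ne_zero, mul_comm]

/-- Pointwise dyadic decomposition estimate for `v ^ p`. -/
theorem sum_dyadic_truncation_le {p v : ℝ} (hp1 : 1 < p) (hp2 : p < 2) (hv : 0 ≤ v)
    (s : Finset ℤ) :
    ∑ κ ∈ s, (((2 : ℝ) ^ κ) ^ (p - 1) * (if (2 : ℝ) ^ κ < v then v else 0) +
      ((2 : ℝ) ^ κ) ^ (p - 2) * (if (2 : ℝ) ^ κ < v then 0 else v ^ 2)) ≤
      (2 ^ (p - 1) / (2 ^ (p - 1) - 1) + 2 ^ (2 - p) / (2 ^ (2 - p) - 1)) * v ^ p := by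
  have h2 : ∀ κ : ℤ, (0 : ℝ) < 2 ^ κ := fun κ => by positivity
  rcases hv.eq_or_lt with rfl | hv0
  · simp [Real.zero_rpow (show p ≠ 0 by linarith)]
  rw [Finset.sum_add_distrib, add_mul]
  refine add_le_add ?_ ?_
  · calc _ ≤ ∑ κ ∈ s, v * (if (2 : ℝ) ^ κ ≤ v then ((2 : ℝ) ^ κ) ^ (p - 1) else 0) := by
          refine Finset.sum_le_sum fun κ _ => ?_
          have := h2 κ
          split_ifs with h1 h3 h3
          · rw [mul_comm]
          · exact absurd h1.le h3
          · rw [mul_zero]; positivity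
          · simp
      _ ≤ v * (v ^ (p - 1) * 2 ^ (p - 1) / (2 ^ (p - 1) - 1)) := by
          rw [← Finset.mul_sum]
          exact mul_le_mul_of_nonneg_left (sum_zpow_rpow_ite_le (by linarith) hv s) hv
      _ = _ := by
          have : v ^ p = v * v ^ (p - 1) := by
            rw [mul_comm, ← Real.rpow_add_one hv0.ne', sub_add_cancel]
          rw [this]; ring
  · calc _ ≤ ∑ κ ∈ s, v ^ 2 *
          (if (2 : ℝ) ^ (-κ) ≤ v⁻¹ then ((2 : ℝ) ^ (-κ)) ^ (2 - p) else 0) := by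
          refine Finset.sum_le_sum fun κ _ => ?_
          have := h2 κ
          split_ifs with h1 h3 h3
          · rw [mul_zero]; positivity
          · simp
          · rw [mul_comm, zpow_neg, Real.inv_rpow (h2 κ).le, ← Real.rpow_neg (h2 κ).le, neg_sub]
          · refine absurd ?_ h3
            rw [zpow_neg]
            exact inv_anti₀ hv0 (not_lt.1 h1)
      _ = v ^ 2 * ∑ κ ∈ s.image Neg.neg,
          (if (2 : ℝ) ^ κ ≤ v⁻¹ then ((2 : ℝ) ^ κ) ^ (2 - p) else 0) := by
          rw [← Finset.mul_sum, Finset.sum_image fun i _ j _ h => neg_injective h]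
      _ ≤ v ^ 2 * (v⁻¹ ^ (2 - p) * 2 ^ (2 - p) / (2 ^ (2 - p) - 1)) :=
          mul_le_mul_of_nonneg_left
            (sum_zpow_rpow_ite_le (by linarith) (inv_nonneg.2 hv) _) (by positivity)
      _ = _ := by
          have : v ^ p = v ^ 2 * v⁻¹ ^ (2 - p) := by
            rw [Real.inv_rpow hv, ← Real.rpow_neg hv, ← Real.rpow_natCast, ← Real.rpow_add hv0]
            congr 1; push_cast; ring
          rw [this]; ring

section Truncation

variable {d : ℕ} {γ : ℝ → EuclideanSpace ℝ (Fin d)} {α β δ C : ℝ}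
  {f : EuclideanSpace ℝ (Fin d) → ℂ}

theorem BoundedIntegrable.lintegral_enorm_ne_top (hf : BoundedIntegrable f) :
    ∫⁻ x, ‖f x‖ₑ ≠ ∞ := hf.integrable.2.ne

theorem BoundedIntegrable.lintegral_enorm_sq_ne_top (hf : BoundedIntegrable f) :
    ∫⁻ x, ‖f x‖ₑ ^ 2 ≠ ∞ := by
  have h := hf.memLp_two.integrable_norm_pow (by norm_num)
  have := h.2.ne
  simpa [enorm_pow] using this

/-- The part of `f` where `‖f‖ ≤ h`. -/
noncomputable def lowPart (f : EuclideanSpace ℝ (Fin d) → ℂ) (h : ℝ) :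
    EuclideanSpace ℝ (Fin d) → ℂ := {x | ‖f x‖ ≤ h}.indicator f

/-- The part of `f` where `h < ‖f‖`. -/
noncomputable def highPart (f : EuclideanSpace ℝ (Fin d) → ℂ) (h : ℝ) :
    EuclideanSpace ℝ (Fin d) → ℂ := {x | h < ‖f x‖}.indicator f

theorem BoundedIntegrable.lowPart (hf : BoundedIntegrable f) (h : ℝ) :
    BoundedIntegrable (lowPart f h) :=
  hf.indicator (measurableSet_le hf.measurable.norm measurable_const)

theorem BoundedIntegrable.highPart (hf : BoundedIntegrable f) (h : ℝ) :
    BoundedIntegrable (highPart f h) :=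
  hf.indicator (measurableSet_lt measurable_const hf.measurable.norm)

theorem lowPart_add_highPart (f : EuclideanSpace ℝ (Fin d) → ℂ) (h : ℝ)
    (x : EuclideanSpace ℝ (Fin d)) : f x = lowPart f h x + highPart f h x := by
  by_cases hx : ‖f x‖ ≤ h
  · simp [lowPart, highPart, hx]
  · simp [lowPart, highPart, hx, not_le.1 hx]

theorem enorm_lowPart_sq (f : EuclideanSpace ℝ (Fin d) → ℂ) (h : ℝ)
    (x : EuclideanSpace ℝ (Fin d)) :
    ‖lowPart f h x‖ₑ ^ 2 = ENNReal.ofReal (if h < ‖f x‖ then 0 else ‖f x‖ ^ 2) := by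
  by_cases hx : ‖f x‖ ≤ h
  · rw [lowPart, Set.indicator_of_mem (by exact hx), if_neg (not_lt.2 hx),
      ENNReal.ofReal_pow (norm_nonneg _), ofReal_norm]
  · rw [lowPart, Set.indicator_of_notMem (by exact hx), if_pos (not_le.1 hx)]
    simp

theorem enorm_highPart (f : EuclideanSpace ℝ (Fin d) → ℂ) (h : ℝ)
    (x : EuclideanSpace ℝ (Fin d)) :
    ‖highPart f h x‖ₑ = ENNReal.ofReal (if h < ‖f x‖ then ‖f x‖ else 0) := by
  by_cases hx : h < ‖f x‖
  · rw [highPart, Set.indicator_of_mem (by exact hx), if_pos hx, ofReal_norm]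
  · rw [highPart, Set.indicator_of_notMem (by exact hx), if_neg hx]
    simp

theorem exists_lintegral_rpow_sum_dyadicPiece_le_of_lt_two {p ρ : ℝ} (hγ : Continuous γ)
    (hα : 0 ≤ α) (hp1 : 1 < p) (hp2 : p < 2) (hρ : 1 < ρ)
    (hαρ : ∀ j : ℕ, Real.exp (α * j) ≤ (ρ ^ j) ^ (p - 1))
    (hδρ : ∀ j : ℕ, Real.exp (j * δ) ^ (-2 : ℤ) = (ρ ^ j) ^ (p - 2)) (hC0 : 0 < C)
    (hC : ∀ (ξ : EuclideanSpace ℝ (Fin d)) (N : ℕ),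
      ∑ j ∈ Finset.range N, Real.exp (j * δ) * ‖dyadicMultiplier γ α β j ξ‖ ≤ C) :
    ∃ A : ℝ, ∀ f : EuclideanSpace ℝ (Fin d) → ℂ, BoundedIntegrable f →
      ∫⁻ x, ENNReal.ofReal (‖f x‖ ^ p) ≤ 1 → ∀ N : ℕ,
      ∫⁻ lam in Set.Ioi (0 : ℝ), ENNReal.ofReal (lam ^ (p - 1)⁻¹) *
        volume {x | lam < ‖∑ j ∈ Finset.range N, dyadicPiece γ α β j f x‖} ^ (p - 1)⁻¹ ≤
          ENNReal.ofReal A := by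
  have h2 : ∀ κ : ℤ, (0 : ℝ) < 2 ^ κ := fun κ => by positivity
  have hρ0 : 0 < ρ := by linarith
  set S : ℝ := 2 ^ (p - 1) / (2 ^ (p - 1) - 1) + 2 ^ (2 - p) / (2 ^ (2 - p) - 1) with hSdef
  have hS0 : 0 ≤ S := by
    have h1 := Real.one_lt_rpow one_lt_two (show 0 < p - 1 by linarith)
    have h3 := Real.one_lt_rpow one_lt_two (show 0 < 2 - p by linarith)
    exact add_nonneg (div_nonneg (by positivity) (by linarith))
      (div_nonneg (by positivity) (by linarith))
  set M : ℝ := 4 * Real.exp α + 4 * C ^ 2 with hM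
  have hM0 : 0 < M := by positivity
  have hq0 : 0 < (p - 1)⁻¹ := inv_pos.2 (by linarith)
  refine ⟨M ^ (p - 1)⁻¹ * ((16 : ℝ) ^ (p - 1)⁻¹ *
    (ρ ^ (p - 1) / (ρ ^ (p - 1) - 1)) ^ (p - 1)⁻¹ * S ^ (p - 1)⁻¹), fun f hf hfp N => ?_⟩
  set a₁ : ℤ → ℝ := fun κ => (∫⁻ x, ‖highPart f (2 ^ κ) x‖ₑ).toReal with ha₁
  set a₂ : ℤ → ℝ := fun κ => (∫⁻ x, ‖lowPart f (2 ^ κ) x‖ₑ ^ 2).toReal with ha₂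
  set b : ℕ → ℤ → ℝ := fun j κ => (dyadicEnergy γ α β δ j (lowPart f (2 ^ κ))).toReal / C with hb
  have hA₁ : ∀ κ, ENNReal.ofReal (a₁ κ) = ∫⁻ x, ‖highPart f (2 ^ κ) x‖ₑ := fun κ =>
    ENNReal.ofReal_toReal (hf.highPart _).lintegral_enorm_ne_top
  have hA₂ : ∀ κ, ENNReal.ofReal (a₂ κ) = ∫⁻ x, ‖lowPart f (2 ^ κ) x‖ₑ ^ 2 := fun κ =>
    ENNReal.ofReal_toReal (hf.lowPart _).lintegral_enorm_sq_ne_top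
  have hEsum : ∀ (N : ℕ) (κ : ℤ), ∑ j ∈ Finset.range N, dyadicEnergy γ α β δ j (lowPart f (2 ^ κ)) ≤
      ENNReal.ofReal (C * a₂ κ) := fun N κ => by
    rw [ENNReal.ofReal_mul hC0.le, hA₂]
    exact sum_dyadicEnergy_le hγ hC (hf.lowPart _) N
  have hEtop : ∀ (j : ℕ) (κ : ℤ), dyadicEnergy γ α β δ j (lowPart f (2 ^ κ)) ≠ ∞ := fun j κ =>
    ne_top_of_le_ne_top ENNReal.ofReal_ne_top ((Finset.single_le_sum
      (f := fun j => dyadicEnergy γ α β δ j (lowPart f (2 ^ κ))) (fun _ _ => zero_le)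
      (Finset.mem_range.2 j.lt_succ_self)).trans (hEsum (j + 1) κ))
  have hE : ∀ (j : ℕ) (κ : ℤ), dyadicEnergy γ α β δ j (lowPart f (2 ^ κ)) =
      ENNReal.ofReal (C * b j κ) :=
    fun j κ => by
      simp only [hb]
      rw [mul_div_cancel₀ _ hC0.ne', ENNReal.ofReal_toReal (hEtop j κ)]
  have hb0 : ∀ j κ, 0 ≤ b j κ := fun j κ => div_nonneg ENNReal.toReal_nonneg hC0.le
  have ha₁0 : ∀ κ, 0 ≤ a₁ κ := fun κ => ENNReal.toReal_nonneg
  have ha₂0 : ∀ κ, 0 ≤ a₂ κ := fun κ => ENNReal.toReal_nonneg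
  have hba : ∀ N κ, ∑ j ∈ Finset.range N, b j κ ≤ a₂ κ := fun N κ => by
    have h := hEsum N κ
    simp only [hE] at h
    rw [← ENNReal.ofReal_sum_of_nonneg fun j _ => mul_nonneg hC0.le (hb0 j κ),
      ENNReal.ofReal_le_ofReal_iff (mul_nonneg hC0.le (ha₂0 κ)), ← Finset.mul_sum] at h
    exact le_of_mul_le_mul_left h hC0
  have hmono : Monotone a₂ := fun κ κ' h => by
    refine ENNReal.toReal_mono (hf.lowPart _).lintegral_enorm_sq_ne_top
      (lintegral_mono fun x => ?_)
    simp only [enorm_lowPart_sq]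
    refine ENNReal.ofReal_le_ofReal ?_
    have : (2 : ℝ) ^ κ ≤ 2 ^ κ' := zpow_le_zpow_right₀ one_le_two h
    split_ifs
    · exact le_rfl
    · positivity
    · linarith
    · exact le_rfl
  have hstep : ∀ κ, a₁ κ ≤ a₁ (κ + 1) + ((2 : ℝ) ^ κ)⁻¹ * a₂ (κ + 1) := fun κ => by
    have hz : (2 : ℝ) ^ (κ + 1) = 2 ^ κ * 2 := zpow_add_one₀ two_ne_zero κ
    have h0 := h2 κ
    rw [← ENNReal.ofReal_le_ofReal_iff (by have := ha₁0 (κ + 1); have := ha₂0 (κ + 1); positivity),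
      ENNReal.ofReal_add (ha₁0 _) (by have := ha₂0 (κ + 1); positivity),
      ENNReal.ofReal_mul (by positivity), hA₁, hA₁, hA₂,
      ← lintegral_const_mul _ ((hf.lowPart _).measurable.enorm.pow_const 2),
      ← lintegral_add_left (hf.highPart _).measurable.enorm]
    refine lintegral_mono fun x => ?_
    simp only [enorm_lowPart_sq, enorm_highPart]
    rw [← ENNReal.ofReal_mul (by positivity), ← ENNReal.ofReal_add (by split_ifs <;> positivity)
      (by split_ifs <;> positivity)]
    refine ENNReal.ofReal_le_ofReal ?_
    split_ifs with h3 h4 h4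
    · simp
    · rw [zero_add, inv_mul_eq_div, le_div_iff₀ h0, sq]
      exact mul_le_mul_of_nonneg_left h3.le (norm_nonneg _)
    · simp
    · positivity
  obtain ⟨B, hB⟩ := hf.bounded
  obtain ⟨n, hn⟩ := pow_unbounded_of_one_lt B (one_lt_two : (1 : ℝ) < 2)
  have hBκ : ∀ κ : ℤ, (n : ℤ) ≤ κ → ∀ x, ‖f x‖ ≤ 2 ^ κ := fun κ hκ x => by
    refine ((hB x).trans hn.le).trans ?_
    rw [← zpow_natCast]
    exact zpow_le_zpow_right₀ one_le_two hκ
  have hlow : ∀ κ : ℤ, (n : ℤ) ≤ κ → lowPart f (2 ^ κ) = f := fun κ hκ => by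
    ext x
    exact Set.indicator_of_mem (s := {x | ‖f x‖ ≤ 2 ^ κ}) (hBκ κ hκ x) f
  have hK₁ : ∀ κ : ℤ, (n : ℤ) ≤ κ → a₁ κ = 0 := fun κ hκ => by
    simp only [ha₁, enorm_highPart, not_lt.2 (hBκ κ hκ _), if_false]
    simp
  have hK₂ : ∀ κ : ℤ, (n : ℤ) ≤ κ → a₂ κ = a₂ n := fun κ hκ => by
    simp only [ha₂]
    rw [hlow κ hκ, hlow n le_rfl]
  have hKb : ∀ j, ∀ κ : ℤ, (n : ℤ) ≤ κ → b j κ = b j n := fun j κ hκ => by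
    simp only [hb]
    rw [hlow κ hκ, hlow n le_rfl]
  have hSsum : ∀ s : Finset ℤ, ∑ κ ∈ s, (((2 : ℝ) ^ κ) ^ (p - 1) * a₁ κ +
      ((2 : ℝ) ^ κ) ^ (p - 2) * a₂ κ) ≤ S := fun s => by
    have hP : ∀ κ : ℤ, 0 ≤ ((2 : ℝ) ^ κ) ^ (p - 1) := fun κ => Real.rpow_nonneg (h2 κ).le _
    have hQ : ∀ κ : ℤ, 0 ≤ ((2 : ℝ) ^ κ) ^ (p - 2) := fun κ => Real.rpow_nonneg (h2 κ).le _
    rw [← ENNReal.ofReal_le_ofReal_iff hS0, ENNReal.ofReal_sum_of_nonneg fun κ _ =>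
      add_nonneg (mul_nonneg (hP κ) (ha₁0 κ)) (mul_nonneg (hQ κ) (ha₂0 κ))]
    calc _ = ∑ κ ∈ s, ∫⁻ x, (ENNReal.ofReal (((2 : ℝ) ^ κ) ^ (p - 1)) * ‖highPart f (2 ^ κ) x‖ₑ +
          ENNReal.ofReal (((2 : ℝ) ^ κ) ^ (p - 2)) * ‖lowPart f (2 ^ κ) x‖ₑ ^ 2) := by
          refine Finset.sum_congr rfl fun κ _ => ?_
          rw [ENNReal.ofReal_add (mul_nonneg (hP κ) (ha₁0 κ)) (mul_nonneg (hQ κ) (ha₂0 κ)),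
            ENNReal.ofReal_mul (hP κ), ENNReal.ofReal_mul (hQ κ), hA₁, hA₂,
            lintegral_add_left ((hf.highPart _).measurable.enorm.const_mul _),
            lintegral_const_mul _ (hf.highPart _).measurable.enorm,
            lintegral_const_mul _ ((hf.lowPart _).measurable.enorm.pow_const 2)]
      _ = ∫⁻ x, ∑ κ ∈ s, (ENNReal.ofReal (((2 : ℝ) ^ κ) ^ (p - 1)) * ‖highPart f (2 ^ κ) x‖ₑ +
          ENNReal.ofReal (((2 : ℝ) ^ κ) ^ (p - 2)) * ‖lowPart f (2 ^ κ) x‖ₑ ^ 2) := by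
          refine (lintegral_finsetSum _ fun κ _ => ?_).symm
          exact ((hf.highPart _).measurable.enorm.const_mul _).add
            (((hf.lowPart _).measurable.enorm.pow_const 2).const_mul _)
      _ ≤ ∫⁻ x, ENNReal.ofReal S * ENNReal.ofReal (‖f x‖ ^ p) := by
          refine lintegral_mono fun x => ?_
          rw [← ENNReal.ofReal_mul hS0]
          refine le_trans (le_of_eq ?_)
            (ENNReal.ofReal_le_ofReal (sum_dyadic_truncation_le hp1 hp2 (norm_nonneg (f x)) s))
          have i1 : ∀ κ : ℤ, 0 ≤ if (2 : ℝ) ^ κ < ‖f x‖ then ‖f x‖ else 0 := fun κ => by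
            split_ifs <;> positivity
          have i2 : ∀ κ : ℤ, 0 ≤ if (2 : ℝ) ^ κ < ‖f x‖ then 0 else ‖f x‖ ^ 2 := fun κ => by
            split_ifs <;> positivity
          rw [ENNReal.ofReal_sum_of_nonneg fun κ _ =>
            add_nonneg (mul_nonneg (hP κ) (i1 κ)) (mul_nonneg (hQ κ) (i2 κ))]
          refine Finset.sum_congr rfl fun κ _ => ?_
          rw [ENNReal.ofReal_add (mul_nonneg (hP κ) (i1 κ)) (mul_nonneg (hQ κ) (i2 κ)),
            ENNReal.ofReal_mul (hP κ), ENNReal.ofReal_mul (hQ κ), enorm_highPart, enorm_lowPart_sq]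
      _ = ENNReal.ofReal S * ∫⁻ x, ENNReal.ofReal (‖f x‖ ^ p) :=
          lintegral_const_mul' _ _ ENNReal.ofReal_ne_top
      _ ≤ ENNReal.ofReal S * 1 := by gcongr
      _ = _ := mul_one _
  have hD : ∀ lam : ℝ, 0 < lam → ∀ κ : ℕ → ℤ,
      ENNReal.ofReal M⁻¹ *
        volume {x | lam < ‖∑ j ∈ Finset.range N, dyadicPiece γ α β j f x‖} ≤
      ENNReal.ofReal (∑ j ∈ Finset.range N, (lam⁻¹ * ((ρ ^ j) ^ (p - 1) * a₁ (κ j)) +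
        (lam ^ 2)⁻¹ * ((ρ ^ j) ^ (p - 2) * b j (κ j)))) := by
    intro lam hlam κ
    have h := volume_lt_norm_sum_dyadicPiece_le hγ hα hC (fun j => hf.lowPart (2 ^ κ j))
      (fun j => hf.highPart (2 ^ κ j)) (fun j x => lowPart_add_highPart f (2 ^ κ j) x) N hlam
    simp only [hE, ← hA₁] at h
    have hn1 : ∀ j, 0 ≤ (ρ ^ j) ^ (p - 1) * a₁ (κ j) := fun j =>
      mul_nonneg (by positivity) (ha₁0 _)
    have hn2 : ∀ j, 0 ≤ (ρ ^ j) ^ (p - 2) * b j (κ j) := fun j =>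
      mul_nonneg (by positivity) (hb0 _ _)
    have hs1 : 0 ≤ ∑ j ∈ Finset.range N, (ρ ^ j) ^ (p - 1) * a₁ (κ j) :=
      Finset.sum_nonneg fun j _ => hn1 j
    have hs2 : 0 ≤ ∑ j ∈ Finset.range N, (ρ ^ j) ^ (p - 2) * b j (κ j) :=
      Finset.sum_nonneg fun j _ => hn2 j
    have hl2 : 0 < lam / 2 := by positivity
    have e1 : (∑ j ∈ Finset.range N, ENNReal.ofReal (2 * Real.exp α * Real.exp (α * j)) *
        ENNReal.ofReal (a₁ (κ j))) / ENNReal.ofReal (lam / 2) ≤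
        ENNReal.ofReal (4 * Real.exp α * (lam⁻¹ *
          ∑ j ∈ Finset.range N, (ρ ^ j) ^ (p - 1) * a₁ (κ j))) := by
      have : ∑ j ∈ Finset.range N, ENNReal.ofReal (2 * Real.exp α * Real.exp (α * j)) *
          ENNReal.ofReal (a₁ (κ j)) ≤ ENNReal.ofReal (2 * Real.exp α *
          ∑ j ∈ Finset.range N, (ρ ^ j) ^ (p - 1) * a₁ (κ j)) := by
        rw [Finset.mul_sum, ENNReal.ofReal_sum_of_nonneg fun j _ =>
          mul_nonneg (by positivity) (hn1 j)]
        refine Finset.sum_le_sum fun j _ => ?_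
        rw [← ENNReal.ofReal_mul (by positivity), mul_assoc]
        refine ENNReal.ofReal_le_ofReal (mul_le_mul_of_nonneg_left ?_ (by positivity))
        exact mul_le_mul_of_nonneg_right (hαρ j) (ha₁0 _)
      refine (ENNReal.div_le_div_right this _).trans (le_of_eq ?_)
      rw [← ENNReal.ofReal_div_of_pos hl2]
      congr 1; field_simp; ring
    have e2 : (ENNReal.ofReal C * ∑ j ∈ Finset.range N,
        ENNReal.ofReal (Real.exp (j * δ) ^ (-2 : ℤ)) * ENNReal.ofReal (C * b j (κ j))) /
        ENNReal.ofReal (lam / 2) ^ 2 =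
        ENNReal.ofReal (4 * C ^ 2 * ((lam ^ 2)⁻¹ *
          ∑ j ∈ Finset.range N, (ρ ^ j) ^ (p - 2) * b j (κ j))) := by
      have : ∑ j ∈ Finset.range N,
        ENNReal.ofReal (Real.exp (j * δ) ^ (-2 : ℤ)) * ENNReal.ofReal (C * b j (κ j)) =
          ENNReal.ofReal (C * ∑ j ∈ Finset.range N, (ρ ^ j) ^ (p - 2) * b j (κ j)) := by
        rw [Finset.mul_sum, ENNReal.ofReal_sum_of_nonneg fun j _ => mul_nonneg hC0.le (hn2 j)]
        refine Finset.sum_congr rfl fun j _ => ?_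
        rw [hδρ, ← ENNReal.ofReal_mul (by positivity)]
        congr 1; ring
      rw [this, ← ENNReal.ofReal_mul hC0.le, ← ENNReal.ofReal_pow hl2.le,
        ← ENNReal.ofReal_div_of_pos (by positivity)]
      congr 1; field_simp; ring
    rw [e2] at h
    have h3 := h.trans (add_le_add_left e1 _)
    rw [← ENNReal.ofReal_add (by positivity) (by positivity)] at h3
    refine (mul_le_mul_right h3 _).trans ?_
    rw [← ENNReal.ofReal_mul (by positivity)]
    refine ENNReal.ofReal_le_ofReal ?_
    rw [inv_mul_le_iff₀ hM0, Finset.sum_add_distrib, ← Finset.mul_sum, ← Finset.mul_sum, mul_add]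
    refine add_le_add (mul_le_mul_of_nonneg_right ?_ (by positivity))
      (mul_le_mul_of_nonneg_right ?_ (by positivity))
    · rw [hM]; exact le_add_of_nonneg_right (by positivity)
    · rw [hM]; exact le_add_of_nonneg_left (by positivity)
  have hfinal := lintegral_rpow_le_of_dyadic_bounds hp1 hp2 hρ ha₁0 hb0 hba hmono hstep
    (fun κ => rfl) hK₁ hK₂ hKb hSsum hD
  have hMq : ENNReal.ofReal M ^ (p - 1)⁻¹ * ENNReal.ofReal M⁻¹ ^ (p - 1)⁻¹ = 1 := by
    rw [← ENNReal.mul_rpow_of_nonneg _ _ hq0.le, ← ENNReal.ofReal_mul hM0.le,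
      mul_inv_cancel₀ hM0.ne', ENNReal.ofReal_one, ENNReal.one_rpow]
  calc _ = ENNReal.ofReal M ^ (p - 1)⁻¹ * ∫⁻ lam in Set.Ioi (0 : ℝ),
        ENNReal.ofReal (lam ^ (p - 1)⁻¹) * (ENNReal.ofReal M⁻¹ *
          volume {x | lam < ‖∑ j ∈ Finset.range N, dyadicPiece γ α β j f x‖}) ^ (p - 1)⁻¹ := by
        rw [← lintegral_const_mul' _ _ (ENNReal.rpow_ne_top_of_nonneg hq0.le ENNReal.ofReal_ne_top)]
        refine lintegral_congr fun lam => ?_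
        rw [ENNReal.mul_rpow_of_nonneg _ _ hq0.le, mul_left_comm, ← mul_assoc _ _ (_ ^ (p - 1)⁻¹),
          hMq, one_mul]
    _ ≤ _ := mul_le_mul_right hfinal _
    _ = _ := by
        rw [ENNReal.ofReal_rpow_of_nonneg hM0.le hq0.le, ← ENNReal.ofReal_mul (by positivity)]

end Truncation

theorem volume_lt_norm_le_liminf {X : Type*} [MeasurableSpace X] {μ : Measure X}
    {g : ℕ → X → ℂ} {h : X → ℂ} (hg : ∀ n, Measurable (g n))
    (hlim : ∀ x, Tendsto (fun n => g n x) atTop (𝓝 (h x))) (lam : ℝ) :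
    μ {x | lam < ‖h x‖} ≤ liminf (fun n => μ {x | lam < ‖g n x‖}) atTop := by
  have hh : Measurable h := measurable_of_tendsto_metrizable hg (tendsto_pi_nhds.2 hlim)
  have hms : ∀ {u : X → ℂ}, Measurable u → MeasurableSet {x | lam < ‖u x‖} := fun hu =>
    measurableSet_lt measurable_const hu.norm
  simp_rw [← lintegral_indicator_one (hms hh), ← lintegral_indicator_one (hms (hg _))]
  refine le_trans (lintegral_mono fun x => ?_)
    (lintegral_liminf_le fun n => measurable_one.indicator (hms (hg n)))
  by_cases hx : lam < ‖h x‖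
  · refine le_liminf_of_le (by isBoundedDefault) ?_
    filter_upwards [(hlim x).norm.eventually_const_lt hx] with n hn
    rw [Set.indicator_of_mem (s := {x | lam < ‖g n x‖}) hn]
    exact Set.indicator_le_self _ _ x
  · rw [Set.indicator_of_notMem (by exact hx)]
    exact zero_le

theorem lintegral_rpow_volume_le_of_tendsto {X : Type*} [MeasurableSpace X] {μ : Measure X}
    {g : ℕ → X → ℂ} {h : X → ℂ} (hg : ∀ n, Measurable (g n))
    (hlim : ∀ x, Tendsto (fun n => g n x) atTop (𝓝 (h x))) {r q : ℝ} (hq : 0 ≤ q) {A : ℝ≥0∞}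
    (hA : ∀ n, ∫⁻ lam in Set.Ioi (0 : ℝ),
      ENNReal.ofReal (lam ^ r) * μ {x | lam < ‖g n x‖} ^ q ≤ A) :
    ∫⁻ lam in Set.Ioi (0 : ℝ), ENNReal.ofReal (lam ^ r) * μ {x | lam < ‖h x‖} ^ q ≤ A := by
  have hmeas : ∀ n, Measurable fun lam : ℝ =>
      ENNReal.ofReal (lam ^ r) * μ {x | lam < ‖g n x‖} ^ q := fun n => by
    have : Measurable fun lam : ℝ => μ {x | lam < ‖g n x‖} :=
      Antitone.measurable fun a b hab => measure_mono fun x hx => lt_of_le_of_lt hab hx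
    exact Measurable.mul (by fun_prop) (this.pow_const q)
  calc _ ≤ ∫⁻ lam in Set.Ioi (0 : ℝ), liminf (fun n =>
        ENNReal.ofReal (lam ^ r) * μ {x | lam < ‖g n x‖} ^ q) atTop := by
        refine lintegral_mono fun lam => ?_
        have hm : Monotone fun a : ℝ≥0∞ => ENNReal.ofReal (lam ^ r) * a ^ q := fun a b hab =>
          mul_le_mul_right (ENNReal.rpow_le_rpow hab hq) _
        have hc : Continuous fun a : ℝ≥0∞ => ENNReal.ofReal (lam ^ r) * a ^ q :=
          (ENNReal.continuous_const_mul ENNReal.ofReal_ne_top).comp ENNReal.continuous_rpow_const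
        refine (hm (volume_lt_norm_le_liminf hg hlim lam)).trans (le_of_eq ?_)
        exact hm.map_liminf_of_continuousAt _ hc.continuousAt
    _ ≤ liminf (fun n => ∫⁻ lam in Set.Ioi (0 : ℝ),
        ENNReal.ofReal (lam ^ r) * μ {x | lam < ‖g n x‖} ^ q) atTop := lintegral_liminf_le hmeas
    _ ≤ A := (liminf_le_liminf (Eventually.of_forall hA)).trans (by simp)

section Assembly

variable {d : ℕ} {γ : ℝ → EuclideanSpace ℝ (Fin d)} {α β C : ℝ}

theorem exists_lintegral_rpow_sum_dyadicPiece_le_of_eq_two (hγ : Continuous γ) (hC0 : 0 < C)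
    (hC : ∀ (ξ : EuclideanSpace ℝ (Fin d)) (N : ℕ),
      ∑ j ∈ Finset.range N, ‖dyadicMultiplier γ α β j ξ‖ ≤ C) :
    ∃ A : ℝ, ∀ f : EuclideanSpace ℝ (Fin d) → ℂ, BoundedIntegrable f →
      ∫⁻ x, ENNReal.ofReal (‖f x‖ ^ (2 : ℝ)) ≤ 1 → ∀ N : ℕ,
      ∫⁻ lam in Set.Ioi (0 : ℝ), ENNReal.ofReal (lam ^ ((2 : ℝ) - 1)⁻¹) *
        volume {x | lam < ‖∑ j ∈ Finset.range N, dyadicPiece γ α β j f x‖} ^ ((2 : ℝ) - 1)⁻¹ ≤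
          ENNReal.ofReal A := by
  have hC' : ∀ (ξ : EuclideanSpace ℝ (Fin d)) (N : ℕ), ∑ j ∈ Finset.range N,
      Real.exp (j * (0 : ℝ)) * ‖dyadicMultiplier γ α β j ξ‖ ≤ C := by simpa using hC
  have hsq : ∀ z : ℂ, ENNReal.ofReal (‖z‖ ^ (2 : ℝ)) = ‖z‖ₑ ^ 2 := fun z => by
    rw [Real.rpow_two, ENNReal.ofReal_pow (norm_nonneg _), ofReal_norm]
  refine ⟨C * C, fun f hf hfp N => ?_⟩
  simp only [hsq] at hfp
  set g : EuclideanSpace ℝ (Fin d) → ℂ :=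
    fun x => ∑ j ∈ Finset.range N, dyadicPiece γ α β j f x with hg
  have hgm : Measurable g := (BoundedIntegrable.sum (Finset.range N)
    (F := fun j => dyadicPiece γ α β j f) fun j _ => hf.dyadicPiece hγ j).measurable
  have h1 : ∫⁻ x, ‖g x‖ₑ ^ 2 ≤ ENNReal.ofReal (C * C) := by
    refine (lintegral_enorm_sum_dyadicPiece_sq_le hγ hC' (fun _ => hf) N).trans ?_
    rw [ENNReal.ofReal_mul hC0.le]
    gcongr
    simp only [mul_zero, Real.exp_zero, one_zpow, ENNReal.ofReal_one, one_mul]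
    calc _ ≤ ENNReal.ofReal C * ∫⁻ x, ‖f x‖ₑ ^ 2 := sum_dyadicEnergy_le hγ hC' hf N
      _ ≤ ENNReal.ofReal C * 1 := by gcongr
      _ = _ := mul_one _
  have h2 := lintegral_rpow_eq_lintegral_meas_lt_mul volume
    (Eventually.of_forall fun x => norm_nonneg (g x)) hgm.norm.aemeasurable two_pos
  simp only [hsq] at h2
  rw [h2] at h1
  refine le_trans ?_ h1
  simp only [show (2 : ℝ) - 1 = 1 by norm_num, inv_one, ENNReal.rpow_one]
  calc _ = 1 * ∫⁻ lam in Set.Ioi (0 : ℝ),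
        volume {x | lam < ‖g x‖} * ENNReal.ofReal (lam ^ (1 : ℝ)) := by
        rw [one_mul]
        exact lintegral_congr fun lam => mul_comm _ _
    _ ≤ _ := by
        gcongr
        rw [← ENNReal.ofReal_one]
        exact ENNReal.ofReal_le_ofReal one_le_two

/-- The endpoint estimate for the truncated operators. -/
theorem IsWellCurved.exists_lintegral_rpow_sum_dyadicPiece_le (hd : 0 < d) (hγ : IsWellCurved d γ)
    (hα : 0 < α) (hβ : 0 < β) {p : ℝ} (hp1 : 1 < p) (hp2 : p ≤ 2)
    (hcrit : p / (p - 1) ≤ 2 * β / ((d + 1) * α)) :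
    ∃ A : ℝ, ∀ f : EuclideanSpace ℝ (Fin d) → ℂ, BoundedIntegrable f →
      ∫⁻ x, ENNReal.ofReal (‖f x‖ ^ p) ≤ 1 → ∀ N : ℕ,
      ∫⁻ lam in Set.Ioi (0 : ℝ), ENNReal.ofReal (lam ^ (p - 1)⁻¹) *
        volume {x | lam < ‖∑ j ∈ Finset.range N, dyadicPiece γ α β j f x‖} ^ (p - 1)⁻¹ ≤
          ENNReal.ofReal A := by
  have hγc : Continuous γ := hγ.1.continuous
  obtain ⟨C, hC0, hC⟩ := hγ.exists_sum_norm_dyadicMultiplier_le hd hα.le hβ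
  have hp0 : 0 < p - 1 := by linarith
  set b : ℝ := β / (d + 1) with hb
  have hb0 : 0 < b := by positivity
  have hαb : p * α ≤ 2 * b * (p - 1) := by
    rw [div_le_div_iff₀ hp0 (by positivity)] at hcrit
    rw [hb, mul_div_assoc', div_mul_eq_mul_div, le_div_iff₀ (by positivity)]
    linarith
  have hC' : ∀ δ, δ ≤ b - α → ∀ (ξ : EuclideanSpace ℝ (Fin d)) (N : ℕ),
      ∑ j ∈ Finset.range N, Real.exp (j * δ) * ‖dyadicMultiplier γ α β j ξ‖ ≤ C :=
    fun δ hδ ξ N => by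
      refine (Finset.sum_le_sum fun j _ => ?_).trans (hC ξ N)
      gcongr
  rcases hp2.eq_or_lt with rfl | hp2
  · refine exists_lintegral_rpow_sum_dyadicPiece_le_of_eq_two hγc hC0 ?_
    simpa using hC' 0 (by linarith)
  set c : ℝ := 2 * b / p with hc
  have hc0 : 0 < c := by positivity
  have hcp : c * p = 2 * b := div_mul_cancel₀ _ (by positivity)
  have hαc : α ≤ c * (p - 1) := by
    rw [hc, div_mul_eq_mul_div, le_div_iff₀ (by positivity)]
    linarith
  have hρ : ∀ (j : ℕ) (r : ℝ), (Real.exp c ^ j) ^ r = Real.exp (j * c * r) := fun j r => by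
    rw [← Real.exp_nat_mul, ← Real.exp_mul]
  refine exists_lintegral_rpow_sum_dyadicPiece_le_of_lt_two (δ := c * (2 - p) / 2) (ρ := Real.exp c)
    hγc hα.le hp1 hp2 (Real.one_lt_exp_iff.2 hc0) (fun j => ?_) (fun j => ?_) hC0
    (hC' _ (by nlinarith))
  · rw [hρ, Real.exp_le_exp, mul_comm, mul_assoc]
    gcongr
  · rw [hρ, ← Real.rpow_intCast, ← Real.exp_mul]
    congr 1; push_cast; ring

end Assembly

section Schwartz

variable {d : ℕ}

open scoped SchwartzMap

theorem SchwartzMap.boundedIntegrable (f : 𝓢(EuclideanSpace ℝ (Fin d), ℂ)) :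
    BoundedIntegrable (f : EuclideanSpace ℝ (Fin d) → ℂ) := by
  obtain ⟨B, hB⟩ := f.decay 0 0
  exact ⟨f.continuous.measurable, f.integrable, B, fun x => by simpa using hB.2 x⟩

theorem BoundedIntegrable.lintegral_rpow_le_one {f : EuclideanSpace ℝ (Fin d) → ℂ}
    (hf : BoundedIntegrable f) {p σ : ℝ} (hp : 1 < p) (hσ : 0 ≤ σ)
    (h : ∫ x, ‖f x‖ ^ p * Real.log (Real.exp 1 + ‖f x‖) ^ σ ≤ 1) :
    ∫⁻ x, ENNReal.ofReal (‖f x‖ ^ p) ≤ 1 := by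
  have hlog : ∀ t : ℝ, 0 ≤ t → 1 ≤ Real.log (Real.exp 1 + t) := fun t ht => by
    rw [Real.le_log_iff_exp_le (by positivity)]
    linarith
  obtain ⟨B, hB⟩ := hf.bounded
  have hint : Integrable fun x => ‖f x‖ ^ p * Real.log (Real.exp 1 + ‖f x‖) ^ σ := by
    refine (hf.integrable.norm.const_mul (B ^ (p - 1) * Real.log (Real.exp 1 + B) ^ σ)).mono' ?_
      (Eventually.of_forall fun x => ?_)
    · have := hf.measurable
      exact Measurable.aestronglyMeasurable (by fun_prop)
    · have h0 := norm_nonneg (f x)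
      have h1 := hlog _ h0
      have hB0 := h0.trans (hB x)
      rw [Real.norm_of_nonneg (by positivity)]
      have e : ‖f x‖ ^ p = ‖f x‖ ^ (p - 1) * ‖f x‖ := by
        rw [← Real.rpow_add_one' h0 (by linarith), sub_add_cancel]
      rw [e, mul_right_comm]
      have h2 : Real.log (Real.exp 1 + ‖f x‖) ≤ Real.log (Real.exp 1 + B) :=
        Real.log_le_log (by positivity) (by linarith [hB x])
      gcongr ?_ ^ _ * ?_ ^ _ * _
      exact hB x
  calc _ ≤ ∫⁻ x, ENNReal.ofReal (‖f x‖ ^ p * Real.log (Real.exp 1 + ‖f x‖) ^ σ) := by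
        refine lintegral_mono fun x => ENNReal.ofReal_le_ofReal ?_
        exact le_mul_of_one_le_right (by positivity)
          (Real.one_le_rpow (hlog _ (norm_nonneg _)) hσ)
    _ = ENNReal.ofReal (∫ x, ‖f x‖ ^ p * Real.log (Real.exp 1 + ‖f x‖) ^ σ) := by
        refine (ofReal_integral_eq_lintegral_ofReal hint (Eventually.of_forall fun x => ?_)).symm
        have := hlog _ (norm_nonneg (f x))
        exact mul_nonneg (by positivity) (Real.rpow_nonneg (by linarith) _)
    _ ≤ 1 := by
        rw [← ENNReal.ofReal_one]
        exact ENNReal.ofReal_le_ofReal h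

end Schwartz

theorem IsStronglySingularIntegralAlong.tendsto_sum_dyadicPiece {d : ℕ}
    {γ : ℝ → EuclideanSpace ℝ (Fin d)} {α β : ℝ}
    {T : SchwartzMap (EuclideanSpace ℝ (Fin d)) ℂ → EuclideanSpace ℝ (Fin d) → ℂ}
    (hT : IsStronglySingularIntegralAlong d γ α β T) (hγ : Continuous γ)
    (f : SchwartzMap (EuclideanSpace ℝ (Fin d)) ℂ) (x : EuclideanSpace ℝ (Fin d)) :
    Tendsto (fun N : ℕ => ∑ j ∈ Finset.range N, dyadicPiece γ α β j f x) atTop (𝓝 (T f x)) := by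
  simp only [← integral_truncated_kernel_eq_sum_dyadicPiece hγ f.continuous]
  refine (hT f x).comp (tendsto_nhdsWithin_iff.2 ⟨?_, Eventually.of_forall fun N => ?_⟩)
  · exact Real.tendsto_exp_neg_atTop_nhds_zero.comp tendsto_natCast_atTop_atTop
  · exact Real.exp_pos _

/-- For well-curved `γ`, `α, β > 0`, `1 < p ≤ 2` with conjugate exponent
`p' = p/(p-1)` satisfying `p' ≤ 2β/((d+1)α)`, the operator `T_γ` maps
`L^p(log L)^{2(1/p - 1/2)}(ℝ^d)` into the Lorentz space `L^{p,p'}(ℝ^d)`: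
if `∫ |f|^p log(e + |f|)^{2(1/p-1/2)} ≤ 1` then the `L^{p,p'}` quasinorm of
`T_γ f` is at most `C`. -/
theorem strongly_singular_LplogL_to_Lorentz
    (d : ℕ) (hd : 0 < d) (γ : ℝ → EuclideanSpace ℝ (Fin d)) (hγ : IsWellCurved d γ)
    (α β : ℝ) (hα : 0 < α) (hβ : 0 < β)
    (p p' : ℝ) (hp1 : 1 < p) (hp2 : p ≤ 2) (hp' : p' = p / (p - 1))
    (hcrit : p' ≤ 2 * β / ((d + 1) * α))
    (T : SchwartzMap (EuclideanSpace ℝ (Fin d)) ℂ → EuclideanSpace ℝ (Fin d) → ℂ)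
    (hT : IsStronglySingularIntegralAlong d γ α β T) :
    ∃ C : ℝ, 0 < C ∧
      ∀ f : SchwartzMap (EuclideanSpace ℝ (Fin d)) ℂ,
        (∫ x, ‖f x‖ ^ p * Real.log (Real.exp 1 + ‖f x‖) ^ (2 * (1 / p - 1 / 2))) ≤ 1 →
          (ENNReal.ofReal p *
              ∫⁻ lam in Set.Ioi (0 : ℝ),
                ENNReal.ofReal (lam ^ (p' - 1)) *
                  volume {x : EuclideanSpace ℝ (Fin d) | lam < ‖T f x‖} ^ (p' / p))
            ^ (1 / p') ≤ ENNReal.ofReal C := by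
  subst hp'
  have hp0 : 0 < p - 1 := by linarith
  have hσ : 0 ≤ 2 * (1 / p - 1 / 2) := by
    have : 1 / 2 ≤ 1 / p := one_div_le_one_div_of_le (by linarith) hp2
    linarith
  have e1 : p / (p - 1) - 1 = (p - 1)⁻¹ := by field_simp; ring
  have e2 : p / (p - 1) / p = (p - 1)⁻¹ := by field_simp
  have hr : 0 ≤ 1 / (p / (p - 1)) := by positivity
  obtain ⟨A, hA⟩ := hγ.exists_lintegral_rpow_sum_dyadicPiece_le hd hα hβ hp1 hp2 hcrit
  have hγc : Continuous γ := hγ.1.continuous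
  refine ⟨(p * max A 1) ^ (1 / (p / (p - 1))), by positivity, fun f hf => ?_⟩
  have hfB := f.boundedIntegrable
  rw [e1, e2, ← ENNReal.ofReal_rpow_of_nonneg (by positivity) hr,
    ENNReal.ofReal_mul (by linarith)]
  gcongr
  refine (lintegral_rpow_volume_le_of_tendsto (fun N => ?_)
    (hT.tendsto_sum_dyadicPiece hγc f) (inv_nonneg.2 hp0.le)
    (hA f hfB (hfB.lintegral_rpow_le_one hp1 hσ hf))).trans
    (ENNReal.ofReal_le_ofReal (le_max_left _ _))
  exact (BoundedIntegrable.sum (Finset.range N) (F := fun j => dyadicPiece γ α β j f)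
    fun j _ => hfB.dyadicPiece hγc j).measurable
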